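/- Let 0 < α < 2, μ ≥ 0, and let B₀ ∈ L^∞ be the initial data for the equation B_t + J B_x + μ Λ^α B = 0, B_x = ℋJ. Then any smooth solution B satisfies the maximum principle ‖B(t)‖_{L^∞} ≤ ‖B₀‖_{L^∞} for all t ≥ 0; more precisely, for 0 ≤ t₁ ≤ t₂, sup_x B(x, t₁) = sup_{(x,t)∈[t₁,t₂]×S¹} B(x,t) and inf_x B(x, t₁) = inf_{(x,t)∈[t₁,t₂]×S¹} B(x,t). -/

import Mathlib

/-!
The maximum principle for the nonlocal transport model
`B_t + J B_x + μ Λ^α B = 0`, `B_x = ℋ J` with `0 < α < 2` (Lemma 6.1 of the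
paper), formulated on `ℝ`.  The fractional Laplacian `Λ^α` is encoded through
its principal-value singular integral representation
`Λ^α B(x) = (1/π) P.V. ∫ (B(x) - B(y)) / |x - y|^{1+α} dy`.
-/

open Filter Topology MeasureTheory

noncomputable section

/-- `H` is the Hilbert transform of `f` on `ℝ`:
`H x = (1/π) P.V. ∫ f y / (x - y) dy`. -/
def IsHilbertPV (f H : ℝ → ℝ) : Prop :=
  ∀ x : ℝ,
    Tendsto (fun ε : ℝ => (1 / Real.pi) * ∫ y in {y : ℝ | ε < |x - y|}, f y / (x - y))
      (𝓝[>] 0) (𝓝 (H x))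

/-- `g = Λ^α f` (for `0 < α < 2`), via the principal-value singular integral
`g x = (1/π) P.V. ∫ (f x - f y)/|x - y|^{1+α} dy`. -/
def IsFracLapPV (α : ℝ) (f g : ℝ → ℝ) : Prop :=
  ∀ x : ℝ,
    Tendsto
      (fun ε : ℝ => (1 / Real.pi) * ∫ y in {y : ℝ | ε < |x - y|}, (f x - f y) / |x - y| ^ (1 + α))
      (𝓝[>] 0) (𝓝 (g x))

open Set (Ioi Icc Ioo indicator Ioc Ici uIcc)
open scoped Real
open Real (log norm_eq_abs pi_pos norm_of_nonneg dist_eq)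

section
lemma schwarz_le (g : ℝ → ℝ) (hc : Continuous g)
    (h : ∀ x, Tendsto (fun h => (g (x+h) + g (x-h) - 2 * g x) / h^2) (𝓝[>] 0) (𝓝 0))
    (p q : ℝ) (hpq : p < q) (x : ℝ) (hx : x ∈ Icc p q) :
    (q-p) * g x ≤ (q-x) * g p + (x-p) * g q := by
  have key : ∀ ε > 0, (q-p) * g x - ((q-x) * g p + (x-p) * g q) + ε * ((x-p)*(x-q)) ≤ 0 := by
    intro ε hε
    set G : ℝ → ℝ := fun x => (q-p) * g x - ((q-x) * g p + (x-p) * g q) + ε * ((x-p)*(x-q)) with hG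
    obtain ⟨z, hz, hmax⟩ := isCompact_Icc.exists_isMaxOn (Set.nonempty_Icc.2 hpq.le)
      (f := G) (by fun_prop : Continuous G).continuousOn
    suffices G z ≤ 0 from (hmax hx).trans this
    by_contra! hpos
    have hzp : z ≠ p := by
      rintro rfl
      simp [hG] at hpos
    have hzq : z ≠ q := by
      rintro rfl
      simp [hG] at hpos
    have hz1 : p < z := lt_of_le_of_ne hz.1 (Ne.symm hzp)
    have hz2 : z < q := lt_of_le_of_ne hz.2 hzq
    have ht : Tendsto (fun h => (q-p) * ((g (z+h) + g (z-h) - 2 * g z) / h^2) + 2*ε) (𝓝[>] 0)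
        (𝓝 ((q-p)*0 + 2*ε)) := ((h z).const_mul _).add_const _
    have hle : ∀ᶠ h in 𝓝[>] (0:ℝ), (q-p) * ((g (z+h) + g (z-h) - 2 * g z) / h^2) + 2*ε ≤ 0 := by
      have : Ioo (0:ℝ) (min (z-p) (q-z)) ∈ 𝓝[>] (0:ℝ) :=
        Ioo_mem_nhdsGT (lt_min (by linarith) (by linarith))
      filter_upwards [this] with h hh
      have h1 : h < z - p := lt_of_lt_of_le hh.2 (min_le_left _ _)
      have h2 : h < q - z := lt_of_lt_of_le hh.2 (min_le_right _ _)
      have h0 := hh.1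
      have a1 : G (z+h) ≤ G z := hmax ⟨by linarith, by linarith⟩
      have a2 : G (z-h) ≤ G z := hmax ⟨by linarith, by linarith⟩
      have e : (q-p) * ((g (z+h) + g (z-h) - 2 * g z) / h^2) + 2*ε
          = (G (z+h) + G (z-h) - 2 * G z) / h^2 := by
        simp only [hG]; field_simp; ring
      rw [e]
      exact div_nonpos_of_nonpos_of_nonneg (by linarith) (by positivity)
    have := le_of_tendsto ht hle
    linarith
  have ht : Tendsto (fun ε => (q-p) * g x - ((q-x) * g p + (x-p) * g q) + ε * ((x-p)*(x-q)))
      (𝓝[>] 0) (𝓝 ((q-p) * g x - ((q-x) * g p + (x-p) * g q) + 0 * ((x-p)*(x-q)))) := by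
    apply Tendsto.mono_left _ nhdsWithin_le_nhds
    exact (by fun_prop : Continuous (fun ε => (q-p) * g x - ((q-x) * g p + (x-p) * g q) + ε * ((x-p)*(x-q)))).tendsto 0
  have := le_of_tendsto ht (eventually_nhdsWithin_of_forall fun ε hε => key ε hε)
  linarith
lemma schwarz_affine (g : ℝ → ℝ) (hc : Continuous g)
    (h : ∀ x, Tendsto (fun h => (g (x+h) + g (x-h) - 2 * g x) / h^2) (𝓝[>] 0) (𝓝 0)) :
    ∃ a b : ℝ, ∀ x, g x = a * x + b := by
  have key : ∀ p q x, p < q → x ∈ Icc p q → (q-p) * g x = (q-x) * g p + (x-p) * g q := by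
    intro p q x hpq hx
    refine le_antisymm (schwarz_le g hc h p q hpq x hx) ?_
    have := schwarz_le (fun x => - g x) hc.neg (fun x => by
      have := (h x).neg
      simp only [neg_zero] at this
      refine this.congr fun y => by ring) p q hpq x hx
    linarith
  refine ⟨g 1 - g 0, g 0, fun x => ?_⟩
  rcases lt_or_ge x 0 with h0 | h0
  · have := key x 1 0 (by linarith) ⟨h0.le, by norm_num⟩
    linarith
  rcases le_or_gt x 1 with h1 | h1
  · have := key 0 1 x (by linarith) ⟨h0, h1⟩
    linarith
  · have := key 0 x 1 (by linarith) ⟨by norm_num, h1.le⟩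
    linarith
end
section
lemma abel_fubini (P md : ℝ → ℝ) (C : ℝ)
    (hP : IntegrableOn (fun r => P r * min r 1) (Ioi 0))
    (hmd : IntegrableOn md (Ioi 0))
    (hH : ∀ σ > 0, ∫ u in Ioo 0 σ, |md u| ≤ C * min σ 1) (h : ℝ) (hh : 0 < h) :
    ∫ r in Ioi 0, P r * ∫ u in Ioo 0 (r/h), md u
      = ∫ u in Ioi 0, md u * ∫ r in Ioi (h*u), P r := by
  have hPm : AEStronglyMeasurable P (volume.restrict (Ioi 0)) := by
    have h1 : AEStronglyMeasurable (fun r => (P r * min r 1) * (min r 1)⁻¹)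
        (volume.restrict (Ioi (0:ℝ))) :=
      hP.1.mul ((by fun_prop : Measurable (fun r : ℝ => (min r 1)⁻¹)).aestronglyMeasurable)
    refine h1.congr ?_
    filter_upwards [ae_restrict_mem measurableSet_Ioi] with r hr
    have : min r 1 ≠ 0 := (lt_min hr one_pos).ne'
    field_simp
  set F : ℝ → ℝ → ℝ := fun r u => if h * u < r then P r * md u else 0 with hF
  have hset : MeasurableSet {z : ℝ × ℝ | h * z.2 < z.1} :=
    measurableSet_lt (by fun_prop) (by fun_prop)
  have hFm : AEStronglyMeasurable (Function.uncurry F)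
      ((volume.restrict (Ioi (0:ℝ))).prod (volume.restrict (Ioi (0:ℝ)))) := by
    have h1 : AEStronglyMeasurable (fun z : ℝ × ℝ => P z.1 * md z.2)
      ((volume.restrict (Ioi (0:ℝ))).prod (volume.restrict (Ioi (0:ℝ)))) :=
      hPm.comp_fst.mul hmd.1.comp_snd
    have h2 := h1.indicator hset
    refine h2.congr (.of_forall fun z => ?_)
    simp [hF, Function.uncurry, indicator]
  have slice : ∀ r : ℝ, ∀ g : ℝ → ℝ, 0 < r → ∫ u in Ioi 0, (if h * u < r then g u else 0)
      = ∫ u in Ioo 0 (r/h), g u := by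
    intro r g hr
    have : (fun u => if h * u < r then g u else 0) = indicator (Set.Iio (r/h)) g := by
      ext u
      have : h * u < r ↔ u < r / h := by rw [lt_div_iff₀ hh, mul_comm]
      simp [indicator, this]
    rw [this, setIntegral_indicator measurableSet_Iio]; rfl
  have hint : Integrable (Function.uncurry F)
      ((volume.restrict (Ioi (0:ℝ))).prod (volume.restrict (Ioi (0:ℝ)))) := by
    rw [integrable_prod_iff hFm]
    constructor
    · refine .of_forall fun r => ?_
      have h1 := (hmd.const_mul (P r)).indicator (measurableSet_lt (f := fun u => h * u) (g := fun _ => r) (by fun_prop) (by fun_prop))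
      refine h1.congr (.of_forall fun u => ?_)
      simp [hF, Function.uncurry, indicator]
    · have hb : IntegrableOn (fun r => (C * max (1/h) 1) * |P r * min r 1|) (Ioi 0) :=
        hP.abs.const_mul _
      refine Integrable.mono' hb (hFm.norm.integral_prod_right') ?_
      filter_upwards [ae_restrict_mem measurableSet_Ioi] with r hr
      have hr : 0 < r := hr
      have e : ∫ u in Ioi 0, ‖Function.uncurry F (r, u)‖ = |P r| * ∫ u in Ioo 0 (r/h), |md u| := by
        rw [← slice r _ hr, ← integral_const_mul]
        congr 1; ext u
        simp only [hF, Function.uncurry]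
        split_ifs <;> simp
      rw [e, norm_eq_abs, abs_of_nonneg (by positivity)]
      have hm : 0 < min r 1 := lt_min hr one_pos
      have h0 := hH (r/h) (by positivity)
      have hC : 0 ≤ C := by
        have h2 : 0 ≤ ∫ u in Ioo 0 1, |md u| := by positivity
        have := hH 1 one_pos
        simp at this; linarith
      have h2 : min (r/h) 1 ≤ max (1/h) 1 * min r 1 := by
        rcases le_total r 1 with h3 | h3
        · rw [min_eq_left h3]
          calc min (r/h) 1 ≤ r/h := min_le_left _ _
            _ = 1/h * r := by ring
            _ ≤ _ := by gcongr; exact le_max_left _ _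
        · rw [min_eq_right h3]
          calc min (r/h) 1 ≤ 1 := min_le_right _ _
            _ ≤ _ := by simp
      rw [abs_mul, abs_of_pos hm]
      calc |P r| * ∫ u in Ioo 0 (r/h), |md u| ≤ |P r| * (C * (max (1/h) 1 * min r 1)) := by
            gcongr; exact h0.trans (by gcongr)
        _ = _ := by ring
  have := integral_integral_swap hint
  have e1 : ∫ r in Ioi 0, P r * ∫ u in Ioo 0 (r/h), md u
      = ∫ r in Ioi 0, ∫ u in Ioi 0, F r u := by
    refine setIntegral_congr_fun measurableSet_Ioi fun r hr => ?_
    rw [← slice r _ hr, ← integral_const_mul]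
    congr 1; ext u; simp only [hF]; split_ifs <;> simp
  rw [e1, this]
  refine setIntegral_congr_fun measurableSet_Ioi fun u hu => ?_
  have hu : 0 < u := hu
  have : (fun r => F r u) = indicator (Ioi (h*u)) (fun r => md u * P r) := by
    ext r; simp [hF, indicator, mul_comm]
  rw [this, setIntegral_indicator measurableSet_Ioi, integral_const_mul]
  congr 3
  ext r; simp; intro h1; nlinarith
lemma abel_limit (P md : ℝ → ℝ) (C L : ℝ)
    (hP : IntegrableOn (fun r => P r * min r 1) (Ioi 0))
    (hmd : IntegrableOn md (Ioi 0))
    (hH : ∀ σ > 0, ∫ u in Ioo 0 σ, |md u| ≤ C * min σ 1)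
    (hG : Tendsto (fun ε => ∫ r in Ioi ε, P r) (𝓝[>] 0) (𝓝 L)) :
    Tendsto (fun h => ∫ r in Ioi 0, P r * ∫ u in Ioo 0 (r/h), md u) (𝓝[>] 0)
      (𝓝 (L * ∫ u in Ioi 0, md u)) := by
  set G : ℝ → ℝ := fun ε => ∫ r in Ioi ε, P r with hGdef
  have hPε : ∀ ε > 0, IntegrableOn P (Ioi ε) := by
    intro ε hε
    have h1 : IntegrableOn (fun r => P r * min r 1) (Ioi ε) :=
      hP.mono_set (Set.Ioi_subset_Ioi hε.le)
    have h2 : IntegrableOn (fun r => (min r 1)⁻¹ * (P r * min r 1)) (Ioi ε) := by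
      refine Integrable.bdd_mul (c := (min ε 1)⁻¹) h1 ((by fun_prop : Measurable (fun r : ℝ => (min r 1)⁻¹)).aestronglyMeasurable) ?_
      filter_upwards [ae_restrict_mem measurableSet_Ioi] with r hr
      have hr : ε < r := hr
      have : 0 < min ε 1 := lt_min hε one_pos
      have h3 : min ε 1 ≤ min r 1 := min_le_min_right _ hr.le
      rw [norm_eq_abs, abs_of_pos (inv_pos.2 (this.trans_le h3))]
      gcongr
    refine h2.congr_fun (fun r hr => ?_) measurableSet_Ioi
    have hr : ε < r := hr
    have : min r 1 ≠ 0 := (lt_min (hε.trans hr) one_pos).ne'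
    field_simp
  -- G bounded
  obtain ⟨D, hD⟩ : ∃ D, ∀ ε > 0, |G ε| ≤ D := by
    have h1 : ∀ᶠ ε in 𝓝[>] (0:ℝ), |G ε| < |L| + 1 := hG.abs.eventually (gt_mem_nhds (by linarith))
    obtain ⟨ε1, hε1, h2⟩ := (mem_nhdsGT_iff_exists_Ioo_subset).1 h1
    have hε1 : 0 < ε1 := hε1
    refine ⟨max (|L|+1) (∫ r in Ioi ε1, |P r|), fun ε hε => ?_⟩
    rcases lt_or_ge ε ε1 with h3 | h3
    · exact le_max_of_le_left (le_of_lt (h2 ⟨hε, h3⟩))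
    · refine le_max_of_le_right ?_
      calc |G ε| ≤ ∫ r in Ioi ε, |P r| := abs_integral_le_integral_abs
        _ ≤ _ := setIntegral_mono_set (hPε ε1 hε1).abs (.of_forall fun _ => abs_nonneg _)
            (Set.Ioi_subset_Ioi h3).eventuallyLE
  have hGc : ∀ h > 0, AEStronglyMeasurable (fun u => G (h*u)) (volume.restrict (Ioi 0)) := by
    intro h hh
    have hcont : ContinuousOn (fun u => G (h*u)) (Ioi 0) := by
      intro u hu
      have hu : 0 < u := hu
      apply ContinuousAt.continuousWithinAt
      have hc : ContinuousAt G (h*u) := by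
        have hpos : 0 < h*u/2 := by positivity
        have e : ∀ᶠ ε in 𝓝 (h*u), G ε = G (h*u/2) - ∫ r in (h*u/2)..ε, P r := by
          filter_upwards [lt_mem_nhds (show h*u/2 < h*u by linarith)] with ε hε
          rw [hGdef]; simp only []
          have := intervalIntegral.integral_interval_add_Ioi (hPε _ hpos) ((hPε _ hpos).mono_set (Set.Ioi_subset_Ioi hε.le))
          linarith
        refine ContinuousAt.congr ?_ (e.mono fun _ h => h.symm)
        refine continuousAt_const.sub ?_
        have hii : IntervalIntegrable P volume (h*u/2) (h*u+1) := by
          rw [intervalIntegrable_iff_integrableOn_Ioc_of_le (by linarith)]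
          exact (hPε _ hpos).mono_set Set.Ioc_subset_Ioi_self
        have := intervalIntegral.continuousOn_primitive_interval' hii (Set.left_mem_uIcc)
        refine this.continuousAt ?_
        rw [Set.uIcc_of_le (by linarith)]
        exact Icc_mem_nhds (by linarith) (by linarith)
      exact ContinuousAt.comp (g := G) (f := fun u => h*u) hc (by fun_prop)
    exact hcont.aestronglyMeasurable measurableSet_Ioi
  have key : Tendsto (fun h => ∫ u in Ioi 0, md u * G (h*u)) (𝓝[>] 0)
      (𝓝 (∫ u in Ioi 0, md u * L)) := by
    refine tendsto_integral_filter_of_dominated_convergence (fun u => D * |md u|) ?_ ?_ ?_ ?_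
    · filter_upwards [self_mem_nhdsWithin] with h hh
      exact hmd.1.mul (hGc h hh)
    · filter_upwards [self_mem_nhdsWithin] with h hh
      have hh : 0 < h := hh
      filter_upwards [ae_restrict_mem measurableSet_Ioi] with u hu
      have hu : 0 < u := hu
      rw [norm_eq_abs, abs_mul, mul_comm]
      gcongr
      exact hD _ (by positivity)
    · exact hmd.abs.const_mul D
    · filter_upwards [ae_restrict_mem measurableSet_Ioi] with u hu
      have hu : 0 < u := hu
      refine Tendsto.const_mul _ (hG.comp ?_)
      refine tendsto_nhdsWithin_iff.2 ⟨?_, ?_⟩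
      · have : Tendsto (fun h => h * u) (𝓝 0) (𝓝 (0*u)) := (continuous_id.mul continuous_const).tendsto 0
        rw [zero_mul] at this
        exact this.mono_left nhdsWithin_le_nhds
      · filter_upwards [self_mem_nhdsWithin] with h hh
        exact mul_pos hh hu
  have e2 : (L * ∫ u in Ioi 0, md u) = ∫ u in Ioi 0, md u * L := by
    rw [integral_mul_const, mul_comm]
  rw [e2]
  refine key.congr' ?_
  filter_upwards [self_mem_nhdsWithin] with h hh
  rw [abel_fubini P md C hP hmd hH h hh]
lemma integrable_fold (F : ℝ → ℝ) (hF : Integrable F) (x : ℝ) :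
    IntegrableOn (fun r => F (x+r) + F (x-r)) (Ioi 0) :=
  (hF.comp_add_left x).integrableOn.add (hF.comp_sub_left x).integrableOn
lemma integral_fold (F : ℝ → ℝ) (hF : Integrable F) (x : ℝ) :
    ∫ y, F y = ∫ r in Ioi 0, (F (x+r) + F (x-r)) := by
  rw [integral_add (hF.comp_add_left x).integrableOn (hF.comp_sub_left x).integrableOn]
  have h1 : ∫ y, F y = ∫ y, F (x+y) := (integral_add_left_eq_self F x).symm
  rw [h1, ← integral_add_compl measurableSet_Ioi (hF.comp_add_left x) (s := Ioi (0:ℝ))]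
  congr 1
  rw [Set.compl_Ioi]
  have := integral_comp_neg_Ioi (0:ℝ) (fun r => F (x + r))
  rw [neg_zero] at this
  rw [← this]; rfl
end
section
def Kf (σ : ℝ) : ℝ := σ * log σ - σ
def kap1 (σ : ℝ) : ℝ := Kf (σ+1) + Kf (σ-1) - 2 * Kf σ
def md (σ : ℝ) : ℝ := kap1 σ + σ * (log (σ+1) + log (σ-1) - 2 * log σ)
lemma Kf_cont : Continuous Kf := by
  unfold Kf; exact Real.continuous_mul_log.sub continuous_id
lemma kap1_cont : Continuous kap1 := by
  unfold kap1
  exact ((Kf_cont.comp (by fun_prop)).add (Kf_cont.comp (by fun_prop))).sub (Kf_cont.const_smul 2 |>.congr (by simp))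
lemma Kf_deriv {σ : ℝ} (h : σ ≠ 0) : HasDerivAt Kf (log σ) σ := by
  have := ((hasDerivAt_id σ).mul (Real.hasDerivAt_log h)).sub (hasDerivAt_id σ)
  refine this.congr_deriv ?_
  simp; field_simp; ring
lemma kap1_deriv {σ : ℝ} (h : 0 < σ) (h1 : σ ≠ 1) :
    HasDerivAt (fun σ => σ * kap1 σ) (md σ) σ := by
  have a1 : HasDerivAt (fun s => Kf (s+1)) (log (σ+1)) σ :=
    (Kf_deriv (by linarith : σ + 1 ≠ 0)).comp_add_const σ 1
  have a2 : HasDerivAt (fun s => Kf (s-1)) (log (σ-1)) σ :=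
    (Kf_deriv (sub_ne_zero.2 h1)).comp_sub_const σ 1
  have := (hasDerivAt_id σ).mul ((a1.add a2).sub ((Kf_deriv h.ne').const_mul 2))
  refine this.congr_deriv ?_
  simp [md, kap1]
lemma md_cont_add_log : ∃ c : ℝ → ℝ, Continuous c ∧ ∀ σ > 0, md σ = c σ + log (σ-1) := by
  refine ⟨fun σ => kap1 σ + ((σ * log (|σ|+1)) + ((σ-1) * log (σ-1)) - 2 * (σ * log σ)), ?_, ?_⟩
  · refine kap1_cont.add ((Continuous.add ?_ ?_).sub (Real.continuous_mul_log.const_smul 2 |>.congr (by simp)))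
    · refine continuous_id.mul (Continuous.log (by fun_prop) fun x => by positivity)
    · exact Real.continuous_mul_log.comp (by fun_prop : Continuous fun x : ℝ => x - 1)
  · intro σ hσ
    simp only [md, abs_of_pos hσ]; ring
lemma md_ii (a b : ℝ) (ha : 0 ≤ a) (hb : 0 ≤ b) : IntervalIntegrable md volume a b := by
  obtain ⟨c, hc, he⟩ := md_cont_add_log
  have h1 : IntervalIntegrable (fun σ => c σ + log (σ-1)) volume a b := by
    refine (hc.intervalIntegrable _ _).add ?_
    exact (intervalIntegral.intervalIntegrable_log' (a := a - 1) (b := b - 1)).comp_sub_right 1 |> fun h => by simpa using h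
  refine h1.congr ?_
  intro σ hσ
  rw [Set.mem_uIoc] at hσ
  rw [he]
  rcases hσ with h | h <;> linarith [h.1]
lemma log_main {z : ℝ} (hz : |z| ≤ 1/2) : |z + z^2/2 + log (1-z)| ≤ 2 * |z|^3 := by
  have := Real.abs_log_sub_add_sum_range_le (x := z) (by linarith) 2
  simp [Finset.sum_range_succ] at this
  norm_num at this
  refine this.trans ?_
  rw [div_le_iff₀ (by linarith)]
  nlinarith [pow_nonneg (abs_nonneg z) 3]
lemma log_pm {σ : ℝ} (hσ : 2 ≤ σ) : ∃ e1 e2 : ℝ, |e1| ≤ 2 / σ^3 ∧ |e2| ≤ 2 / σ^3 ∧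
    log (σ-1) = log σ - 1/σ - 1/(2*σ^2) + e1 ∧
    log (σ+1) = log σ + 1/σ - 1/(2*σ^2) + e2 := by
  have h0 : 0 < σ := by linarith
  have hz : |1/σ| ≤ 1/2 := by
    rw [abs_of_pos (by positivity)]; gcongr
  refine ⟨1/σ + (1/σ)^2/2 + log (1-1/σ), -(1/σ) + (-(1/σ))^2/2 + log (1-(-(1/σ))), ?_, ?_, ?_, ?_⟩
  · refine (log_main hz).trans (le_of_eq ?_)
    rw [abs_of_pos (by positivity)]; field_simp
  · refine (log_main (z := -(1/σ)) (by rwa [abs_neg])).trans (le_of_eq ?_)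
    rw [abs_neg, abs_of_pos (by positivity)]; field_simp
  · have : σ - 1 = σ * (1 - 1/σ) := by field_simp
    have h1 : 1/σ ≤ 1/2 := by rwa [abs_of_pos (by positivity)] at hz
    rw [this, Real.log_mul h0.ne' (by linarith)]
    field_simp; ring
  · have : σ + 1 = σ * (1 - (-(1/σ))) := by field_simp; ring
    have h1 : 0 < 1/σ := by positivity
    rw [this, Real.log_mul h0.ne' (by linarith)]
    field_simp; ring
lemma md_decay {σ : ℝ} (hσ : 2 ≤ σ) : |md σ| ≤ 8 / σ^2 := by
  obtain ⟨e1, e2, h1, h2, l1, l2⟩ := log_pm hσ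
  have h0 : 0 < σ := by linarith
  have : md σ = (2*σ+1)*e2 + (2*σ-1)*e1 := by
    simp only [md, kap1, Kf, l1, l2]; field_simp; ring
  rw [this]
  calc |(2*σ+1)*e2 + (2*σ-1)*e1| ≤ |(2*σ+1)*e2| + |(2*σ-1)*e1| := abs_add_le _ _
    _ = (2*σ+1)*|e2| + (2*σ-1)*|e1| := by
      rw [abs_mul, abs_mul, abs_of_pos (by linarith : 0 < 2*σ+1), abs_of_pos (by linarith : 0 < 2*σ-1)]
    _ ≤ (2*σ+1)*(2/σ^3) + (2*σ-1)*(2/σ^3) := by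
      gcongr; linarith
    _ = 8 / σ^2 := by field_simp; ring
lemma m_lim {σ : ℝ} (hσ : 2 ≤ σ) : |σ * kap1 σ - 1| ≤ 4 / σ := by
  obtain ⟨e1, e2, h1, h2, l1, l2⟩ := log_pm hσ
  have h0 : 0 < σ := by linarith
  have : σ * kap1 σ - 1 = σ * ((σ+1)*e2 + (σ-1)*e1) := by
    simp only [kap1, Kf, l1, l2]; field_simp; ring
  rw [this, abs_mul, abs_of_pos h0]
  calc σ * |(σ+1)*e2 + (σ-1)*e1| ≤ σ * (|(σ+1)*e2| + |(σ-1)*e1|) := by gcongr; exact abs_add_le _ _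
    _ = σ * ((σ+1)*|e2| + (σ-1)*|e1|) := by
      rw [abs_mul, abs_mul, abs_of_pos (by linarith : 0 < σ+1), abs_of_pos (by linarith : 0 < σ-1)]
    _ ≤ σ * ((σ+1)*(2/σ^3) + (σ-1)*(2/σ^3)) := by
      gcongr; linarith
    _ = 4 / σ := by field_simp; ring
lemma md_int : IntegrableOn md (Ioi 0) := by
  rw [← Set.Ioc_union_Ioi_eq_Ioi (show (0:ℝ) ≤ 2 by norm_num)]
  have hm : Measurable md := by
    have h1 : Measurable kap1 := kap1_cont.measurable
    unfold md; fun_prop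
  refine IntegrableOn.union ?_ ?_
  · rw [← intervalIntegrable_iff_integrableOn_Ioc_of_le (by norm_num)]
    exact md_ii 0 2 le_rfl (by norm_num)
  · have : IntegrableOn (fun σ : ℝ => 8 * σ ^ (-2:ℝ)) (Ioi 2) :=
      (integrableOn_Ioi_rpow_of_lt (by norm_num) (by norm_num)).const_mul 8
    refine Integrable.mono' this hm.aestronglyMeasurable ?_
    filter_upwards [ae_restrict_mem measurableSet_Ioi] with σ hσ
    have hσ : 2 < σ := hσ
    refine (md_decay hσ.le).trans (le_of_eq ?_)
    rw [Real.rpow_neg (by linarith), Real.rpow_two]; rfl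
lemma md_primitive {σ : ℝ} (hσ : 0 < σ) : ∫ u in Ioo 0 σ, md u = σ * kap1 σ := by
  rw [← integral_Ioc_eq_integral_Ioo, ← intervalIntegral.integral_of_le hσ.le]
  have := integral_eq_of_hasDerivAt_off_countable_of_le (fun σ => σ * kap1 σ) md hσ.le
    (s := {1}) (Set.countable_singleton 1) (by have := kap1_cont; fun_prop)
    (fun x hx => kap1_deriv hx.1.1 hx.2) (md_ii 0 σ le_rfl hσ.le)
  rw [this]; simp
lemma md_total : ∫ u in Ioi 0, md u = 1 := by
  have h1 := intervalIntegral_tendsto_integral_Ioi 0 md_int tendsto_id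
  have h2 : Tendsto (fun σ : ℝ => σ * kap1 σ) atTop (𝓝 1) := by
    have h3 : Tendsto (fun σ : ℝ => 4 / σ) atTop (𝓝 0) := tendsto_const_nhds.div_atTop tendsto_id
    rw [tendsto_iff_dist_tendsto_zero]
    refine squeeze_zero' (.of_forall fun _ => dist_nonneg) ?_ h3
    filter_upwards [eventually_ge_atTop 2] with σ hσ
    exact m_lim hσ
  refine tendsto_nhds_unique (h1.congr' ?_) h2
  filter_upwards [eventually_gt_atTop 0] with σ hσ
  rw [id, intervalIntegral.integral_of_le (le_of_lt hσ), integral_Ioc_eq_integral_Ioo, md_primitive hσ]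
lemma md_H : ∃ C, ∀ σ > 0, ∫ u in Ioo 0 σ, |md u| ≤ C * min σ 1 := by
  obtain ⟨c, hc, he⟩ := md_cont_add_log
  have hcont : ContinuousOn (fun σ => |c σ + log (σ-1)|) (Icc 0 (1/2)) := by
    refine (hc.continuousOn.add (ContinuousOn.log (by fun_prop) ?_)).abs
    intro x hx; have := hx.2; intro h; norm_num at this; linarith
  obtain ⟨C0, hC0⟩ := isCompact_Icc.bddAbove_image hcont
  have hC0 : ∀ σ, 0 < σ → σ ≤ 1/2 → |md σ| ≤ C0 := fun σ h1 h2 => by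
    rw [he σ h1]; exact hC0 ⟨σ, ⟨h1.le, h2⟩, rfl⟩
  set T := ∫ u in Ioi 0, |md u|
  have hT0 : 0 ≤ T := by positivity
  refine ⟨max C0 (2*T), fun σ hσ => ?_⟩
  rcases le_or_gt σ (1/2) with h | h
  · rw [min_eq_left (by linarith)]
    have : ‖∫ u in Ioo 0 σ, |md u|‖ ≤ C0 * volume.real (Ioo 0 σ) := by
      refine norm_setIntegral_le_of_norm_le_const (by simp) fun u hu => ?_
      simpa using hC0 u hu.1 (by linarith [hu.2])
    rw [Real.volume_real_Ioo_of_le hσ.le, sub_zero] at this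
    refine (le_abs_self _).trans (this.trans ?_)
    gcongr; exact le_max_left _ _
  · have h1 : ∫ u in Ioo 0 σ, |md u| ≤ T :=
      setIntegral_mono_set md_int.abs (.of_forall fun _ => abs_nonneg _)
        (Set.Ioo_subset_Ioi_self).eventuallyLE
    have h2 : 1/2 ≤ min σ 1 := le_min h.le (by norm_num)
    calc _ ≤ T := h1
      _ = (2*T) * (1/2) := by ring
      _ ≤ _ := by gcongr; exact le_max_right _ _
end
section
def Rk (x s : ℝ) : ℝ := Kf (x-s) - Kf (-s) - x * (log (1+s^2)/2)
lemma Kf_bound (σ : ℝ) : |Kf σ| ≤ 2*σ^2 + 2 := by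
  have h1 : |σ * log σ| ≤ σ^2 + 1 := by
    have hpos : ∀ τ : ℝ, 0 < τ → |τ * log τ| ≤ τ^2 + 1 := by
      intro τ h
      rcases le_total τ 1 with h1 | h1
      · have := Real.abs_log_mul_self_lt τ h h1
        rw [mul_comm] at this
        nlinarith [sq_nonneg τ]
      · rw [abs_of_nonneg (mul_nonneg h.le (Real.log_nonneg h1))]
        have := Real.log_le_sub_one_of_pos h
        nlinarith
    rcases lt_trichotomy σ 0 with h | h | h
    · have := hpos (-σ) (by linarith)
      rw [Real.log_neg_eq_log, neg_mul, abs_neg, neg_sq] at this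
      exact this
    · simp [h]
    · exact hpos σ h
  unfold Kf
  have h2 : |σ| ≤ σ^2 + 1 := by nlinarith [sq_abs σ, sq_nonneg (|σ|-1), abs_nonneg σ]
  calc |σ * log σ - σ| ≤ |σ * log σ| + |σ| := abs_sub _ _
    _ ≤ _ := by linarith
lemma abs_log_one_sub {z : ℝ} (hz : |z| ≤ 1/2) : |log (1-z)| ≤ 2*|z| := by
  have h1 := log_main hz
  have h0 := abs_nonneg z
  have h2 : |log (1-z)| ≤ |z + z^2/2 + log (1-z)| + |z + z^2/2| := by
    have := abs_sub (z + z^2/2 + log (1-z)) (z + z^2/2)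
    simpa using this
  have h3 : |z + z^2/2| ≤ |z| + |z|^2/2 := by
    refine (abs_add_le _ _).trans ?_
    rw [abs_of_nonneg (by positivity : 0 ≤ z^2/2), sq_abs]
  nlinarith [mul_nonneg h0 h0, mul_nonneg h0 (mul_nonneg h0 h0), mul_nonneg h0 (sub_nonneg.2 hz), mul_nonneg (mul_nonneg h0 h0) (sub_nonneg.2 hz)]
lemma Rk_bound (x s : ℝ) : |Rk x s| ≤ 64 * (1+|x|)^3 / (1+|s|) := by
  have hx0 := abs_nonneg x
  have hs0 := abs_nonneg s
  rw [le_div_iff₀ (by positivity)]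
  rcases le_total (|s|) (2*|x|+1) with h | h
  · have b1 := Kf_bound (x-s)
    have b2 := Kf_bound (-s)
    have b3 : |x * (log (1+s^2)/2)| ≤ |x| * |s| := by
      rw [abs_mul]
      refine mul_le_mul_of_nonneg_left ?_ hx0
      rw [abs_of_nonneg (div_nonneg (Real.log_nonneg (by nlinarith [sq_nonneg s])) (by norm_num))]
      have e : log (1+s^2) ≤ log ((1+|s|)^2) :=
        Real.log_le_log (by positivity) (by nlinarith [sq_abs s])
      rw [Real.log_pow] at e
      have := Real.log_le_sub_one_of_pos (show 0 < 1+|s| by positivity)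
      push_cast at e
      linarith
    have hb : |Rk x s| ≤ |Kf (x-s)| + |Kf (-s)| + |x * (log (1+s^2)/2)| := by
      unfold Rk
      exact (abs_sub _ _).trans (add_le_add_left (abs_sub _ _) _)
    have c1 : (x-s)^2 ≤ (3*|x|+1)^2 := by
      rw [← sq_abs (x-s)]
      gcongr
      exact (abs_sub _ _).trans (by linarith)
    have c2 : (-s)^2 ≤ (2*|x|+1)^2 := by
      rw [← sq_abs (-s), abs_neg]; gcongr
    have c3 : |Rk x s| ≤ 32 * (1+|x|)^2 := by nlinarith
    calc |Rk x s| * (1+|s|) ≤ (32 * (1+|x|)^2) * (2*(1+|x|)) := by gcongr; linarith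
      _ = _ := by ring
  · have hs1 : 1 ≤ |s| := by linarith
    have hs : s ≠ 0 := by intro h; simp [h] at hs1; linarith
    have d1 : |Kf (x-s) - Kf (-s) - x * log s| ≤ (2*|x|/|s|) * |x| := by
      have := (convex_uIcc (0:ℝ) x).norm_image_sub_le_of_norm_hasDerivWithin_le
        (f := fun u => Kf (u-s) - u * log s) (f' := fun u => log (u-s) - log s)
        (C := 2*|x|/|s|) (x := 0) (y := x) ?_ ?_ Set.left_mem_uIcc Set.right_mem_uIcc
      · simp only [norm_eq_abs, zero_sub, zero_mul, sub_zero] at this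
        refine le_trans (le_of_eq ?_) this
        congr 1; ring
      · intro u hu
        have hu' : |u| ≤ |x| := by
          have := Set.abs_sub_left_of_mem_uIcc hu; simpa using this
        have hne : u - s ≠ 0 := by
          intro h'; have : u = s := by linarith
          rw [this] at hu'; linarith
        have := ((Kf_deriv hne).comp_sub_const u s).sub ((hasDerivAt_id u).mul_const (log s))
        refine HasDerivAt.hasDerivWithinAt (this.congr_deriv (by simp))
      · intro u hu
        have hu' : |u| ≤ |x| := by
          have := Set.abs_sub_left_of_mem_uIcc hu; simpa using this
        have hz : |u/s| ≤ 1/2 := by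
          rw [abs_div, div_le_iff₀ (by positivity)]; linarith
        have hne : (1 - u/s) ≠ 0 := by
          have := abs_le.1 hz; linarith [this.2]
        have e : log (u-s) - log s = log (1-u/s) := by
          have : u - s = (-s) * (1-u/s) := by field_simp; ring
          rw [this, Real.log_mul (neg_ne_zero.2 hs) hne, Real.log_neg_eq_log]; ring
        rw [e, norm_eq_abs]
        refine (abs_log_one_sub hz).trans ?_
        rw [abs_div, mul_div_assoc]; gcongr
    have d2 : |x * log s - x * (log (1+s^2)/2)| ≤ |x| / |s| := by
      rw [← mul_sub, abs_mul, div_eq_mul_inv |x| |s|]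
      refine mul_le_mul_of_nonneg_left ?_ hx0
      have e : log s - log (1+s^2)/2 = -(log (1+1/s^2)/2) := by
        have : 1+s^2 = s^2 * (1+1/s^2) := by field_simp; ring
        rw [this, Real.log_mul (by positivity) (by positivity), Real.log_pow]; push_cast; ring
      rw [e, abs_neg, abs_of_nonneg (div_nonneg (Real.log_nonneg (by simp; positivity)) (by norm_num))]
      have := Real.log_le_sub_one_of_pos (show 0 < 1+1/s^2 by positivity)
      have h3 : 1/s^2 ≤ |s|⁻¹ := by
        rw [← sq_abs, one_div]
        gcongr
        nlinarith
      have : 0 ≤ |s|⁻¹ := by positivity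
      linarith
    have d3 : |Rk x s| ≤ (2*|x|/|s|) * |x| + |x|/|s| := by
      have e : Rk x s = (Kf (x-s) - Kf (-s) - x * log s) + (x * log s - x * (log (1+s^2)/2)) := by
        unfold Rk; ring
      rw [e]; exact (abs_add_le _ _).trans (add_le_add d1 d2)
    calc |Rk x s| * (1+|s|) ≤ ((2*|x|/|s|) * |x| + |x|/|s|) * (2*|s|) := by gcongr; linarith
      _ = 4*|x|^2 + 2*|x| := by field_simp; ring
      _ ≤ _ := by nlinarith [mul_nonneg hx0 hx0, mul_nonneg hx0 (mul_nonneg hx0 hx0)]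
end
section
lemma J_mul_int (J g : ℝ → ℝ) (hJ : Integrable (fun s => J s / (1+|s|))) (C : ℝ)
    (hg : Measurable g) (hb : ∀ s, |g s| ≤ C / (1+|s|)) : Integrable (fun s => J s * g s) := by
  have h1 : Integrable (fun s => ((1+|s|) * g s) * (J s / (1+|s|))) := by
    refine Integrable.bdd_mul (c := C) hJ (by fun_prop) (.of_forall fun s => ?_)
    have : 0 < 1 + |s| := by positivity
    rw [norm_eq_abs, abs_mul, abs_of_pos this]
    have := hb s
    rw [le_div_iff₀ (by positivity)] at this; linarith
  refine h1.congr (.of_forall fun s => ?_)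
  have : 0 < 1 + |s| := by positivity
  simp only []; field_simp
lemma Rk_meas (x : ℝ) : Measurable (Rk x) := by
  have := Kf_cont.measurable
  unfold Rk; fun_prop
lemma Rk_contx (s : ℝ) : Continuous (fun x => Rk x s) := by
  have := Kf_cont
  unfold Rk; fun_prop
def Vf (J : ℝ → ℝ) (x : ℝ) : ℝ := ∫ s, J s * Rk x s
lemma JRk_int (J : ℝ → ℝ) (hJ : Integrable (fun s => J s / (1+|s|))) (x : ℝ) :
    Integrable (fun s => J s * Rk x s) :=
  J_mul_int J _ hJ _ (Rk_meas x) (Rk_bound x)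
lemma Vf_cont (J : ℝ → ℝ) (hJ : Integrable (fun s => J s / (1+|s|))) : Continuous (Vf J) := by
  rw [continuous_iff_continuousAt]
  intro x0
  refine continuousAt_of_dominated (bound := fun s => 64*(2+|x0|)^3 * |J s / (1+|s|)|) ?_ ?_ ?_ ?_
  · exact .of_forall fun x => (JRk_int J hJ x).1
  · filter_upwards [Metric.ball_mem_nhds x0 one_pos] with x hx
    refine .of_forall fun s => ?_
    have hx : |x| ≤ |x0| + 1 := by
      rw [Metric.mem_ball, dist_eq] at hx
      have := abs_sub_abs_le_abs_sub x x0; linarith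
    rw [norm_eq_abs, abs_mul, abs_div]
    have hp : 0 < 1 + |s| := by positivity
    rw [abs_of_pos hp]
    calc |J s| * |Rk x s| ≤ |J s| * (64*(2+|x0|)^3 / (1+|s|)) := by
          gcongr
          refine (Rk_bound x s).trans ?_
          have h5 : 1+|x| ≤ 2+|x0| := by linarith
          gcongr 64 * ?_^3 / _
      _ = _ := by ring
  · exact hJ.abs.const_mul _
  · exact .of_forall fun s => ((Rk_contx s).const_smul (J s)).continuousAt
lemma Kf_neg (σ : ℝ) : Kf (-σ) = - Kf σ := by
  unfold Kf; rw [Real.log_neg_eq_log]; ring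
lemma Kf_scale {h : ℝ} (hh : 0 < h) (σ : ℝ) : Kf (h*σ) = h * Kf σ + h * σ * log h := by
  unfold Kf
  rcases eq_or_ne σ 0 with h0 | h0
  · simp [h0]
  · rw [Real.log_mul hh.ne' h0]; ring
lemma d2K {h : ℝ} (hh : 0 < h) (r : ℝ) : Kf (r+h) + Kf (r-h) - 2 * Kf r = h * kap1 (r/h) := by
  have e1 : r + h = h * (r/h + 1) := by field_simp
  have e2 : r - h = h * (r/h - 1) := by field_simp
  have e3 : r = h * (r/h) := by field_simp
  rw [e1, e2, Kf_scale hh, Kf_scale hh]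
  conv_lhs => rw [show 2 * Kf r = 2 * Kf (h*(r/h)) by rw [← e3]]
  rw [Kf_scale hh, kap1]; ring
lemma Vf_d2 (J : ℝ → ℝ) (hJ : Integrable (fun s => J s / (1+|s|))) (x h : ℝ) (hh : 0 < h) :
    (Vf J (x+h) + Vf J (x-h) - 2 * Vf J x) / h^2 =
      ∫ r in Ioi 0, ((J (x-r) - J (x+r))/r) * ∫ u in Ioo 0 (r/h), md u := by
  set F : ℝ → ℝ := fun s => J s * Rk (x+h) s + J s * Rk (x-h) s - 2 * (J s * Rk x s) with hF
  have hFi : Integrable F := ((JRk_int J hJ _).add (JRk_int J hJ _)).sub ((JRk_int J hJ _).const_mul 2)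
  have e1 : Vf J (x+h) + Vf J (x-h) - 2 * Vf J x = ∫ s, F s := by
    have h1 := integral_sub ((JRk_int J hJ (x+h)).add (JRk_int J hJ (x-h))) ((JRk_int J hJ x).const_mul 2)
    have h2 := integral_add (JRk_int J hJ (x+h)) (JRk_int J hJ (x-h))
    have h3 := integral_const_mul (μ := volume) 2 (fun s => J s * Rk x s)
    unfold Vf
    rw [← h2, ← h3]; exact h1.symm
  rw [e1, integral_fold F hFi x, div_eq_inv_mul, ← integral_const_mul]
  refine setIntegral_congr_fun measurableSet_Ioi fun r hr => ?_
  have hr : 0 < r := hr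
  rw [md_primitive (by positivity)]
  have a1 : F (x+r) = - (J (x+r) * (h * kap1 (r/h))) := by
    rw [← d2K hh r]
    simp only [hF, Rk]
    rw [show x + h - (x+r) = -(r-h) by ring, show x - h - (x+r) = -(r+h) by ring,
      show x - (x+r) = -r by ring, Kf_neg (r-h), Kf_neg (r+h), Kf_neg r]; ring
  have a2 : F (x-r) = J (x-r) * (h * kap1 (r/h)) := by
    rw [← d2K hh r]
    simp only [hF, Rk]
    rw [show x + h - (x-r) = (r+h) by ring, show x - h - (x-r) = r-h by ring,
      show x - (x-r) = r by ring]; ring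
  rw [a1, a2]; field_simp; ring
lemma P_int (J : ℝ → ℝ) (hJ : Integrable (fun s => J s / (1+|s|))) (x : ℝ) :
    IntegrableOn (fun r => ((J (x-r) - J (x+r))/r) * min r 1) (Ioi 0) := by
  have gen : ∀ τ : ℝ → ℝ, Measurable τ → (∀ r, |τ r| ≤ |x| + |r|) → Integrable (fun r => J (τ r) / (1+|τ r|)) →
      IntegrableOn (fun r => (J (τ r)/r) * min r 1) (Ioi 0) := by
    intro τ hτ hb hi
    have h1 : IntegrableOn (fun r => ((1+|τ r|) * (min r 1 / r)) * (J (τ r) / (1+|τ r|))) (Ioi 0) := by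
      refine Integrable.bdd_mul (c := 2+|x|) hi.integrableOn (by fun_prop) ?_
      filter_upwards [ae_restrict_mem measurableSet_Ioi] with r hr
      have hr : 0 < r := hr
      have hm : 0 < min r 1 := lt_min hr one_pos
      have h2 := hb r
      rw [abs_of_pos hr] at h2
      have := abs_nonneg x
      rw [norm_eq_abs, abs_of_pos (by positivity), ← mul_div_assoc, div_le_iff₀ hr]
      rcases le_total r 1 with h3 | h3
      · rw [min_eq_left h3]; nlinarith
      · rw [min_eq_right h3]; nlinarith
    refine h1.congr (.of_forall fun r => ?_)
    have : 0 < 1 + |τ r| := by positivity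
    simp only []; field_simp
  have h1 := gen (fun r => x - r) (by fun_prop) (fun r => abs_sub _ _) (hJ.comp_sub_left x)
  have h2 := gen (fun r => x + r) (by fun_prop) (fun r => abs_add_le _ _) (hJ.comp_add_left x)
  refine (h1.sub h2).congr (.of_forall fun r => ?_)
  simp only [Pi.sub_apply]; ring
lemma G_eq (J : ℝ → ℝ) (hJ : Integrable (fun s => J s / (1+|s|))) (x ε : ℝ) (hε : 0 < ε) :
    ∫ y in {y : ℝ | ε < |x - y|}, J y / (x - y) = ∫ r in Ioi ε, (J (x-r) - J (x+r))/r := by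
  have hS : MeasurableSet {y : ℝ | ε < |x - y|} := measurableSet_lt (by fun_prop) (by fun_prop)
  rw [← integral_indicator hS]
  have hi : Integrable (indicator {y : ℝ | ε < |x - y|} (fun y => J y / (x - y))) := by
    have := J_mul_int J (indicator {y : ℝ | ε < |x - y|} (fun y => 1 / (x - y))) hJ
      ((1+|x|)/ε + 1) ((by fun_prop : Measurable fun y : ℝ => 1/(x-y)).indicator hS) ?_
    · refine this.congr (.of_forall fun y => ?_)
      simp only [indicator]; split_ifs <;> simp; ring
    · intro y
      simp only [indicator]
      split_ifs with h
      · have h : ε < |x-y| := h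
        have h1 : |y| ≤ |x| + |x-y| := by
          have := abs_sub x (x-y); simpa using this
        have h0 := abs_nonneg x
        have : (1+|x|) ≤ (1+|x|)/ε * |x-y| := by
          rw [div_mul_eq_mul_div, le_div_iff₀ hε]; gcongr
        rw [abs_div, abs_one, div_le_div_iff₀ (by linarith) (by positivity)]
        nlinarith
      · simp; positivity
  rw [integral_fold _ hi x]
  have e : ∀ r ∈ Ioi (0:ℝ), (indicator {y : ℝ | ε < |x - y|} (fun y => J y / (x - y)) (x+r)
      + indicator {y : ℝ | ε < |x - y|} (fun y => J y / (x - y)) (x-r))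
      = indicator (Ioi ε) (fun r => (J (x-r) - J (x+r))/r) r := by
    intro r hr
    have hr : 0 < r := hr
    simp only [indicator, Set.mem_ofPred_eq, Set.mem_Ioi, sub_add_cancel_left, abs_neg, sub_sub_cancel, abs_of_pos hr]
    split_ifs
    · field_simp; ring
    · simp
  rw [setIntegral_congr_fun measurableSet_Ioi e, setIntegral_indicator measurableSet_Ioi]
  congr 2
  ext r; simp; intro h; linarith
lemma Vf_limit (J : ℝ → ℝ) (hJ : Integrable (fun s => J s / (1+|s|))) (x a : ℝ)
    (ha : Tendsto (fun ε : ℝ => (1 / π) * ∫ y in {y : ℝ | ε < |x - y|}, J y / (x - y))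
      (𝓝[>] 0) (𝓝 a)) :
    Tendsto (fun h => (Vf J (x+h) + Vf J (x-h) - 2 * Vf J x) / h^2) (𝓝[>] 0) (𝓝 (π * a)) := by
  obtain ⟨C, hC⟩ := md_H
  have h1 : Tendsto (fun ε => ∫ r in Ioi ε, (J (x-r) - J (x+r))/r) (𝓝[>] 0) (𝓝 (π * a)) := by
    refine (ha.const_mul π).congr' ?_
    filter_upwards [self_mem_nhdsWithin] with ε hε
    rw [G_eq J hJ x ε hε]
    have := pi_pos
    field_simp
  have := abel_limit _ md C _ (P_int J hJ x) md_int hC h1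
  rw [md_total, mul_one] at this
  refine this.congr' ?_
  filter_upwards [self_mem_nhdsWithin] with h hh
  rw [Vf_d2 J hJ x h hh]
lemma d2_limit (F f : ℝ → ℝ) (a x : ℝ) (hF : ∀ y, HasDerivAt F (f y) y) (hf : HasDerivAt f a x) :
    Tendsto (fun h => (F (x+h) + F (x-h) - 2 * F x) / h^2) (𝓝[>] 0) (𝓝 a) := by
  have hd : ∀ h, HasDerivAt (fun h => F (x+h) + F (x-h) - 2 * F x) (f (x+h) - f (x-h)) h := by
    intro h
    have a1 : HasDerivAt (fun h => F (x+h)) (f (x+h)) h := (hF (x+h)).comp_const_add x h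
    have a2 : HasDerivAt (fun h => F (x-h)) (-f (x-h)) h := (hF (x-h)).comp_const_sub x h
    exact ((a1.add a2).sub_const _).congr_deriv (by ring)
  have hd2 : ∀ h : ℝ, HasDerivAt (fun h => h^2) (2*h) h := fun h => by simpa using hasDerivAt_pow 2 h
  refine HasDerivAt.lhopital_zero_nhdsGT (.of_forall hd) (.of_forall hd2) ?_ ?_ ?_ ?_
  · filter_upwards [self_mem_nhdsWithin] with h hh
    have hh : 0 < h := hh
    positivity
  · have := (hd 0).continuousAt.tendsto
    refine (this.mono_left nhdsWithin_le_nhds).congr' (.of_forall fun _ => rfl) |>.trans_eq ?_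
    simp; ring
  · have := (hd2 0).continuousAt.tendsto
    simp at this
    exact this.mono_left nhdsWithin_le_nhds
  · have b1 : HasDerivAt (fun h => f (x+h)) a 0 := by
      have : HasDerivAt f a (x+0) := by simpa using hf
      exact this.comp_const_add x 0
    have b2 : HasDerivAt (fun h => f (x-h)) (-a) 0 := by
      have : HasDerivAt f a (x-0) := by simpa using hf
      exact this.comp_const_sub x 0
    have := (b1.sub b2).tendsto_slope_zero_right
    have h3 := this.const_mul (1/2)
    rw [show (1/2:ℝ) * (a - -a) = a by ring] at h3
    refine h3.congr' ?_
    filter_upwards [self_mem_nhdsWithin] with h hh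
    have hh : 0 < h := hh
    simp; field_simp
lemma Vf_affine (J f : ℝ → ℝ) (hJ : Integrable (fun s => J s / (1+|s|))) (hf : Differentiable ℝ f)
    (h : IsHilbertPV J (deriv f)) :
    ∃ a b : ℝ, ∀ x, Vf J x = π * (∫ u in (0:ℝ)..x, f u) + (a * x + b) := by
  have hF : ∀ y, HasDerivAt (fun x => ∫ u in (0:ℝ)..x, f u) (f y) y := fun y =>
    intervalIntegral.integral_hasDerivAt_right (hf.continuous.intervalIntegrable _ _)
      (hf.continuous.stronglyMeasurableAtFilter _ _) hf.continuous.continuousAt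
  have hFc : Continuous (fun x => ∫ u in (0:ℝ)..x, f u) :=
    continuous_iff_continuousAt.2 fun y => (hF y).continuousAt
  obtain ⟨a, b, hab⟩ := schwarz_affine (fun x => Vf J x - π * ∫ u in (0:ℝ)..x, f u)
    ((Vf_cont J hJ).sub (hFc.const_smul π)) (fun x => by
      have h1 := (Vf_limit J hJ x _ (h x)).sub ((d2_limit _ f _ x hF (hf x).hasDerivAt).const_mul π)
      rw [sub_self] at h1
      refine h1.congr fun t => by ring)
  exact ⟨a, b, fun x => by have := hab x; linarith⟩
end
section
def Q0 (a x : ℝ) : ℝ := x / (x^2 + a^2)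
def Q1 (a x : ℝ) : ℝ := (a^2 - x^2) / (x^2 + a^2)^2
def Q2 (a x : ℝ) : ℝ := 2 * x * (x^2 - 3*a^2) / (x^2 + a^2)^3
def w0 (a b x : ℝ) : ℝ := Q0 a x - Q0 b x
def w1 (a b x : ℝ) : ℝ := Q1 a x - Q1 b x
def w2 (a b x : ℝ) : ℝ := Q2 a x - Q2 b x
lemma Q0_deriv {a : ℝ} (ha : 0 < a) (x : ℝ) : HasDerivAt (Q0 a) (Q1 a x) x := by
  have h : x^2 + a^2 ≠ 0 := by positivity
  have := (hasDerivAt_id x).div (((hasDerivAt_pow 2 x).add_const (a^2))) h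
  refine this.congr_deriv ?_
  simp [Q1]; field_simp; ring
lemma Q1_deriv {a : ℝ} (ha : 0 < a) (x : ℝ) : HasDerivAt (Q1 a) (Q2 a x) x := by
  have h : x^2 + a^2 ≠ 0 := by positivity
  have := (((hasDerivAt_pow 2 x).const_sub (a^2))).div ((((hasDerivAt_pow 2 x).add_const (a^2))).pow 2) (pow_ne_zero 2 h)
  refine this.congr_deriv ?_
  simp [Q2]; field_simp; ring
lemma w0_deriv {a b : ℝ} (ha : 0 < a) (hb : 0 < b) (x : ℝ) : HasDerivAt (w0 a b) (w1 a b x) x :=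
  (Q0_deriv ha x).sub (Q0_deriv hb x)
lemma w1_deriv {a b : ℝ} (ha : 0 < a) (hb : 0 < b) (x : ℝ) : HasDerivAt (w1 a b) (w2 a b x) x :=
  (Q1_deriv ha x).sub (Q1_deriv hb x)
lemma w2_cont {a b : ℝ} (ha : 0 < a) (hb : 0 < b) : Continuous (w2 a b) := by
  unfold w2 Q2
  refine Continuous.sub (Continuous.div (by fun_prop) (by fun_prop) fun x => by positivity)
    (Continuous.div (by fun_prop) (by fun_prop) fun x => by positivity)
lemma p_le {a : ℝ} (ha : 0 < a) (x : ℝ) : 1/(x^2+a^2) ≤ (1 + 1/a^2) / (1+x^2) := by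
  rw [div_le_div_iff₀ (by positivity) (by positivity)]
  have : (1 + 1/a^2) * (x^2+a^2) = x^2 + a^2 + x^2/a^2 + 1 := by field_simp; ring
  rw [this]
  have : 0 ≤ x^2/a^2 := by positivity
  nlinarith [sq_nonneg a]
lemma w_bounds {a b : ℝ} (ha : 0 < a) (hb : 0 < b) : ∃ C, 0 ≤ C ∧ ∀ x,
    |w0 a b x| ≤ C / (1+x^2) ∧ |w1 a b x| ≤ C / (1+x^2)^2 ∧ |w2 a b x| ≤ C * |x| / (1+x^2)^3 := by
  set A := 1 + 1/a^2
  set B := 1 + 1/b^2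
  have hA : 1 ≤ A := by have : 0 ≤ 1/a^2 := by positivity
                        linarith
  have hB : 1 ≤ B := by have : 0 ≤ 1/b^2 := by positivity
                        linarith
  set D := |b^2 - a^2|
  have hD : 0 ≤ D := abs_nonneg _
  refine ⟨D * A * B * (18 * (A + B)), by positivity, fun x => ?_⟩
  set p := 1/(x^2+a^2) with hp
  set q := 1/(x^2+b^2) with hq
  set y := 1/(1+x^2) with hy
  have hp0 : 0 < p := by positivity
  have hq0 : 0 < q := by positivity
  have hy0 : 0 < y := by positivity
  have hpA : p ≤ A * y := by have := p_le ha x; rw [hy, mul_one_div]; exact this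
  have hqB : q ≤ B * y := by have := p_le hb x; rw [hy, mul_one_div]; exact this
  have hxp : x^2 * p ≤ 1 := by rw [hp, mul_one_div, div_le_one (by positivity)]; nlinarith [sq_nonneg a]
  have hxq : x^2 * q ≤ 1 := by rw [hq, mul_one_div, div_le_one (by positivity)]; nlinarith [sq_nonneg b]
  have hx0 : 0 ≤ |x| := abs_nonneg x
  have hxy : |x| * y ≤ 1 := by
    rw [hy, mul_one_div, div_le_one (by positivity)]
    nlinarith [sq_abs x, sq_nonneg (|x|-1)]
  have hpq : p * q ≤ A * B * y^2 := by
    calc p * q ≤ (A*y)*(B*y) := by gcongr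
      _ = _ := by ring
  have e0 : w0 a b x = (b^2-a^2) * (x * (p*q)) := by
    simp only [w0, Q0, hp, hq]; field_simp; ring
  have e1 : w1 a b x = (b^2-a^2) * ((p*q) * (1 - 2*(x^2*p) - 2*(x^2*q))) := by
    simp only [w1, Q1, hp, hq]; field_simp; ring
  have e2 : w2 a b x = (b^2-a^2) * ((x * (p*q)) * (-2*(p+q)*(1 - 2*(x^2*p) - 2*(x^2*q)) - 4*(p+q) + 4*(x^2*p)*p + 4*(x^2*q)*q)) := by
    simp only [w2, Q2, hp, hq]; field_simp; ring
  have hxp0 : 0 ≤ x^2 * p := by positivity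
  have hxq0 : 0 ≤ x^2 * q := by positivity
  have hAB : 1 ≤ A * B := by nlinarith
  have hbig : 5 ≤ 18 * (A+B) := by linarith
  refine ⟨?_, ?_, ?_⟩
  · rw [e0, abs_mul, abs_mul, abs_of_pos (by positivity : 0 < p * q), div_eq_mul_one_div, ← hy]
    calc D * (|x| * (p*q)) ≤ D * (|x| * (A*B*y^2)) := by gcongr
      _ = D * A * B * y * (|x| * y) := by ring
      _ ≤ D * A * B * y * (18 * (A+B)) := mul_le_mul_of_nonneg_left (by linarith) (by positivity)
      _ = _ := by ring
  · rw [e1, abs_mul, abs_mul, abs_of_pos (by positivity : 0 < p * q), div_eq_mul_one_div, ← one_div_pow, ← hy]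
    have : |1 - 2*(x^2*p) - 2*(x^2*q)| ≤ 18*(A+B) := by rw [abs_le]; constructor <;> linarith
    calc D * ((p*q) * |1 - 2*(x^2*p) - 2*(x^2*q)|) ≤ D * ((A*B*y^2) * (18*(A+B))) := by gcongr
      _ = _ := by ring
  · rw [e2, abs_mul, abs_mul, abs_mul, abs_of_pos (by positivity : 0 < p * q), div_eq_mul_one_div, ← one_div_pow, ← hy]
    have h5 : |-2*(p+q)*(1 - 2*(x^2*p) - 2*(x^2*q)) - 4*(p+q) + 4*(x^2*p)*p + 4*(x^2*q)*q| ≤ 18*(p+q) := by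
      rw [abs_le]
      have m1 := mul_nonneg hxp0 hp0.le
      have m2 := mul_nonneg hxp0 hq0.le
      have m3 := mul_nonneg hxq0 hp0.le
      have m4 := mul_nonneg hxq0 hq0.le
      have n1 := mul_le_mul_of_nonneg_right hxp hp0.le
      have n2 := mul_le_mul_of_nonneg_right hxp hq0.le
      have n3 := mul_le_mul_of_nonneg_right hxq hp0.le
      have n4 := mul_le_mul_of_nonneg_right hxq hq0.le
      constructor <;> nlinarith
    have h6 : 18*(p+q) ≤ 18*(A+B)*y := by linarith
    calc _ ≤ D * (|x| * (A*B*y^2) * (18*(A+B)*y)) := by gcongr; exact h5.trans h6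
      _ = _ := by ring
/-- c with c·r = Q0(s+r) - Q0(s-r) -/
def cc (a s r : ℝ) : ℝ := -2*(s^2 - a^2 - r^2) / (((s+r)^2+a^2) * ((s-r)^2+a^2))
def AA (a s r : ℝ) : ℝ := -(1/(s^2+a^2)) * ((s/2) * (log ((s+r)^2+a^2) - log ((s-r)^2+a^2))
  - a * (Real.arctan ((r+s)/a) + Real.arctan ((r-s)/a)))
lemma cc_mul {a : ℝ} (ha : 0 < a) (s r : ℝ) : cc a s r * r = Q0 a (s+r) - Q0 a (s-r) := by
  unfold cc Q0
  have h1 : (s+r)^2+a^2 ≠ 0 := by positivity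
  have h2 : (s-r)^2+a^2 ≠ 0 := by positivity
  field_simp; ring
lemma cc_cont {a : ℝ} (ha : 0 < a) (s : ℝ) : Continuous (cc a s) := by
  unfold cc
  exact Continuous.div (by fun_prop) (by fun_prop) fun x => by positivity
lemma AA_deriv {a : ℝ} (ha : 0 < a) (s r : ℝ) : HasDerivAt (AA a s) (cc a s r) r := by
  have h1 : (s+r)^2+a^2 ≠ 0 := by positivity
  have h2 : (s-r)^2+a^2 ≠ 0 := by positivity
  have h3 : s^2+a^2 ≠ 0 := by positivity
  have d1 : HasDerivAt (fun r => log ((s+r)^2+a^2)) ((2*(s+r))/((s+r)^2+a^2)) r := by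
    refine HasDerivAt.log ?_ h1
    have := (((hasDerivAt_id r).const_add s).pow 2).add_const (a^2)
    exact this.congr_deriv (by simp)
  have d2 : HasDerivAt (fun r => log ((s-r)^2+a^2)) ((-2*(s-r))/((s-r)^2+a^2)) r := by
    refine HasDerivAt.log ?_ h2
    have := (((hasDerivAt_id r).const_sub s).pow 2).add_const (a^2)
    exact this.congr_deriv (by simp)
  have d3 : HasDerivAt (fun r => Real.arctan ((r+s)/a)) (1/(1+((r+s)/a)^2) * (1/a)) r :=
    HasDerivAt.arctan (((hasDerivAt_id r).add_const s).div_const a)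
  have d4 : HasDerivAt (fun r => Real.arctan ((r-s)/a)) (1/(1+((r-s)/a)^2) * (1/a)) r :=
    HasDerivAt.arctan (((hasDerivAt_id r).sub_const s).div_const a)
  have := (((d1.sub d2).const_mul (s/2)).sub ((d3.add d4).const_mul a)).const_mul (-(1/(s^2+a^2)))
  refine this.congr_deriv ?_
  have e3 : 1/(1+((r+s)/a)^2) * (1/a) = a/((s+r)^2+a^2) := by
    have : a^2 + (r+s)^2 ≠ 0 := by positivity
    field_simp; ring
  have e4 : 1/(1+((r-s)/a)^2) * (1/a) = a/((s-r)^2+a^2) := by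
    have : a^2 + (r-s)^2 ≠ 0 := by positivity
    field_simp; ring
  rw [e3, e4, cc]
  field_simp; ring
lemma AA_zero (a s : ℝ) : AA a s 0 = 0 := by
  simp [AA, neg_div, Real.arctan_neg]
lemma AA_lim {a : ℝ} (ha : 0 < a) (s : ℝ) : Tendsto (AA a s) atTop (𝓝 (π * (a/(s^2+a^2)))) := by
  have hlog : Tendsto (fun r => log ((s+r)^2+a^2) - log ((s-r)^2+a^2)) atTop (𝓝 0) := by
    have h1 : Tendsto (fun r : ℝ => r⁻¹) atTop (𝓝 0) := tendsto_inv_atTop_zero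
    have hc : Continuous (fun u : ℝ => log ((s*u+1)^2+(a*u)^2) - log ((s*u-1)^2+(a*u)^2)) := by
      refine Continuous.sub (Continuous.log (by fun_prop) fun u => ?_) (Continuous.log (by fun_prop) fun u => ?_)
      · rcases eq_or_ne u 0 with h | h
        · simp [h]
        · positivity
      · rcases eq_or_ne u 0 with h | h
        · simp [h]
        · positivity
    have h2 := (hc.tendsto 0).comp h1
    simp at h2
    refine h2.congr' ?_
    filter_upwards [eventually_gt_atTop 0] with r hr
    have e1 : (s+r)^2+a^2 = r^2 * ((s*r⁻¹+1)^2+(a*r⁻¹)^2) := by field_simp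
    have e2 : (s-r)^2+a^2 = r^2 * ((s*r⁻¹-1)^2+(a*r⁻¹)^2) := by field_simp
    have h3 : (s*r⁻¹+1)^2+(a*r⁻¹)^2 ≠ 0 := by positivity
    have h4 : (s*r⁻¹-1)^2+(a*r⁻¹)^2 ≠ 0 := by positivity
    have h5 : r^2 ≠ 0 := by positivity
    simp only [Function.comp]
    rw [e1, e2, Real.log_mul h5 h3, Real.log_mul h5 h4]; ring
  have hat : ∀ c : ℝ, Tendsto (fun r => Real.arctan ((r+c)/a)) atTop (𝓝 (π/2)) := by
    intro c
    have h1 : Tendsto (fun r => (r+c)/a) atTop atTop :=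
      (tendsto_atTop_add_const_right _ c tendsto_id).atTop_div_const ha
    exact (tendsto_nhds_of_tendsto_nhdsWithin Real.tendsto_arctan_atTop).comp h1
  have := ((hlog.const_mul (s/2)).sub (((hat s).add (hat (-s))).const_mul a)).const_mul (-(1/(s^2+a^2)))
  refine Tendsto.congr (fun r => ?_) (this.trans (le_of_eq ?_))
  · rw [AA]; simp [sub_eq_add_neg]
  · congr 1; ring
end
section
lemma int_of_bd (g : ℝ → ℝ) (C : ℝ) (hg : AEStronglyMeasurable g) (hb : ∀ x, |g x| ≤ C / (1+x^2)) :
    Integrable g := by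
  have h1 : Integrable (fun x : ℝ => C * (1+x^2)⁻¹) := integrable_inv_one_add_sq.const_mul C
  refine h1.mono' hg (.of_forall fun x => ?_)
  rw [norm_eq_abs, ← div_eq_mul_inv]; exact hb x
lemma tendsto_zero_top (g : ℝ → ℝ) (C : ℝ) (hb : ∀ x, |g x| ≤ C / (1+|x|)) : Tendsto g atTop (𝓝 0) := by
  refine squeeze_zero_norm (a := fun x => C / (1+|x|)) hb ?_
  refine Tendsto.div_atTop tendsto_const_nhds ?_
  exact tendsto_atTop_add_const_left _ 1 tendsto_abs_atTop_atTop
lemma tendsto_zero_bot (g : ℝ → ℝ) (C : ℝ) (hb : ∀ x, |g x| ≤ C / (1+|x|)) : Tendsto g atBot (𝓝 0) := by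
  refine squeeze_zero_norm (a := fun x => C / (1+|x|)) hb ?_
  refine Tendsto.div_atTop tendsto_const_nhds ?_
  exact tendsto_atTop_add_const_left _ 1 tendsto_abs_atBot_atTop
lemma sq_le_ab (x : ℝ) : 1 + |x| ≤ 2 * (1+x^2) := by nlinarith [sq_abs x, sq_nonneg (|x|-1)]
lemma inv_sq_le (x : ℝ) : 1/(1+x^2) ≤ 2/(1+|x|) := by
  rw [div_le_div_iff₀ (by positivity) (by positivity)]; linarith [sq_le_ab x]
lemma peetre (s r : ℝ) : 1/(1+(s+r)^2) ≤ 2*(1+s^2) / (1+r^2) := by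
  rw [div_le_div_iff₀ (by positivity) (by positivity)]
  nlinarith [sq_nonneg (2*s+r), sq_nonneg (s*(s+r)), sq_nonneg s]
lemma peetre' (s r : ℝ) : 1/(1+(s-r)^2) ≤ 2*(1+s^2) / (1+r^2) := by
  have := peetre s (-r)
  simpa [sub_eq_add_neg] using this
lemma w2K {a b : ℝ} (ha : 0 < a) (hb : 0 < b) (s : ℝ) :
    Integrable (fun x => w2 a b x * Kf (x-s)) ∧
    ∫ x, w2 a b x * Kf (x-s) = π * (a/(s^2+a^2) - b/(s^2+b^2)) := by
  obtain ⟨C, hC, hw⟩ := w_bounds ha hb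
  have hint : Integrable (fun x => w2 a b x * Kf (x-s)) := by
    have hm : Continuous (fun x => w2 a b x * Kf (x-s)) :=
      (w2_cont ha hb).mul (Kf_cont.comp (by fun_prop))
    refine int_of_bd _ (C * (4*(1+s^2))) hm.aestronglyMeasurable fun x => ?_
    rw [abs_mul]
    have h1 : |Kf (x-s)| ≤ 4*(1+s^2)*(1+x^2) := by
      refine (Kf_bound (x-s)).trans ?_
      nlinarith [sq_nonneg (x+s), sq_nonneg (x*s)]
    have h2 := (hw x).2.2
    have h3 : C * |x| / (1+x^2)^3 ≤ C / (1+x^2)^2 := by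
      rw [div_le_div_iff₀ (by positivity) (by positivity)]
      have : |x| ≤ 1 + x^2 := by nlinarith [sq_abs x, sq_nonneg (|x|-1)]
      calc C * |x| * (1+x^2)^2 ≤ C * (1+x^2) * (1+x^2)^2 := by gcongr
        _ = _ := by ring
    calc |w2 a b x| * |Kf (x-s)| ≤ (C / (1+x^2)^2) * (4*(1+s^2)*(1+x^2)) :=
          mul_le_mul (h2.trans h3) h1 (abs_nonneg _) (by positivity)
      _ = _ := by field_simp
  refine ⟨hint, ?_⟩
  rw [integral_fold _ hint s]
  have hfi := integrable_fold _ hint s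
  set Ant : ℝ → ℝ := fun r => (w1 a b (s+r) + w1 a b (s-r)) * Kf r - (cc a s r - cc b s r) * (r * log r)
    + (AA a s r - AA b s r) with hAnt
  have hcr : ∀ r, (cc a s r - cc b s r) * r = w0 a b (s+r) - w0 a b (s-r) := by
    intro r
    rw [sub_mul, cc_mul ha, cc_mul hb, w0, w0]; ring
  have c1 : Continuous (w1 a b) := continuous_iff_continuousAt.2 fun x => (w1_deriv ha hb x).continuousAt
  have cA : Continuous (fun r => AA a s r - AA b s r) := continuous_iff_continuousAt.2
    fun x => ((AA_deriv ha s x).sub (AA_deriv hb s x)).continuousAt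
  have cAnt : Continuous Ant := by
    have h1 := cc_cont ha s
    have h2 := cc_cont hb s
    have h3 := Kf_cont
    have h4 := Real.continuous_mul_log
    refine ((Continuous.mul (by fun_prop) h3).sub (Continuous.mul (by fun_prop) h4)).add cA
  have hd : ∀ r ∈ Ioi (0:ℝ), HasDerivAt Ant (w2 a b (s+r) * Kf (s+r-s) + w2 a b (s-r) * Kf (s-r-s)) r := by
    intro r hr
    have hr' : r ≠ 0 := (ne_of_gt hr)
    have d1 : HasDerivAt (fun r => w1 a b (s+r)) (w2 a b (s+r)) r := (w1_deriv ha hb (s+r)).comp_const_add s r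
    have d2 : HasDerivAt (fun r => w1 a b (s-r)) (-w2 a b (s-r)) r := (w1_deriv ha hb (s-r)).comp_const_sub s r
    have d3 : HasDerivAt (fun r => w0 a b (s+r)) (w1 a b (s+r)) r := (w0_deriv ha hb (s+r)).comp_const_add s r
    have d4 : HasDerivAt (fun r => w0 a b (s-r)) (-w1 a b (s-r)) r := (w0_deriv ha hb (s-r)).comp_const_sub s r
    have dl := Real.hasDerivAt_log hr'
    have := (((d1.add d2).mul (Kf_deriv hr')).sub ((d3.sub d4).mul dl)).add ((AA_deriv ha s r).sub (AA_deriv hb s r))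
    refine (this.congr_deriv ?_).congr_of_eventuallyEq (.of_forall fun r => ?_)
    · have e : (w0 a b (s+r) - w0 a b (s-r)) * r⁻¹ = cc a s r - cc b s r := by
        rw [← hcr]; field_simp
      have k1 : s + r - s = r := by ring
      have k2 : s - r - s = -r := by ring
      rw [k1, k2, Kf_neg]
      simp only [Pi.add_apply, Pi.sub_apply]
      rw [e]; ring
    · simp only [hAnt, Pi.add_apply, Pi.sub_apply, Pi.mul_apply]
      rw [← hcr]; ring
  have hlim : Tendsto Ant atTop (𝓝 (0 - 0 + (π * (a/(s^2+a^2)) - π * (b/(s^2+b^2))))) := by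
    refine Tendsto.add (Tendsto.sub ?_ ?_) ((AA_lim ha s).sub (AA_lim hb s))
    · refine tendsto_zero_top _ (2 * (C * (2*(1+s^2))^2 * 4)) fun r => ?_
      rw [abs_mul]
      have b1 : |w1 a b (s+r) + w1 a b (s-r)| ≤ 2 * (C * (2*(1+s^2) / (1+r^2))^2) := by
        have p1 := (hw (s+r)).2.1
        have p2 := (hw (s-r)).2.1
        have q1 : C / (1+(s+r)^2)^2 ≤ C * (2*(1+s^2) / (1+r^2))^2 := by
          rw [div_eq_mul_one_div, ← one_div_pow]
          have := peetre s r
          gcongr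
        have q2 : C / (1+(s-r)^2)^2 ≤ C * (2*(1+s^2) / (1+r^2))^2 := by
          rw [div_eq_mul_one_div, ← one_div_pow]
          have := peetre' s r
          gcongr
        linarith [abs_add_le (w1 a b (s+r)) (w1 a b (s-r))]
      calc _ ≤ 2 * (C * (2*(1+s^2) / (1+r^2))^2) * (2*r^2+2) :=
            mul_le_mul b1 (Kf_bound r) (abs_nonneg _) (by positivity)
        _ = 2 * (C * (2*(1+s^2))^2 * 2) * (1/(1+r^2)) := by field_simp; ring
        _ ≤ 2 * (C * (2*(1+s^2))^2 * 2) * (2/(1+|r|)) := by gcongr 2 * (C * (2*(1+s^2))^2 * 2) * ?_; exact inv_sq_le r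
        _ = _ := by ring
    · have key : ∀ r : ℝ, 1 ≤ r → |(cc a s r - cc b s r) * (r * log r)| ≤ 2*(C*(2*(1+s^2))) * (1/r) := by
        intro r hr
        rw [← mul_assoc, hcr, abs_mul]
        have b1 : |w0 a b (s+r) - w0 a b (s-r)| ≤ 2 * (C * (2*(1+s^2) / (1+r^2))) := by
          have p1 := (hw (s+r)).1
          have p2 := (hw (s-r)).1
          have q1 : C / (1+(s+r)^2) ≤ C * (2*(1+s^2) / (1+r^2)) := by
            rw [div_eq_mul_one_div]
            have := peetre s r
            gcongr
          have q2 : C / (1+(s-r)^2) ≤ C * (2*(1+s^2) / (1+r^2)) := by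
            rw [div_eq_mul_one_div]
            have := peetre' s r
            gcongr
          linarith [abs_sub (w0 a b (s+r)) (w0 a b (s-r))]
        have b2 : |log r| ≤ r := by
          rw [abs_of_nonneg (Real.log_nonneg hr)]; linarith [Real.log_le_sub_one_of_pos (by linarith : 0 < r)]
        calc _ ≤ 2 * (C * (2*(1+s^2) / (1+r^2))) * r := mul_le_mul b1 b2 (abs_nonneg _) (by positivity)
          _ = 2 * (C * (2*(1+s^2))) * (r / (1+r^2)) := by ring
          _ ≤ _ := by
            gcongr 2 * (C * (2*(1+s^2))) * ?_
            rw [div_le_div_iff₀ (by positivity) (by positivity)]; nlinarith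
      refine squeeze_zero_norm' (a := fun r : ℝ => 2*(C*(2*(1+s^2))) * (1/r)) ?_ ?_
      · filter_upwards [eventually_ge_atTop 1] with r hr using key r hr
      · have : Tendsto (fun r : ℝ => 1/r) atTop (𝓝 0) := by simpa using tendsto_inv_atTop_zero (𝕜 := ℝ)
        simpa using this.const_mul (2*(C*(2*(1+s^2))))
  have := integral_Ioi_of_hasDerivAt_of_tendsto cAnt.continuousWithinAt hd hfi hlim
  rw [this]
  have h0 : Ant 0 = 0 := by simp [hAnt, Kf, AA_zero]
  rw [h0]; ring
lemma w2_zero {a b : ℝ} (ha : 0 < a) (hb : 0 < b) :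
    Integrable (w2 a b) ∧ Integrable (fun x => w2 a b x * x) ∧ ∫ x, w2 a b x = 0 ∧ ∫ x, w2 a b x * x = 0 := by
  obtain ⟨C, hC, hw⟩ := w_bounds ha hb
  have b2 : ∀ x, |w2 a b x| ≤ C / (1+x^2) := fun x => by
    refine (hw x).2.2.trans ?_
    rw [div_le_div_iff₀ (by positivity) (by positivity)]
    have : |x| ≤ (1 + x^2)^2 := by nlinarith [sq_abs x, sq_nonneg (|x|-1), sq_nonneg (x^2)]
    calc C * |x| * (1+x^2) ≤ C * (1+x^2)^2 * (1+x^2) := by gcongr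
      _ = _ := by ring
  have b2' : ∀ x, |w2 a b x * x| ≤ C / (1+x^2) := fun x => by
    rw [abs_mul]
    calc _ ≤ C * |x| / (1+x^2)^3 * |x| := by gcongr; exact (hw x).2.2
      _ = C * x^2 / (1+x^2)^3 := by rw [← sq_abs x]; ring
      _ ≤ _ := by
        rw [div_le_div_iff₀ (by positivity) (by positivity)]
        have : x^2 ≤ (1 + x^2)^2 := by nlinarith [sq_nonneg (x^2)]
        calc C * x^2 * (1+x^2) ≤ C * (1+x^2)^2 * (1+x^2) := by gcongr
          _ = _ := by ring
  have i1 : Integrable (w2 a b) := int_of_bd _ C (w2_cont ha hb).aestronglyMeasurable b2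
  have i2 : Integrable (fun x => w2 a b x * x) := int_of_bd _ C ((w2_cont ha hb).mul continuous_id).aestronglyMeasurable b2'
  have t1 : ∀ x, |w1 a b x| ≤ 2*C / (1+|x|) := fun x => by
    refine (hw x).2.1.trans ?_
    calc C / (1+x^2)^2 ≤ C / (1+x^2) := by
          gcongr; nlinarith [sq_nonneg x]
      _ = C * (1/(1+x^2)) := by ring
      _ ≤ C * (2/(1+|x|)) := by gcongr C * ?_; exact inv_sq_le x
      _ = _ := by ring
  have t2 : ∀ x, |x * w1 a b x - w0 a b x| ≤ 4*C / (1+|x|) := fun x => by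
    have h1 : |x * w1 a b x| ≤ C / (1+x^2) := by
      rw [abs_mul]
      calc |x| * |w1 a b x| ≤ |x| * (C / (1+x^2)^2) := by gcongr; exact (hw x).2.1
        _ = C * |x| / (1+x^2)^2 := by ring
        _ ≤ _ := by
          rw [div_le_div_iff₀ (by positivity) (by positivity)]
          have : |x| ≤ (1 + x^2) := by nlinarith [sq_abs x, sq_nonneg (|x|-1)]
          calc C * |x| * (1+x^2) ≤ C * (1+x^2) * (1+x^2) := by gcongr
            _ = _ := by ring
    calc _ ≤ C / (1+x^2) + C / (1+x^2) := (abs_sub _ _).trans (add_le_add h1 (hw x).1)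
      _ = 2*C * (1/(1+x^2)) := by ring
      _ ≤ 2*C * (2/(1+|x|)) := by gcongr 2*C * ?_; exact inv_sq_le x
      _ = _ := by ring
  refine ⟨i1, i2, ?_, ?_⟩
  · rw [integral_of_hasDerivAt_of_tendsto (fun x => w1_deriv ha hb x) i1 (tendsto_zero_bot _ _ t1) (tendsto_zero_top _ _ t1)]; simp
  · have hd : ∀ x, HasDerivAt (fun x => x * w1 a b x - w0 a b x) (w2 a b x * x) x := fun x =>
      (((hasDerivAt_id x).mul (w1_deriv ha hb x)).sub (w0_deriv ha hb x)).congr_deriv (by simp; ring)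
    rw [integral_of_hasDerivAt_of_tendsto hd i2 (tendsto_zero_bot _ _ t2) (tendsto_zero_top _ _ t2)]; simp
lemma w2Rk {a b : ℝ} (ha : 0 < a) (hb : 0 < b) (s : ℝ) :
    ∫ x, w2 a b x * Rk x s = π * (a/(s^2+a^2) - b/(s^2+b^2)) := by
  obtain ⟨i1, i2, e1, e2⟩ := w2_zero ha hb
  obtain ⟨i3, e3⟩ := w2K ha hb s
  have : ∀ x, w2 a b x * Rk x s = w2 a b x * Kf (x-s) - w2 a b x * Kf (-s) - (w2 a b x * x) * (log (1+s^2)/2) := by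
    intro x; rw [Rk]; ring
  simp_rw [this]
  have h1 := integral_sub (i3.sub (i1.mul_const (Kf (-s)))) (i2.mul_const (log (1+s^2)/2))
  have h2 := integral_sub i3 (i1.mul_const (Kf (-s)))
  simp only [Pi.sub_apply] at h1 h2
  rw [h1, h2, e3, integral_mul_const, integral_mul_const, e1, e2]; ring
lemma w2V {a b : ℝ} (ha : 0 < a) (hb : 0 < b) (J : ℝ → ℝ) (hJ : Integrable (fun s => J s / (1+|s|))) :
    Integrable (fun x => w2 a b x * Vf J x) ∧ 
    ∫ x, w2 a b x * Vf J x = π * ∫ s, J s * (a/(s^2+a^2) - b/(s^2+b^2)) := by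
  obtain ⟨C, hC, hw⟩ := w_bounds ha hb
  have hbd : Integrable (fun p : ℝ × ℝ => (256 * C * (1+p.1^2)⁻¹) * (J p.2 / (1+|p.2|))) :=
    (integrable_inv_one_add_sq.const_mul (256*C)).mul_prod hJ
  have hRm : Measurable (fun p : ℝ × ℝ => Rk p.1 p.2) := by
    have := Kf_cont.measurable
    unfold Rk; fun_prop
  have hJm : AEStronglyMeasurable J := by
    have h1 : AEStronglyMeasurable (fun s => (J s / (1+|s|)) * (1+|s|)) := hJ.1.mul (by fun_prop)
    refine h1.congr (.of_forall fun s => ?_)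
    have : 1+|s| ≠ 0 := by positivity
    simp only; field_simp
  have hP : Integrable (fun p : ℝ × ℝ => w2 a b p.1 * (J p.2 * Rk p.1 p.2)) (volume.prod volume) := by
    refine hbd.mono ?_ (.of_forall fun p => ?_)
    · refine ((w2_cont ha hb).measurable.comp measurable_fst).aestronglyMeasurable.mul (AEStronglyMeasurable.mul hJm.comp_snd hRm.aestronglyMeasurable)
    · rw [norm_eq_abs, norm_eq_abs, abs_mul, abs_mul, abs_mul, abs_div, abs_of_nonneg (by positivity : 0 ≤ 256 * C * (1+p.1^2)⁻¹), abs_of_pos (by positivity : 0 < 1 + |p.2|)]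
      have k1 := (hw p.1).2.2
      have k2 := Rk_bound p.1 p.2
      have k3 : C * |p.1| / (1+p.1^2)^3 * (64*(1+|p.1|)^3) ≤ 256 * C * (1+p.1^2)⁻¹ := by
        have m1 : (1+|p.1|)^2 ≤ 2*(1+p.1^2) := by nlinarith [sq_abs p.1, sq_nonneg (|p.1|-1)]
        have m2 : (1+|p.1|)*|p.1| ≤ 2*(1+p.1^2) := by nlinarith [sq_abs p.1, sq_nonneg (|p.1|-1)]
        have m3 : (1+|p.1|)^2 * ((1+|p.1|)*|p.1|) ≤ (2*(1+p.1^2)) * (2*(1+p.1^2)) := by gcongr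
        have e : C * |p.1| / (1+p.1^2)^3 * (64*(1+|p.1|)^3) = 64 * C / (1+p.1^2)^3 * ((1+|p.1|)^2 * ((1+|p.1|)*|p.1|)) := by ring
        rw [e]
        calc _ ≤ 64 * C / (1+p.1^2)^3 * ((2*(1+p.1^2)) * (2*(1+p.1^2))) := mul_le_mul_of_nonneg_left m3 (by positivity)
          _ = _ := by field_simp; ring
      calc |w2 a b p.1| * (|J p.2| * |Rk p.1 p.2|) ≤ (C * |p.1| / (1+p.1^2)^3) * (|J p.2| * (64*(1+|p.1|)^3/(1+|p.2|))) := by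
            gcongr
        _ = (C * |p.1| / (1+p.1^2)^3 * (64*(1+|p.1|)^3)) * (|J p.2| / (1+|p.2|)) := by ring
        _ ≤ _ := mul_le_mul_of_nonneg_right k3 (by positivity)
  have e1 : ∀ x, w2 a b x * Vf J x = ∫ s, w2 a b x * (J s * Rk x s) := fun x => by
    rw [Vf, integral_const_mul]
  constructor
  · simp_rw [e1]; exact hP.integral_prod_left
  · simp_rw [e1]
    rw [integral_integral_swap hP, ← integral_const_mul]
    congr 1; ext s
    have : ∀ x, w2 a b x * (J s * Rk x s) = J s * (w2 a b x * Rk x s) := fun x => by ring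
    simp_rw [this]
    rw [integral_const_mul, w2Rk ha hb]; ring
end
section
def d2 (f : ℝ → ℝ) (x r : ℝ) : ℝ := 2 * f x - f (x+r) - f (x-r)
def wk (α r : ℝ) : ℝ := min (r^2) 1 / r^(1+α)
def Lam (α : ℝ) (f : ℝ → ℝ) (x : ℝ) : ℝ := (1/π) * ∫ r in Ioi 0, d2 f x r / r^(1+α)
lemma wk_nonneg (α : ℝ) {r : ℝ} (hr : 0 < r) : 0 ≤ wk α r := by unfold wk; positivity
lemma wk_int {α : ℝ} (h0 : 0 < α) (h2 : α < 2) : IntegrableOn (wk α) (Ioi 0) := by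
  rw [← Set.Ioc_union_Ioi_eq_Ioi (zero_le_one (α := ℝ))]
  refine IntegrableOn.union ?_ ?_
  · have h1 : IntegrableOn (fun r : ℝ => r^(1-α)) (Ioc 0 1) := by
      rw [← intervalIntegrable_iff_integrableOn_Ioc_of_le zero_le_one]
      exact intervalIntegral.intervalIntegrable_rpow' (by linarith)
    refine h1.congr_fun (fun r hr => ?_) measurableSet_Ioc
    have h3 : r^2 ≤ 1 := by nlinarith [hr.1, hr.2]
    simp only [wk]
    rw [min_eq_left h3, ← Real.rpow_natCast, ← Real.rpow_sub hr.1]; congr 1; push_cast; ring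
  · have h1 : IntegrableOn (fun r : ℝ => r^(-(1+α))) (Ioi 1) :=
      integrableOn_Ioi_rpow_of_lt (by linarith) one_pos
    refine h1.congr_fun (fun r hr => ?_) measurableSet_Ioi
    have hr' : (1:ℝ) < r := hr
    have h3 : 1 ≤ r^2 := by nlinarith
    simp only [wk]
    rw [min_eq_right h3, Real.rpow_neg (by linarith), one_div]
lemma d2_meas {f : ℝ → ℝ} (hf : Measurable f) (x : ℝ) : Measurable (d2 f x) := by
  unfold d2; fun_prop
lemma d2_abs {f : ℝ → ℝ} {M : ℝ} (hM : ∀ x, |f x| ≤ M) (x r : ℝ) : |d2 f x r| ≤ 4 * M := by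
  unfold d2
  have h1 := abs_le.1 (hM x)
  have h2 := abs_le.1 (hM (x+r))
  have h3 := abs_le.1 (hM (x-r))
  rw [abs_le]; constructor <;> linarith
lemma d2_min {f : ℝ → ℝ} {M n : ℝ} (hM : ∀ x, |f x| ≤ M) (hn : 0 ≤ n) {x : ℝ}
    (h : ∀ r, 0 < r → r ≤ 1 → |d2 f x r| ≤ n * r^2) {r : ℝ} (hr : 0 < r) :
    |d2 f x r| ≤ (n + 4*M) * min (r^2) 1 := by
  have hM0 : 0 ≤ M := (abs_nonneg _).trans (hM 0)
  rcases le_total r 1 with h1 | h1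
  · rw [min_eq_left (by nlinarith)]
    refine (h r hr h1).trans ?_
    gcongr; linarith
  · rw [min_eq_right (by nlinarith)]
    have := d2_abs hM x r; linarith
lemma d2_wk {f : ℝ → ℝ} {N α x : ℝ} {r : ℝ} (hr : 0 < r) (h : |d2 f x r| ≤ N * min (r^2) 1) :
    |d2 f x r / r^(1+α)| ≤ N * wk α r := by
  have : 0 < r^(1+α) := by positivity
  rw [abs_div, abs_of_pos this, wk, ← mul_div_assoc]
  gcongr
lemma Lam_int {f : ℝ → ℝ} {N α x : ℝ} (h0 : 0 < α) (h2 : α < 2) (hf : Measurable f)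
    (h : ∀ r, 0 < r → |d2 f x r| ≤ N * min (r^2) 1) :
    IntegrableOn (fun r => d2 f x r / r^(1+α)) (Ioi 0) := by
  have := d2_meas hf x
  refine Integrable.mono' ((wk_int h0 h2).const_mul N) (Measurable.aestronglyMeasurable (by fun_prop)) ?_
  refine (ae_restrict_iff' measurableSet_Ioi).2 (.of_forall fun r hr => ?_)
  exact d2_wk hr (h r hr)
def wkI (α : ℝ) : ℝ := ∫ r in Ioi 0, wk α r
lemma wkI_nonneg (α : ℝ) : 0 ≤ wkI α :=
  setIntegral_nonneg measurableSet_Ioi fun _ hr => wk_nonneg α hr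
lemma Lam_bd {f : ℝ → ℝ} {N α x : ℝ} (h0 : 0 < α) (h2 : α < 2)
    (h : ∀ r, 0 < r → |d2 f x r| ≤ N * min (r^2) 1) :
    |Lam α f x| ≤ N * wkI α := by
  have h1 : |∫ r in Ioi 0, d2 f x r / r^(1+α)| ≤ ∫ r in Ioi 0, N * wk α r := by
    rw [← norm_eq_abs]
    refine norm_integral_le_of_norm_le ((wk_int h0 h2).const_mul N) ?_
    exact (ae_restrict_iff' measurableSet_Ioi).2 (.of_forall fun r hr => d2_wk hr (h r hr))
  rw [integral_const_mul] at h1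
  have hp : 1/π ≤ 1 := by
    rw [div_le_one pi_pos]; linarith [Real.pi_gt_three]
  rw [Lam, abs_mul, abs_of_pos (by positivity : 0 < 1/π)]
  refine le_trans ?_ h1
  exact mul_le_of_le_one_left (abs_nonneg _) hp
lemma d2_of_deriv {f : ℝ → ℝ} {n x η : ℝ} (hf : Differentiable ℝ f)
    (h : ∀ u ∈ Icc (x-η) (x+η), ∀ v ∈ Icc (x-η) (x+η), |deriv f u - deriv f v| ≤ n * |u-v|) :
    ∀ r, 0 ≤ r → r ≤ η → |d2 f x r| ≤ n * r^2 := by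
  intro r hr0 hr1
  have hd : ∀ r, HasDerivAt (d2 f x) (-(deriv f (x+r)) + deriv f (x-r)) r := by
    intro r
    have a1 : HasDerivAt (fun r => f (x+r)) (deriv f (x+r)) r := ((hf (x+r)).hasDerivAt).comp_const_add x r
    have a2 : HasDerivAt (fun r => f (x-r)) (-deriv f (x-r)) r := ((hf (x-r)).hasDerivAt).comp_const_sub x r
    exact (((hasDerivAt_const r (2 * f x)).sub a1).sub a2).congr_deriv (by ring)
  have := image_norm_le_of_norm_deriv_right_le_deriv_boundary (f := d2 f x) (f' := fun r => -(deriv f (x+r)) + deriv f (x-r))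
    (a := 0) (b := η) (B := fun r => n * r^2) (B' := fun r => n * (2*r)) ?_ ?_ ?_ ?_ ?_ (x := r) ⟨hr0, hr1⟩
  · exact this
  · exact fun r _ => (hd r).continuousAt.continuousWithinAt
  · exact fun r _ => (hd r).hasDerivWithinAt
  · simp [d2]; ring
  · intro r
    exact ((hasDerivAt_pow 2 r).const_mul n).congr_deriv (by simp)
  · intro r hr
    have := h (x-r) ⟨by linarith [hr.1, hr.2], by linarith [hr.1, hr.2]⟩ (x+r) ⟨by linarith [hr.1, hr.2], by linarith [hr.1, hr.2]⟩
    have e : |x - r - (x+r)| = 2*r := by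
      rw [show x - r - (x+r) = -(2*r) by ring, abs_neg, abs_of_nonneg (by linarith [hr.1])]
    rw [e] at this
    rw [norm_eq_abs, show -deriv f (x+r) + deriv f (x-r) = deriv f (x-r) - deriv f (x+r) by ring]
    exact this
lemma C1_lip {g : ℝ → ℝ} (hg : ContDiff ℝ 1 g) (R : ℝ) : ∃ n, 0 ≤ n ∧ ∀ u ∈ Icc (-R) R, ∀ v ∈ Icc (-R) R,
    |g u - g v| ≤ n * |u - v| := by
  have hc : Continuous (deriv g) := hg.continuous_deriv le_rfl
  obtain ⟨n, hn⟩ := (isCompact_Icc (a := -R) (b := R)).exists_bound_of_continuousOn hc.continuousOn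
  refine ⟨max n 0, le_max_right _ _, fun u hu v hv => ?_⟩
  have := Convex.norm_image_sub_le_of_norm_deriv_le (𝕜 := ℝ) (f := g) (C := max n 0) (s := Icc (-R) R)
    (fun x _ => hg.differentiable (by norm_num) x) (fun x hx => (hn x hx).trans (le_max_left _ _)) (convex_Icc _ _) hv hu
  exact this
lemma d2_loc {f : ℝ → ℝ} (hf : ContDiff ℝ 2 f) (R : ℝ) : ∃ n, 0 ≤ n ∧ ∀ x, |x| ≤ R → ∀ r, 0 < r → r ≤ 1 →
    |d2 f x r| ≤ n * r^2 := by
  have h1 : ContDiff ℝ 1 (deriv f) := by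
    have : ContDiff ℝ (1+1) f := by simpa [one_add_one_eq_two] using hf
    exact (contDiff_succ_iff_deriv.1 this).2.2
  obtain ⟨n, hn0, hn⟩ := C1_lip h1 (R+1)
  refine ⟨n, hn0, fun x hx r hr hr1 => d2_of_deriv (hf.differentiable (by norm_num)) (fun u hu v hv => hn u ?_ v ?_) r hr.le hr1⟩
  · have := abs_le.1 hx; exact ⟨by linarith [hu.1], by linarith [hu.2]⟩
  · have := abs_le.1 hx; exact ⟨by linarith [hv.1], by linarith [hv.2]⟩
lemma d2_locM {f : ℝ → ℝ} (hf : ContDiff ℝ 2 f) {M : ℝ} (hM : ∀ x, |f x| ≤ M) (R : ℝ) : ∃ N, 0 ≤ N ∧ ∀ x, |x| ≤ R → ∀ r, 0 < r →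
    |d2 f x r| ≤ N * min (r^2) 1 := by
  obtain ⟨n, hn0, hn⟩ := d2_loc hf R
  have hM0 : 0 ≤ M := (abs_nonneg _).trans (hM 0)
  exact ⟨n + 4*M, by positivity, fun x hx r hr => d2_min hM hn0 (hn x hx) hr⟩
lemma Lam_meas {f : ℝ → ℝ} (hf : Measurable f) (α : ℝ) : StronglyMeasurable (Lam α f) := by
  unfold Lam
  refine StronglyMeasurable.const_mul ?_ _
  have : StronglyMeasurable (Function.uncurry fun x r => d2 f x r / r^(1+α)) := by
    refine Measurable.stronglyMeasurable ?_
    unfold d2 Function.uncurry; fun_prop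
  exact this.integral_prod_right
end
section
lemma Q1_bd {b : ℝ} (hb : 0 < b) (x : ℝ) : |Q1 b x| ≤ 1/(x^2+b^2) := by
  have h : 0 < x^2+b^2 := by positivity
  rw [Q1, abs_div, abs_of_pos (by positivity : 0 < (x^2+b^2)^2), div_le_div_iff₀ (by positivity) h]
  have : |b^2-x^2| ≤ x^2+b^2 := by rw [abs_le]; constructor <;> nlinarith [sq_nonneg b, sq_nonneg x]
  nlinarith
lemma Q1_cont {b : ℝ} (hb : 0 < b) : Continuous (Q1 b) :=
  continuous_iff_continuousAt.2 fun x => (Q1_deriv hb x).continuousAt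
lemma fQ1_int {b : ℝ} (hb : 0 < b) (f : ℝ → ℝ) (M : ℝ) (hf : Continuous f) (hM : ∀ x, |f x| ≤ M) :
    Integrable (fun x => f x * Q1 b x) := by
  have hM0 : 0 ≤ M := (abs_nonneg _).trans (hM 0)
  refine int_of_bd _ (M * (1+1/b^2)) (hf.mul (Q1_cont hb)).aestronglyMeasurable fun x => ?_
  rw [abs_mul, mul_div_assoc]
  exact mul_le_mul (hM x) ((Q1_bd hb x).trans (p_le hb x)) (abs_nonneg _) hM0
lemma poisson_ab (J f : ℝ → ℝ) (M : ℝ) (hJ : Integrable (fun s => J s / (1+|s|))) (hf : Differentiable ℝ f)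
    (hM : ∀ x, |f x| ≤ M)
    (h : IsHilbertPV J (deriv f)) {a b : ℝ} (ha : 0 < a) (hb : 0 < b) :
    ∫ s, J s * (a/(s^2+a^2) - b/(s^2+b^2)) = - ∫ x, f x * w1 a b x := by
  obtain ⟨a0, b0, hV⟩ := Vf_affine J f hJ hf h
  obtain ⟨i2, e2⟩ := w2V ha hb J hJ
  obtain ⟨C, hC, hw⟩ := w_bounds ha hb
  have hM0 : 0 ≤ M := (abs_nonneg _).trans (hM 0)
  have c1 : Continuous (w1 a b) := continuous_iff_continuousAt.2 fun x => (w1_deriv ha hb x).continuousAt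
  have w1b : ∀ x, |w1 a b x| ≤ C / (1+x^2) := fun x => by
    refine (hw x).2.1.trans ?_
    gcongr; nlinarith [sq_nonneg x]
  have iw1 : Integrable (w1 a b) := int_of_bd _ C c1.aestronglyMeasurable w1b
  have ifw : Integrable (fun x => f x * w1 a b x) := by
    refine int_of_bd _ (M*C) (hf.continuous.mul c1).aestronglyMeasurable fun x => ?_
    rw [abs_mul, mul_div_assoc]
    exact mul_le_mul (hM x) (w1b x) (abs_nonneg _) hM0
  have zw1 : ∫ x, w1 a b x = 0 := by
    have t : ∀ x, |w0 a b x| ≤ 2*C/(1+|x|) := fun x => by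
      refine (hw x).1.trans ?_
      calc C / (1+x^2) = C * (1/(1+x^2)) := by ring
        _ ≤ C * (2/(1+|x|)) := by gcongr C * ?_; exact inv_sq_le x
        _ = _ := by ring
    rw [integral_of_hasDerivAt_of_tendsto (fun x => w0_deriv ha hb x) iw1 (tendsto_zero_bot _ _ t) (tendsto_zero_top _ _ t)]; simp
  have dV : ∀ x, HasDerivAt (Vf J) (π * f x + a0) x := by
    intro x
    have hF : HasDerivAt (fun x => ∫ u in (0:ℝ)..x, f u) (f x) x :=
      intervalIntegral.integral_hasDerivAt_right (hf.continuous.intervalIntegrable _ _)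
        (hf.continuous.stronglyMeasurableAtFilter _ _) hf.continuous.continuousAt
    have := (hF.const_mul π).add (((hasDerivAt_id x).const_mul a0).add_const b0)
    have e : Vf J = fun x => π * (∫ u in (0:ℝ)..x, f u) + (a0 * x + b0) := funext hV
    rw [e]
    exact this.congr_deriv (by simp)
  have Vb : ∀ x, |Vf J x| ≤ (π * M + |a0| + |b0|) * (1+|x|) := by
    intro x
    have h1 : |∫ u in (0:ℝ)..x, f u| ≤ M * |x| := by
      have := intervalIntegral.norm_integral_le_of_norm_le_const (a := 0) (b := x) (f := f) (C := M) (fun u _ => hM u)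
      simpa using this
    rw [hV]
    have h2 : |π * (∫ u in (0:ℝ)..x, f u)| ≤ π * (M * |x|) := by
      rw [abs_mul, abs_of_pos pi_pos]; exact mul_le_mul_of_nonneg_left h1 Real.pi_pos.le
    have h3 : |a0 * x + b0| ≤ |a0| * |x| + |b0| := (abs_add_le _ _).trans (by rw [abs_mul])
    have h4 : 0 ≤ π * M := by positivity
    have h5 : 0 ≤ |b0| * |x| := by positivity
    have h6 : 0 ≤ |a0| := by positivity
    calc _ ≤ π * (M * |x|) + (|a0| * |x| + |b0|) := (abs_add_le _ _).trans (add_le_add h2 h3)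
      _ ≤ _ := by nlinarith
  have ivw : Integrable (fun x => Vf J x * w1 a b x) := by
    refine int_of_bd _ ((π * M + |a0| + |b0|) * (2*C)) ((Vf_cont J hJ).mul c1).aestronglyMeasurable fun x => ?_
    rw [abs_mul]
    have := sq_le_ab x
    calc _ ≤ ((π * M + |a0| + |b0|) * (1+|x|)) * (C / (1+x^2)^2) :=
          mul_le_mul (Vb x) (hw x).2.1 (abs_nonneg _) (by positivity)
      _ ≤ ((π * M + |a0| + |b0|) * (2*(1+x^2))) * (C / (1+x^2)^2) := by gcongr
      _ = _ := by field_simp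
  have ibp := integral_mul_deriv_eq_deriv_mul_of_integrable (u := Vf J) (v := w1 a b) (u' := fun x => π * f x + a0) (v' := w2 a b) (fun x _ => dV x) (fun x _ => w1_deriv ha hb x)
    (by simpa [mul_comm, Pi.mul_def] using i2)
    (by
      have := (ifw.const_mul π).add (iw1.const_mul a0)
      refine this.congr (.of_forall fun x => ?_)
      simp only [Pi.add_apply, Pi.mul_apply]; ring) ivw
  have e3 : ∫ x, (π * f x + a0) * w1 a b x = π * ∫ x, f x * w1 a b x := by
    have : ∀ x, (π * f x + a0) * w1 a b x = π * (f x * w1 a b x) + a0 * w1 a b x := fun x => by ring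
    simp_rw [this]
    rw [integral_add (ifw.const_mul _) (iw1.const_mul _), integral_const_mul, integral_const_mul, zw1]; ring
  rw [e3] at ibp
  have e4 : ∫ x, Vf J x * w2 a b x = ∫ x, w2 a b x * Vf J x := by simp_rw [mul_comm]
  rw [e4, e2] at ibp
  have := pi_pos
  have h9 : π * (∫ s, J s * (a/(s^2+a^2) - b/(s^2+b^2))) = π * (- ∫ x, f x * w1 a b x) := by rw [ibp]; ring
  exact mul_left_cancel₀ this.ne' h9
lemma pb_bd {b : ℝ} (hb : 1 ≤ b) (s : ℝ) : |b/(s^2+b^2)| ≤ 2/(1+|s|) := by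
  have : 0 < s^2+b^2 := by positivity
  rw [abs_of_nonneg (by positivity), div_le_div_iff₀ this (by positivity)]
  nlinarith [sq_nonneg (|s|-b), sq_abs s, abs_nonneg s]
lemma pa_int (J : ℝ → ℝ) (hJ : Integrable (fun s => J s / (1+|s|))) {a : ℝ} (ha : 0 < a) :
    Integrable (fun s => J s * (a/(s^2+a^2))) := by
  refine J_mul_int J _ hJ (2*(a*(1+1/a^2))) (by fun_prop) fun s => ?_
  rw [abs_of_nonneg (by positivity)]
  have h1 := p_le ha s
  calc a/(s^2+a^2) = a * (1/(s^2+a^2)) := by ring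
    _ ≤ a * ((1+1/a^2)/(1+s^2)) := by gcongr
    _ = a * (1+1/a^2) * (1/(1+s^2)) := by ring
    _ ≤ a * (1+1/a^2) * (2/(1+|s|)) := mul_le_mul_of_nonneg_left (inv_sq_le s) (by positivity)
    _ = _ := by ring
lemma poisson_a (J f : ℝ → ℝ) (M : ℝ) (hJ : Integrable (fun s => J s / (1+|s|))) (hf : Differentiable ℝ f)
    (hM : ∀ x, |f x| ≤ M)
    (h : IsHilbertPV J (deriv f)) {a : ℝ} (ha : 0 < a) :
    ∫ s, J s * (a/(s^2+a^2)) = - ∫ x, f x * Q1 a x := by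
  have hM0 : 0 ≤ M := (abs_nonneg _).trans (hM 0)
  have key : ∀ᶠ b : ℝ in atTop, (∫ s, J s * (a/(s^2+a^2))) + (∫ x, f x * Q1 a x) = (∫ s, J s * (b/(s^2+b^2))) + ∫ x, f x * Q1 b x := by
    filter_upwards [eventually_gt_atTop 0] with b hb
    have h1 := poisson_ab J f M hJ hf hM h ha hb
    simp_rw [w1, mul_sub] at h1
    rw [integral_sub (pa_int J hJ ha) (pa_int J hJ hb), integral_sub (fQ1_int ha f M hf.continuous hM) (fQ1_int hb f M hf.continuous hM)] at h1
    linarith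
  have l1 : Tendsto (fun b : ℝ => ∫ s, J s * (b/(s^2+b^2))) atTop (𝓝 (∫ s : ℝ, 0)) := by
    refine tendsto_integral_filter_of_dominated_convergence (fun s => 2 * |J s / (1+|s|)|) ?_ ?_ (hJ.abs.const_mul 2) ?_
    · filter_upwards [eventually_gt_atTop 0] with b hb using (pa_int J hJ hb).1
    · filter_upwards [eventually_ge_atTop 1] with b hb
      refine .of_forall fun s => ?_
      rw [norm_eq_abs, abs_mul, abs_div (J s), abs_of_pos (by positivity : 0 < 1 + |s|)]
      calc _ ≤ |J s| * (2/(1+|s|)) := mul_le_mul_of_nonneg_left (pb_bd hb s) (abs_nonneg _)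
        _ = _ := by ring
    · refine .of_forall fun s => ?_
      have : Tendsto (fun b : ℝ => b/(s^2+b^2)) atTop (𝓝 0) := by
        refine squeeze_zero' (g := fun b : ℝ => b⁻¹) ?_ ?_ tendsto_inv_atTop_zero
        · filter_upwards [eventually_gt_atTop 0] with b hb; positivity
        · filter_upwards [eventually_gt_atTop 0] with b hb
          rw [← one_div, div_le_div_iff₀ (by positivity) hb]; nlinarith [sq_nonneg s]
      simpa using this.const_mul (J s)
  have l2 : Tendsto (fun b : ℝ => ∫ x, f x * Q1 b x) atTop (𝓝 (∫ s : ℝ, 0)) := by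
    refine tendsto_integral_filter_of_dominated_convergence (fun s => M * (1+s^2)⁻¹) ?_ ?_ (integrable_inv_one_add_sq.const_mul M) ?_
    · filter_upwards [eventually_gt_atTop 0] with b hb using (fQ1_int hb f M hf.continuous hM).1
    · filter_upwards [eventually_ge_atTop 1] with b hb
      refine .of_forall fun s => ?_
      rw [norm_eq_abs, abs_mul]
      refine mul_le_mul (hM s) ((Q1_bd (by linarith) s).trans ?_) (abs_nonneg _) hM0
      rw [← one_div]
      gcongr 1 / ?_; nlinarith
    · refine .of_forall fun s => ?_
      have : Tendsto (fun b : ℝ => Q1 b s) atTop (𝓝 0) := by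
        refine squeeze_zero_norm' (a := fun b : ℝ => b⁻¹) ?_ tendsto_inv_atTop_zero
        filter_upwards [eventually_ge_atTop 1] with b hb
        refine (Q1_bd (by linarith) s).trans ?_
        rw [← one_div]; gcongr 1/?_; nlinarith [sq_nonneg s]
      simpa using this.const_mul (f s)
  have l3 := l1.add l2
  have l4 := tendsto_nhds_unique (l3.congr' (key.mono fun b hb => hb.symm)) tendsto_const_nhds
  simp at l4
  linarith
end
section
lemma J_trans (J : ℝ → ℝ) (hJ : Integrable (fun s => J s / (1+|s|))) (x0 : ℝ) :
    Integrable (fun s => J (s+x0) / (1+|s|)) := by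
  have h1 : Integrable (fun s => J s * (1/(1+|s-x0|))) := by
    refine J_mul_int J _ hJ (1+|x0|) (by fun_prop) fun s => ?_
    rw [abs_of_pos (by positivity), div_le_div_iff₀ (by positivity) (by positivity)]
    have : |s| ≤ |s-x0| + |x0| := by simpa using abs_add_le (s-x0) x0
    nlinarith [abs_nonneg (s-x0), abs_nonneg x0, mul_nonneg (abs_nonneg (s-x0)) (abs_nonneg x0)]
  have := h1.comp_add_right x0
  refine this.congr (.of_forall fun s => ?_)
  simp [div_eq_mul_inv]
lemma pv_trans (J f : ℝ → ℝ) (x0 : ℝ)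
    (h : IsHilbertPV J (deriv f)) :
    ∀ x, Tendsto (fun ε : ℝ => (1 / π) * ∫ y in {y : ℝ | ε < |x - y|}, J (y+x0) / (x - y))
      (𝓝[>] 0) (𝓝 (deriv (fun x => f (x+x0)) x)) := by
  intro x
  rw [deriv_comp_add_const]
  refine (h (x+x0)).congr fun ε => ?_
  congr 1
  have hm : ∀ x, MeasurableSet {y : ℝ | ε < |x - y|} := fun x => measurableSet_lt (by fun_prop) (by fun_prop)
  rw [← integral_indicator (hm _), ← integral_indicator (hm _), ← integral_add_right_eq_self _ x0]
  congr 1; ext y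
  simp only [indicator, Set.mem_ofPred_eq, add_sub_add_right_eq_sub]
lemma poisson_x (J f : ℝ → ℝ) (M : ℝ) (hJ : Integrable (fun s => J s / (1+|s|))) (hf : Differentiable ℝ f)
    (hM : ∀ x, |f x| ≤ M)
    (h : IsHilbertPV J (deriv f)) {a : ℝ} (ha : 0 < a) (x0 : ℝ) :
    ∫ s, J (s+x0) * (a/(s^2+a^2)) = ∫ r in Ioi 0, d2 f x0 r * Q1 a r := by
  have hf' : Differentiable ℝ (fun x => f (x+x0)) := hf.comp (by fun_prop)
  rw [poisson_a (fun s => J (s+x0)) (fun x => f (x+x0)) M (J_trans J hJ x0) hf' (fun x => hM _) (pv_trans J f x0 h) ha]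
  have hi := fQ1_int ha (fun x => f (x+x0)) M hf'.continuous (fun x => hM _)
  rw [integral_fold _ hi 0]
  have hfi := integrable_fold _ hi 0
  have hev : ∀ r, Q1 a (0-r) = Q1 a r := fun r => by simp [Q1]
  have hQi : IntegrableOn (Q1 a) (Ioi 0) := by
    have := fQ1_int ha (fun _ => 1) 1 continuous_const (by simp)
    simpa using this.integrableOn
  have hQ0 : ∫ r in Ioi 0, Q1 a r = 0 := by
    have hl : Tendsto (Q0 a) atTop (𝓝 0) := by
      refine squeeze_zero' (g := fun b : ℝ => b⁻¹) ?_ ?_ tendsto_inv_atTop_zero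
      · filter_upwards [eventually_gt_atTop 0] with b hb; unfold Q0; positivity
      · filter_upwards [eventually_gt_atTop 0] with b hb
        rw [← one_div, Q0, div_le_div_iff₀ (by positivity) hb]; nlinarith [sq_nonneg a]
    rw [integral_Ioi_of_hasDerivAt_of_tendsto (Q0_deriv ha 0).continuousAt.continuousWithinAt (fun x _ => Q0_deriv ha x) hQi hl]
    simp [Q0]
  have e : ∀ r, d2 f x0 r * Q1 a r = 2 * f x0 * Q1 a r - (f (0+r+x0) * Q1 a (0+r) + f (0-r+x0) * Q1 a (0-r)) := by
    intro r; rw [hev, d2]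
    rw [show 0 + r + x0 = x0 + r by ring, show 0 - r + x0 = x0 - r by ring, zero_add]; ring
  simp_rw [e]
  have := integral_sub (hQi.const_mul (2 * f x0)) hfi
  rw [this, integral_const_mul, hQ0]; ring
lemma rhs_lim (f : ℝ → ℝ) {N x : ℝ} (hf : Measurable f) (h : ∀ r, 0 < r → |d2 f x r| ≤ N * min (r^2) 1) :
    Tendsto (fun a => ∫ r in Ioi 0, d2 f x r * Q1 a r) (𝓝[>] 0) (𝓝 (-(π * Lam 1 f x))) ∧
    ∀ a, 0 < a → |∫ r in Ioi 0, d2 f x r * Q1 a r| ≤ N * wkI 1 := by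
  have e : -(π * Lam 1 f x) = ∫ r in Ioi 0, -(d2 f x r / r^(1+1:ℝ)) := by
    rw [Lam, integral_neg]; field_simp
  have hm := d2_meas hf x
  have bd : ∀ a, 0 < a → ∀ r ∈ Ioi (0:ℝ), ‖d2 f x r * Q1 a r‖ ≤ N * wk 1 r := by
    intro a ha r hr
    have hr' : 0 < r := hr
    have h1 := h r hr
    rw [norm_mul, norm_eq_abs, norm_eq_abs, wk, ← mul_div_assoc, div_eq_mul_one_div]
    have e2 : r^(1+1:ℝ) = r^2 := by rw [← Real.rpow_natCast]; norm_num
    rw [e2]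
    refine mul_le_mul h1 ((Q1_bd ha r).trans ?_) (abs_nonneg _) ((abs_nonneg _).trans h1)
    gcongr; nlinarith
  constructor
  · rw [e]
    refine tendsto_integral_filter_of_dominated_convergence (fun r => N * wk 1 r) ?_ ?_ ((wk_int one_pos one_lt_two).const_mul N) ?_
    · filter_upwards [self_mem_nhdsWithin] with a ha
      exact (hm.mul (Q1_cont ha).measurable).aestronglyMeasurable
    · filter_upwards [self_mem_nhdsWithin] with a ha
      exact (ae_restrict_iff' measurableSet_Ioi).2 (.of_forall fun r hr => bd a ha r hr)
    · refine (ae_restrict_iff' measurableSet_Ioi).2 (.of_forall fun r hr => ?_)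
      have hr' : 0 < r := hr
      have hc : ContinuousAt (fun a => d2 f x r * Q1 a r) 0 := by
        unfold Q1
        refine ContinuousAt.mul continuousAt_const (ContinuousAt.div (by fun_prop) (by fun_prop) ?_)
        positivity
      have := hc.tendsto.mono_left (nhdsWithin_le_nhds (s := Ioi 0))
      refine this.trans (le_of_eq ?_)
      congr 1
      have e2 : r^(1+1:ℝ) = r^2 := by rw [← Real.rpow_natCast]; norm_num
      rw [e2, Q1]; field_simp; simp; ring
  · intro a ha
    rw [← norm_eq_abs, wkI, ← integral_const_mul]
    refine norm_integral_le_of_norm_le ((wk_int one_pos one_lt_two).const_mul N) ?_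
    exact (ae_restrict_iff' measurableSet_Ioi).2 (.of_forall fun r hr => bd a ha r hr)
def Phi (φ : ℝ → ℝ) (a s : ℝ) : ℝ := ∫ x, φ x * (a/((s-x)^2+a^2))
lemma cs_data {φ : ℝ → ℝ} (hφ : Continuous φ) (hc : HasCompactSupport φ) :
    ∃ R A : ℝ, 1 ≤ R ∧ 0 ≤ A ∧ (∀ x, |φ x| ≤ A) ∧ ∀ x, R < |x| → φ x = 0 := by
  obtain ⟨A, hA⟩ := hc.exists_bound_of_continuous hφ
  obtain ⟨R, hR⟩ := hc.isCompact.isBounded.exists_norm_le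
  refine ⟨max R 1, A, le_max_right _ _, (norm_nonneg _).trans (hA 0), hA, fun x hx => ?_⟩
  by_contra h
  have := hR x (subset_tsupport _ h)
  rw [norm_eq_abs] at this
  linarith [le_max_left R 1]
lemma Phi_eq (φ : ℝ → ℝ) {a : ℝ} (ha : 0 < a) (s : ℝ) : Phi φ a s = ∫ z, φ (a*z+s) * (1+z^2)⁻¹ := by
  have h1 : Phi φ a s = ∫ x, φ (x+s) * (a/(x^2+a^2)) := by
    rw [Phi, ← integral_add_right_eq_self _ s]
    congr 1; ext x; congr 3; ring
  have h2 := Measure.integral_comp_mul_left (fun x => φ (x+s) * (a/(x^2+a^2))) a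
  rw [abs_of_pos (by positivity), smul_eq_mul] at h2
  have h3 : Phi φ a s = a * ∫ x, φ (a*x+s) * (a/((a*x)^2+a^2)) := by
    rw [h2, h1, ← mul_assoc, mul_inv_cancel₀ ha.ne', one_mul]
  rw [h3, ← integral_const_mul]
  congr 1; ext z
  have : (a*z)^2+a^2 = a^2*(1+z^2) := by ring
  rw [this]; field_simp
lemma Phi_bd {φ : ℝ → ℝ} (hφ : Continuous φ) (hc : HasCompactSupport φ) : ∃ C, ∀ a, 0 < a → a ≤ 1 → ∀ s,
    |Phi φ a s| ≤ C/(1+|s|) := by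
  obtain ⟨R, A, hR, hA0, hA, hs⟩ := cs_data hφ hc
  have hi : Integrable φ := hφ.integrable_of_hasCompactSupport hc
  have hI0 : 0 ≤ ∫ x, |φ x| := integral_nonneg fun x => abs_nonneg _
  refine ⟨A*π*(1+2*R) + 8 * ∫ x, |φ x|, fun a ha ha1 s => ?_⟩
  rw [le_div_iff₀ (by positivity)]
  rcases le_or_gt |s| (2*R) with h | h
  · have h1 : |Phi φ a s| ≤ A * π := by
      rw [Phi_eq φ ha, ← integral_univ_inv_one_add_sq, ← integral_const_mul, ← norm_eq_abs]
      refine norm_integral_le_of_norm_le (integrable_inv_one_add_sq.const_mul A) (.of_forall fun z => ?_)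
      rw [norm_mul, norm_eq_abs, norm_eq_abs, abs_of_pos (by positivity : 0 < (1+z^2)⁻¹)]
      gcongr; exact hA _
    have := pi_pos
    calc _ ≤ A * π * (1+2*R) := by gcongr
      _ ≤ _ := by linarith
  · have hs1 : 1 ≤ |s| := by linarith
    have h1 : |Phi φ a s| ≤ (∫ x, |φ x|) * (4/s^2) := by
      rw [Phi, ← integral_mul_const, ← norm_eq_abs]
      refine norm_integral_le_of_norm_le (hi.abs.mul_const _) (.of_forall fun x => ?_)
      rw [norm_mul, norm_eq_abs, norm_eq_abs]
      rcases le_or_gt |x| R with hx | hx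
      · refine mul_le_mul_of_nonneg_left ?_ (abs_nonneg _)
        have h2 : |s| - |x| ≤ |s - x| := abs_sub_abs_le_abs_sub s x
        have h3 : |s|/2 ≤ |s-x| := by linarith
        have h4 : s^2/4 ≤ (s-x)^2 := by
          rw [← sq_abs s, ← sq_abs (s-x)]; nlinarith
        have h5 : 0 < s^2 := by rw [← sq_abs s]; positivity
        rw [abs_of_pos (by positivity), div_le_div_iff₀ (by positivity) h5]
        nlinarith [sq_nonneg a]
      · simp [hs x hx]
    have h6 : 4/s^2 * (1+|s|) ≤ 8 := by
      have h5 : 0 < s^2 := by rw [← sq_abs s]; positivity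
      rw [div_mul_eq_mul_div, div_le_iff₀ h5, ← sq_abs s]; nlinarith
    have : 0 ≤ A * π * (1+2*R) := by have := pi_pos; positivity
    calc _ ≤ (∫ x, |φ x|) * (4/s^2) * (1+|s|) := by gcongr
      _ = (∫ x, |φ x|) * (4/s^2 * (1+|s|)) := by ring
      _ ≤ (∫ x, |φ x|) * 8 := by gcongr
      _ ≤ _ := by linarith
lemma Phi_lim {φ : ℝ → ℝ} (hφ : Continuous φ) (hc : HasCompactSupport φ) (s : ℝ) :
    Tendsto (fun a => Phi φ a s) (𝓝[>] 0) (𝓝 (π * φ s)) := by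
  obtain ⟨R, A, hR, hA0, hA, hs⟩ := cs_data hφ hc
  have h : Tendsto (fun a => ∫ z, φ (a*z+s) * (1+z^2)⁻¹) (𝓝[>] 0) (𝓝 (∫ z, φ s * (1+z^2)⁻¹)) := by
    refine tendsto_integral_filter_of_dominated_convergence (fun z => A * (1+z^2)⁻¹) ?_ ?_ (integrable_inv_one_add_sq.const_mul A) ?_
    · refine .of_forall fun a => Continuous.aestronglyMeasurable ?_
      refine Continuous.mul (by fun_prop) (Continuous.inv₀ (by fun_prop) fun x => by positivity)
    · refine .of_forall fun a => .of_forall fun z => ?_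
      rw [norm_mul, norm_eq_abs, norm_eq_abs, abs_of_pos (by positivity : 0 < (1+z^2)⁻¹)]
      gcongr; exact hA _
    · refine .of_forall fun z => ?_
      have hc : Continuous (fun a => φ (a*z+s) * (1+z^2)⁻¹) := by fun_prop
      have := (hc.tendsto 0).mono_left (nhdsWithin_le_nhds (s := Ioi 0))
      simpa using this
  rw [integral_const_mul, integral_univ_inv_one_add_sq, mul_comm] at h
  refine h.congr' ?_
  filter_upwards [self_mem_nhdsWithin] with a ha
  rw [Phi_eq φ ha]
lemma Phi_meas {φ : ℝ → ℝ} (hφ : Continuous φ) (a : ℝ) : Measurable (Phi φ a) := by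
  have : StronglyMeasurable (Function.uncurry fun s x => φ x * (a/((s-x)^2+a^2))) := by
    refine Measurable.stronglyMeasurable ?_
    have := hφ.measurable
    unfold Function.uncurry; fun_prop
  exact this.integral_prod_right.measurable
lemma J_aesm (J : ℝ → ℝ) (hJ : Integrable (fun s => J s / (1+|s|))) : AEStronglyMeasurable J := by
  have h1 : AEStronglyMeasurable (fun s => (J s / (1+|s|)) * (1+|s|)) := hJ.1.mul (by fun_prop)
  refine h1.congr (.of_forall fun s => ?_)
  have : 1+|s| ≠ 0 := by positivity
  simp only; field_simp
lemma Phi_fub (J : ℝ → ℝ) (hJ : Integrable (fun s => J s / (1+|s|))) {φ : ℝ → ℝ} (hφ : Continuous φ)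
    (hc : HasCompactSupport φ) {a : ℝ} (ha : 0 < a) (ha1 : a ≤ 1) :
    ∫ x, φ x * ∫ s, J (s+x) * (a/(s^2+a^2)) = ∫ s, J s * Phi φ a s := by
  have hi : Integrable (fun x => (1+|x|) * φ x) :=
    Continuous.integrable_of_hasCompactSupport (by fun_prop) hc.mul_left
  have hb := hi.abs.mul_prod (hJ.abs.const_mul (2/a))
  have hP : Integrable (fun p : ℝ × ℝ => φ p.1 * (J p.2 * (a/((p.2-p.1)^2+a^2)))) (volume.prod volume) := by
    refine hb.mono' ?_ (.of_forall fun p => ?_)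
    · refine hφ.aestronglyMeasurable.comp_fst.mul ((J_aesm J hJ).comp_snd.mul (Measurable.aestronglyMeasurable (by fun_prop)))
    · rw [norm_mul, norm_mul, norm_eq_abs, norm_eq_abs, norm_eq_abs, abs_mul (1 + |p.1|), abs_of_pos (by positivity : 0 < 1 + |p.1|), abs_div (J p.2), abs_of_pos (by positivity : 0 < 1 + |p.2|)]
      have k : |a/((p.2-p.1)^2+a^2)| * (1+|p.2|) ≤ (1+|p.1|) * (2/a) := by
        rw [abs_of_pos (by positivity)]
        have h1 : |p.2| ≤ |p.2-p.1| + |p.1| := by simpa using abs_add_le (p.2-p.1) p.1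
        set u := |p.2-p.1|
        have hu : (p.2-p.1)^2 = u^2 := (sq_abs _).symm
        have hu0 : 0 ≤ u := abs_nonneg _
        have h2 : 1 + |p.2| ≤ (1+|p.1|)*(1+u) := by nlinarith [abs_nonneg p.1, mul_nonneg (abs_nonneg p.1) hu0]
        have h3 : a/(u^2+a^2) * (1+u) ≤ 2/a := by
          rw [div_mul_eq_mul_div, div_le_div_iff₀ (by positivity) ha]
          nlinarith [sq_nonneg (u-1), mul_nonneg hu0 ha.le, sq_nonneg (a*u-u), mul_nonneg hu0 (sub_nonneg.2 ha1), sq_nonneg (u-a), mul_nonneg (sub_nonneg.2 ha1) (mul_nonneg hu0 ha.le)]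
        rw [hu]
        calc _ ≤ a/(u^2+a^2) * ((1+|p.1|)*(1+u)) := by gcongr
          _ = (1+|p.1|) * (a/(u^2+a^2) * (1+u)) := by ring
          _ ≤ _ := by gcongr
      calc |φ p.1| * (|J p.2| * |a/((p.2-p.1)^2+a^2)|) = |φ p.1| * (|J p.2|/(1+|p.2|)) * (|a/((p.2-p.1)^2+a^2)| * (1+|p.2|)) := by field_simp
        _ ≤ |φ p.1| * (|J p.2|/(1+|p.2|)) * ((1+|p.1|) * (2/a)) := mul_le_mul_of_nonneg_left k (by positivity)
        _ = _ := by ring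
  have e1 : ∀ x, φ x * ∫ s, J (s+x) * (a/(s^2+a^2)) = ∫ s, φ x * (J s * (a/((s-x)^2+a^2))) := by
    intro x
    rw [integral_const_mul, ← integral_add_right_eq_self (fun s => J s * (a/((s-x)^2+a^2))) x]
    simp
  simp_rw [e1]
  rw [integral_integral_swap hP]
  congr 1; ext s
  rw [Phi, ← integral_const_mul]
  congr 1; ext x; ring
lemma J_test (J f : ℝ → ℝ) (M : ℝ) (hJ : Integrable (fun s => J s / (1+|s|))) (hf : ContDiff ℝ 2 f)
    (hM : ∀ x, |f x| ≤ M)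
    (h : IsHilbertPV J (deriv f)) {φ : ℝ → ℝ} (hφ : Continuous φ) (hc : HasCompactSupport φ) :
    ∫ x, φ x * J x = ∫ x, φ x * (-Lam 1 f x) := by
  have hfd : Differentiable ℝ f := hf.differentiable (by norm_num)
  obtain ⟨R, A, hR, hA0, hA, hs⟩ := cs_data hφ hc
  obtain ⟨N, hN0, hN⟩ := d2_locM hf hM R
  obtain ⟨C, hC⟩ := Phi_bd hφ hc
  have hle : ∀ᶠ a : ℝ in 𝓝[>] 0, 0 < a ∧ a ≤ 1 := by
    filter_upwards [Ioc_mem_nhdsGT (zero_lt_one (α := ℝ))] with a ha using ha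
  have l1 : Tendsto (fun a => ∫ s, J s * Phi φ a s) (𝓝[>] 0) (𝓝 (∫ s, J s * (π * φ s))) := by
    refine tendsto_integral_filter_of_dominated_convergence (fun s => C * |J s / (1+|s|)|) ?_ ?_ (hJ.abs.const_mul C) ?_
    · exact .of_forall fun a => (J_aesm J hJ).mul (Phi_meas hφ a).aestronglyMeasurable
    · filter_upwards [hle] with a ha
      refine .of_forall fun s => ?_
      rw [norm_mul, norm_eq_abs, norm_eq_abs, abs_div, abs_of_pos (by positivity : 0 < 1 + |s|)]
      calc _ ≤ |J s| * (C/(1+|s|)) := mul_le_mul_of_nonneg_left (hC a ha.1 ha.2 s) (abs_nonneg _)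
        _ = _ := by ring
    · exact .of_forall fun s => (Phi_lim hφ hc s).const_mul _
  have l2 : Tendsto (fun a => ∫ x, φ x * ∫ r in Ioi 0, d2 f x r * Q1 a r) (𝓝[>] 0) (𝓝 (∫ x, φ x * (-(π * Lam 1 f x)))) := by
    refine tendsto_integral_filter_of_dominated_convergence (fun x => |φ x| * (N * wkI 1)) ?_ ?_ ((hφ.integrable_of_hasCompactSupport hc).abs.mul_const _) ?_
    · filter_upwards [hle] with a ha
      refine hφ.aestronglyMeasurable.mul ?_
      have : StronglyMeasurable (Function.uncurry fun x r => d2 f x r * Q1 a r) := by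
        refine Continuous.stronglyMeasurable ?_
        have := hfd.continuous
        have := Q1_cont ha.1
        unfold d2 Function.uncurry; fun_prop
      exact this.integral_prod_right.aestronglyMeasurable
    · filter_upwards [hle] with a ha
      refine .of_forall fun x => ?_
      rw [norm_mul, norm_eq_abs, norm_eq_abs]
      rcases le_or_gt |x| R with hx | hx
      · exact mul_le_mul_of_nonneg_left ((rhs_lim f hfd.continuous.measurable (hN x hx)).2 a ha.1) (abs_nonneg _)
      · simp [hs x hx]
    · refine .of_forall fun x => ?_
      rcases le_or_gt |x| R with hx | hx
      · exact ((rhs_lim f hfd.continuous.measurable (hN x hx)).1).const_mul _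
      · simp [hs x hx]
  have l3 : Tendsto (fun a => ∫ x, φ x * ∫ r in Ioi 0, d2 f x r * Q1 a r) (𝓝[>] 0) (𝓝 (∫ s, J s * (π * φ s))) := by
    refine l1.congr' ?_
    filter_upwards [hle] with a ha
    rw [← Phi_fub J hJ hφ hc ha.1 ha.2]
    congr 1; ext x
    rw [poisson_x J f M hJ hfd hM h ha.1 x]
  have l4 := tendsto_nhds_unique l2 l3
  have e1 : ∫ x, φ x * (-(π * Lam 1 f x)) = π * ∫ x, φ x * (-Lam 1 f x) := by
    rw [← integral_const_mul]; congr 1; ext x; ring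
  have e2 : ∫ s, J s * (π * φ s) = π * ∫ x, φ x * J x := by
    rw [← integral_const_mul]; congr 1; ext x; ring
  rw [e1, e2] at l4
  exact (mul_left_cancel₀ Real.pi_pos.ne' l4).symm
lemma Lam_locint {f : ℝ → ℝ} {M : ℝ} (hf : ContDiff ℝ 2 f) (hM : ∀ x, |f x| ≤ M) {α : ℝ} (h0 : 0 < α) (h2 : α < 2) :
    LocallyIntegrable (Lam α f) := by
  rw [locallyIntegrable_iff]
  intro K hK
  obtain ⟨R, hR⟩ := hK.isBounded.exists_norm_le
  obtain ⟨N, hN0, hN⟩ := d2_locM hf hM R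
  refine Measure.integrableOn_of_bounded (M := N * wkI α) hK.measure_lt_top.ne (Lam_meas hf.continuous.measurable α).aestronglyMeasurable ?_
  exact (ae_restrict_iff' hK.measurableSet).2 (.of_forall fun x hx => Lam_bd h0 h2 (hN x (hR x hx)))
lemma J_ae (J f : ℝ → ℝ) (M : ℝ) (hJ : Integrable (fun s => J s / (1+|s|))) (hf : ContDiff ℝ 2 f)
    (hM : ∀ x, |f x| ≤ M)
    (h : IsHilbertPV J (deriv f)) : ∀ᵐ x, J x = -Lam 1 f x := by
  refine ae_eq_of_integral_contDiff_smul_eq ?_ (Lam_locint hf hM one_pos one_lt_two).neg fun g hg hc => ?_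
  · rw [locallyIntegrable_iff]
    intro K hK
    have : IntegrableOn (fun s => (1+|s|) * (J s / (1+|s|))) K :=
      IntegrableOn.continuousOn_mul (by fun_prop) hJ.integrableOn hK
    refine this.congr (.of_forall fun s => ?_)
    have : 1+|s| ≠ 0 := by positivity
    simp only; field_simp
  · simpa only [smul_eq_mul, Pi.neg_apply] using J_test J f M hJ hf hM h hg.continuous hc
lemma J_junk (J f : ℝ → ℝ) (hf : ContDiff ℝ 2 f)
    (h : IsHilbertPV J (deriv f)) (x1 : ℝ) (h1 : deriv f x1 ≠ 0) : Integrable (fun s => J s / (1+|s|)) := by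
  have hcd : Continuous (deriv f) := hf.continuous_deriv (by norm_num)
  have hne : ∀ᶠ x in 𝓝[≠] x1, deriv f x ≠ 0 := (hcd.continuousAt.eventually_ne h1).filter_mono nhdsWithin_le_nhds
  obtain ⟨x2, h2, hx⟩ := (hne.and self_mem_nhdsWithin).exists
  have hx12 : 0 < |x2 - x1| := abs_pos.2 (sub_ne_zero.2 hx)
  have ev : ∀ x, deriv f x ≠ 0 → ∀ᶠ ε : ℝ in 𝓝[>] 0, IntegrableOn (fun y => J y / (x-y)) {y : ℝ | ε < |x - y|} := by
    intro x hx
    filter_upwards [(h x).eventually_ne hx] with ε hε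
    by_contra hn
    apply hε
    rw [integral_undef hn, mul_zero]
  have e3 : ∀ᶠ ε : ℝ in 𝓝[>] 0, ε < |x2-x1|/2 := by
    filter_upwards [Ioo_mem_nhdsGT (by positivity : (0:ℝ) < |x2-x1|/2)] with ε hε using hε.2
  obtain ⟨ε, i1, i2, h3, h0⟩ := ((ev x1 h1).and ((ev x2 h2).and (e3.and (self_mem_nhdsWithin (a := (0:ℝ)) (s := Ioi 0))))).exists
  replace h0 : 0 ≤ ε := le_of_lt h0
  have conv : ∀ x, IntegrableOn (fun y => J y / (x-y)) {y : ℝ | ε < |x - y|} → 0 ≤ ε → IntegrableOn (fun s => J s / (1+|s|)) {y : ℝ | ε < |x - y|} := by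
    intro x hi hε
    have hm : MeasurableSet {y : ℝ | ε < |x - y|} := measurableSet_lt (by fun_prop) (by fun_prop)
    have := Integrable.bdd_mul (c := |x|+1) hi (f := fun y => (x-y)/(1+|y|)) (Measurable.aestronglyMeasurable (by fun_prop)) (.of_forall fun y => ?_)
    · refine Integrable.congr this ((ae_restrict_iff' hm).2 (.of_forall fun y hy => ?_))
      have hy' : ε < |x-y| := hy
      have : x - y ≠ 0 := abs_pos.1 (by linarith)
      simp only; field_simp
    · rw [norm_eq_abs, abs_div, abs_of_pos (by positivity : 0 < 1+|y|), div_le_iff₀ (by positivity)]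
      have := abs_sub x y
      nlinarith [abs_nonneg x, abs_nonneg y, mul_nonneg (abs_nonneg x) (abs_nonneg y)]
  have u : {y : ℝ | ε < |x1 - y|} ∪ {y : ℝ | ε < |x2 - y|} = Set.univ := by
    refine Set.eq_univ_of_forall fun y => ?_
    by_contra hy
    simp only [Set.mem_union, Set.mem_ofPred_eq, not_or, not_lt] at hy
    have := abs_sub (x2 - y) (x1 - y)
    rw [show x2 - y - (x1 - y) = x2 - x1 by ring] at this
    linarith
  rw [← integrableOn_univ, ← u]
  exact (conv x1 i1 h0).union (conv x2 i2 h0)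
lemma hilbert_main (J f : ℝ → ℝ) (M : ℝ) (hf : ContDiff ℝ 2 f) (hM : ∀ x, |f x| ≤ M)
    (h : IsHilbertPV J (deriv f)) : ∀ᵐ x, J x * deriv f x = -(deriv f x * Lam 1 f x) := by
  by_cases h1 : ∃ x1, deriv f x1 ≠ 0
  · obtain ⟨x1, h1⟩ := h1
    filter_upwards [J_ae J f M (J_junk J f hf h x1 h1) hf hM h] with x hx
    rw [hx]; ring
  · push Not at h1
    exact .of_forall fun x => by simp [h1]
end
section
lemma Lam_of_pv {α : ℝ} (h0 : 0 < α) (h2 : α < 2) {f L : ℝ → ℝ} {M : ℝ} (hf : ContDiff ℝ 2 f) (hM : ∀ x, |f x| ≤ M)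
    (h : ∀ x, Tendsto (fun ε : ℝ => (1 / π) * ∫ y in {y : ℝ | ε < |x - y|}, (f x - f y) / |x - y| ^ (1 + α))
      (𝓝[>] 0) (𝓝 (L x))) (x : ℝ) : L x = Lam α f x := by
  obtain ⟨N, hN0, hN⟩ := d2_locM hf hM |x|
  have hi := Lam_int h0 h2 hf.continuous.measurable (hN x le_rfl)
  have hM0 : 0 ≤ M := (abs_nonneg _).trans (hM 0)
  refine tendsto_nhds_unique (h x) (Tendsto.const_mul _ ?_)
  have e : ∀ ε : ℝ, 0 < ε → ∫ y in {y : ℝ | ε < |x - y|}, (f x - f y) / |x - y| ^ (1 + α) =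
      ∫ r in Ioi 0, (Ioi ε).indicator (fun r => d2 f x r / r^(1+α)) r := by
    intro ε hε
    have hm : MeasurableSet {y : ℝ | ε < |x - y|} := measurableSet_lt (by fun_prop) (by fun_prop)
    have hfm := hf.continuous.measurable
    rw [← integral_indicator hm, integral_fold _ _ x]
    · refine setIntegral_congr_fun measurableSet_Ioi fun r hr => ?_
      have hr' : 0 < r := hr
      simp only [indicator, Set.mem_ofPred_eq, Set.mem_Ioi, sub_add_cancel_left, abs_neg, sub_sub_cancel, abs_of_pos hr']
      split_ifs
      · unfold d2; ring
      · simp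
    · have hb : Integrable (fun y => (max 1 ε⁻¹)^(1+α) * (1 + ‖x - y‖)^(-(1+α)) * (2^(1+α) * (2*M))) :=
        (((integrable_one_add_norm (E := ℝ) (μ := volume) (r := 1+α) (by simp; linarith)).comp_sub_left x).const_mul _).mul_const _
      refine hb.mono' (Measurable.aestronglyMeasurable ((by fun_prop : Measurable fun y => (f x - f y) / |x - y| ^ (1 + α)).indicator hm)) (.of_forall fun y => ?_)
      simp only [indicator, Set.mem_ofPred_eq, norm_eq_abs]
      split_ifs with hy
      · have hp : 0 < |x-y| := hε.trans hy
        have hq : |f x - f y| ≤ 2*M := by linarith [abs_sub (f x) (f y), hM x, hM y]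
        have hr : 1 + |x-y| ≤ 2 * max 1 ε⁻¹ * |x-y| := by
          have h1 : 1 ≤ max 1 ε⁻¹ * |x-y| := by
            calc (1:ℝ) = ε⁻¹ * ε := by field_simp
              _ ≤ max 1 ε⁻¹ * |x-y| := by gcongr; exact le_max_right _ _
          have h2 : |x-y| ≤ max 1 ε⁻¹ * |x-y| := le_mul_of_one_le_left hp.le (le_max_left _ _)
          linarith
        have hm0 : 0 < max 1 ε⁻¹ := lt_of_lt_of_le one_pos (le_max_left _ _)
        rw [abs_div, abs_of_pos (by positivity : 0 < |x-y|^(1+α)), Real.rpow_neg (by positivity)]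
        have h3 : (1+|x-y|)^(1+α) ≤ (2:ℝ)^(1+α) * (max 1 ε⁻¹)^(1+α) * |x-y|^(1+α) := by
          rw [← Real.mul_rpow (by positivity) (by positivity), ← Real.mul_rpow (by positivity) (by positivity)]
          exact Real.rpow_le_rpow (by positivity) hr (by linarith)
        rw [div_le_iff₀ (by positivity)]
        have h4 : 0 < (1+|x-y|)^(1+α) := by positivity
        calc _ ≤ 2*M := hq
          _ = (1+|x-y|)^(1+α) * (((1+|x-y|)^(1+α))⁻¹ * (2*M)) := by field_simp
          _ ≤ ((2:ℝ)^(1+α) * (max 1 ε⁻¹)^(1+α) * |x-y|^(1+α)) * (((1+|x-y|)^(1+α))⁻¹ * (2*M)) := by gcongr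
          _ = _ := by ring
      · rw [abs_zero]; positivity
  have l : Tendsto (fun ε : ℝ => ∫ r in Ioi 0, (Ioi ε).indicator (fun r => d2 f x r / r^(1+α)) r) (𝓝[>] 0)
      (𝓝 (∫ r in Ioi 0, d2 f x r / r^(1+α))) := by
    refine tendsto_integral_filter_of_dominated_convergence _ (.of_forall fun ε => hi.1.indicator measurableSet_Ioi)
      (.of_forall fun ε => .of_forall fun r => norm_indicator_le_norm_self _ _) hi.norm ?_
    refine (ae_restrict_iff' measurableSet_Ioi).2 (.of_forall fun r hr => ?_)
    refine tendsto_const_nhds.congr' ?_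
    filter_upwards [Ioo_mem_nhdsGT hr] with ε hε
    rw [Set.indicator_of_mem]; exact hε.2
  refine l.congr' ?_
  filter_upwards [self_mem_nhdsWithin] with ε hε using (e ε hε).symm
def Dec (A : ℝ) (φ : ℝ → ℝ) : Prop :=
  ContDiff ℝ (⊤:ℕ∞) φ ∧ ∀ k ≤ 3, ∀ x, |iteratedDeriv k φ x| ≤ A/(1+x^2)
def hh (x r : ℝ) : ℝ := 1/(1+x^2) + 1/(1+(x+r)^2) + 1/(1+(x-r)^2)
lemma Dec.nonneg {A : ℝ} {φ : ℝ → ℝ} (h : Dec A φ) : 0 ≤ A := by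
  have := (abs_nonneg _).trans (h.2 0 (by norm_num) 0); simpa using this
lemma Dec.b0 {A : ℝ} {φ : ℝ → ℝ} (h : Dec A φ) (x : ℝ) : |φ x| ≤ A/(1+x^2) := by
  simpa using h.2 0 (by norm_num) x
lemma cd_le {φ : ℝ → ℝ} (h : ContDiff ℝ (⊤:ℕ∞) φ) (n : ℕ) : ContDiff ℝ n φ := h.of_le (by exact_mod_cast le_top)
lemma hd_iter {φ : ℝ → ℝ} (h : ContDiff ℝ (⊤:ℕ∞) φ) (n : ℕ) (x : ℝ) : HasDerivAt (iteratedDeriv n φ) (iteratedDeriv (n+1) φ x) x := by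
  rw [iteratedDeriv_succ]
  exact ((h.differentiable_iteratedDeriv n (by exact_mod_cast ENat.natCast_lt_top n)) x).hasDerivAt
lemma cont_iter {φ : ℝ → ℝ} (h : ContDiff ℝ (⊤:ℕ∞) φ) (n : ℕ) : Continuous (iteratedDeriv n φ) :=
  continuous_iff_continuousAt.2 fun x => (hd_iter h n x).continuousAt
lemma lip_of_hd {g g' : ℝ → ℝ} (h : ∀ x, HasDerivAt g (g' x) x) {a b C : ℝ} (hb : ∀ x ∈ Icc a b, |g' x| ≤ C)
    {u v : ℝ} (hu : u ∈ Icc a b) (hv : v ∈ Icc a b) : |g u - g v| ≤ C * |u - v| := by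
  simpa using (convex_Icc a b).norm_image_sub_le_of_norm_hasDerivWithin_le (fun x _ => (h x).hasDerivWithinAt) hb hv hu
lemma dec_d2 {A : ℝ} {φ : ℝ → ℝ} (h : Dec A φ) (x : ℝ) {r : ℝ} (hr : 0 < r) :
    |d2 φ x r| ≤ 4 * A * min (r^2) 1 * hh x r := by
  have hA := h.nonneg
  rcases le_total r 1 with h1 | h1
  · have hl : |d2 φ x r| ≤ (A * (4/(1+x^2))) * r^2 := by
      refine d2_of_deriv (h.1.differentiable (by simp)) (fun u hu v hv => ?_) r hr.le h1
      have hd := hd_iter h.1 1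
      simp only [iteratedDeriv_one] at hd
      refine lip_of_hd hd (fun y hy => ?_) hu hv
      refine (h.2 2 (by norm_num) y).trans ?_
      have hp := peetre (y-x) x
      simp only [sub_add_cancel] at hp
      rw [div_eq_mul_one_div]
      refine mul_le_mul_of_nonneg_left (hp.trans ?_) hA
      gcongr
      nlinarith [hy.1, hy.2]
    have : min (r^2) 1 = r^2 := min_eq_left (by nlinarith)
    rw [this]
    refine hl.trans ?_
    have h3 : 1/(1+x^2) ≤ hh x r := by unfold hh; nlinarith [(by positivity : 0 ≤ 1/(1+(x+r)^2)), (by positivity : 0 ≤ 1/(1+(x-r)^2))]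
    calc _ = 4 * A * r^2 * (1/(1+x^2)) := by ring
      _ ≤ _ := by gcongr
  · have : min (r^2) 1 = 1 := min_eq_right (by nlinarith)
    rw [this]
    have a1 := abs_le.1 (h.b0 x)
    have a2 := abs_le.1 (h.b0 (x+r))
    have a3 := abs_le.1 (h.b0 (x-r))
    have p1 : 0 ≤ A/(1+x^2) := by positivity
    have p2 : 0 ≤ A/(1+(x+r)^2) := by positivity
    have p3 : 0 ≤ A/(1+(x-r)^2) := by positivity
    have e : 4*A*1*hh x r = 4*(A/(1+x^2)) + 4*(A/(1+(x+r)^2)) + 4*(A/(1+(x-r)^2)) := by unfold hh; ring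
    rw [e, abs_le]; unfold d2
    constructor <;> linarith [a1.1, a1.2, a2.1, a2.2, a3.1, a3.2]
abbrev nu : Measure ℝ := volume.restrict (Ioi 0)
lemma hh_meas : Measurable (Function.uncurry hh) := by unfold hh Function.uncurry; fun_prop
lemma hh_int {α : ℝ} (h0 : 0 < α) (h2 : α < 2) : Integrable (fun p : ℝ × ℝ => hh p.1 p.2 * wk α p.2) (volume.prod nu) := by
  have hw : Measurable (wk α) := by unfold wk; fun_prop
  have hI : ∀ r, Integrable (fun x => hh x r) := by
    intro r
    have i0 : Integrable (fun x : ℝ => 1/(1+x^2)) := by simpa using integrable_inv_one_add_sq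
    exact (i0.add (i0.comp_add_right r)).add (i0.comp_sub_right r)
  have hI2 : ∀ r, ∫ x, hh x r = 3 * ∫ x : ℝ, 1/(1+x^2) := by
    intro r
    have i0 : Integrable (fun x : ℝ => 1/(1+x^2)) := by simpa using integrable_inv_one_add_sq
    have e1 := integral_add (i0.add (i0.comp_add_right r)) (i0.comp_sub_right r)
    have e2 := integral_add i0 (i0.comp_add_right r)
    have e3 := integral_add_right_eq_self (μ := volume) (fun x : ℝ => 1/(1+x^2)) r
    have e4 := integral_sub_right_eq_self (μ := volume) (fun x : ℝ => 1/(1+x^2)) r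
    simp only [Pi.add_apply] at e1 e2
    unfold hh
    rw [e1, e2, e3, e4]; ring
  have hhn : ∀ x r, 0 ≤ hh x r := fun x r => by unfold hh; positivity
  have hme : Measurable (fun p : ℝ × ℝ => hh p.1 p.2 * wk α p.2) := hh_meas.mul (hw.comp measurable_snd)
  rw [integrable_prod_iff' hme.aestronglyMeasurable]
  refine ⟨.of_forall fun r => (hI r).mul_const (wk α r), ?_⟩
  refine ((wk_int h0 h2).const_mul (3 * ∫ x : ℝ, 1/(1+x^2))).congr ((ae_restrict_iff' measurableSet_Ioi).2 (.of_forall fun r hr => ?_))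
  simp only
  rw [← hI2 r, ← integral_mul_const]
  congr 1; ext x
  rw [norm_of_nonneg (mul_nonneg (hhn _ _) (wk_nonneg α hr))]
lemma d2_meas2 {f : ℝ → ℝ} (hf : Measurable f) (α : ℝ) : Measurable (fun p : ℝ × ℝ => d2 f p.1 p.2 / p.2^(1+α)) := by
  unfold d2; fun_prop
lemma ae_nu {P : ℝ × ℝ → Prop} (h : ∀ x r, 0 < r → P (x, r)) : ∀ᵐ p ∂(volume.prod nu), P p := by
  have hr : (volume : Measure ℝ).prod nu = ((volume : Measure ℝ).prod volume).restrict (Set.univ ×ˢ Ioi 0) := by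
    rw [← Measure.prod_restrict, Measure.restrict_univ]
  rw [hr]
  exact (ae_restrict_iff' (MeasurableSet.univ.prod measurableSet_Ioi)).2 (.of_forall fun p hp => h p.1 p.2 hp.2)
lemma dec_wk {A α : ℝ} {φ : ℝ → ℝ} (h : Dec A φ) (x : ℝ) {r : ℝ} (hr : 0 < r) :
    |d2 φ x r / r^(1+α)| ≤ 4 * A * (hh x r * wk α r) := by
  have := dec_d2 h x hr
  have hp : 0 < r^(1+α) := by positivity
  rw [abs_div, abs_of_pos hp, wk, div_le_iff₀ hp]
  refine this.trans (le_of_eq ?_)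
  field_simp
lemma pair_int {A α M : ℝ} (h0 : 0 < α) (h2 : α < 2) {f φ : ℝ → ℝ} (hf : Measurable f) (hM : ∀ x, |f x| ≤ M) (h : Dec A φ) :
    Integrable (fun p : ℝ × ℝ => f p.1 * (d2 φ p.1 p.2 / p.2^(1+α))) (volume.prod nu) := by
  refine ((hh_int h0 h2).const_mul (M * (4*A))).mono' ((hf.comp measurable_fst).mul (d2_meas2 h.1.continuous.measurable α)).aestronglyMeasurable (ae_nu fun x r hr => ?_)
  have hM0 : 0 ≤ M := (abs_nonneg _).trans (hM 0)
  rw [norm_mul, mul_assoc M]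
  exact mul_le_mul (hM x) (dec_wk h x hr) (norm_nonneg _) hM0
lemma pair_eq {α : ℝ} (f φ : ℝ → ℝ) : ∫ x, f x * Lam α φ x = (1/π) * ∫ x, ∫ r in Ioi 0, f x * (d2 φ x r / r^(1+α)) := by
  rw [← integral_const_mul]
  congr 1; ext x
  rw [integral_const_mul, Lam]; ring
lemma Lam_integrable {A α M : ℝ} (h0 : 0 < α) (h2 : α < 2) {f φ : ℝ → ℝ} (hf : Measurable f) (hM : ∀ x, |f x| ≤ M) (h : Dec A φ) :
    Integrable (fun x => f x * Lam α φ x) := by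
  refine ((pair_int h0 h2 hf hM h).integral_prod_left.const_mul (1/π)).congr (.of_forall fun x => ?_)
  simp only
  rw [integral_const_mul, Lam]; ring
lemma d2_dual {f φ : ℝ → ℝ} {M : ℝ} (hf : Measurable f) (hM : ∀ x, |f x| ≤ M) (hφ : Integrable φ) (r : ℝ) :
    ∫ x, φ x * d2 f x r = ∫ x, f x * d2 φ x r := by
  have hb : ∀ c d : ℝ, Integrable (fun x => f (x + c) * φ (x + d)) := fun c d =>
    (hφ.comp_add_right d).bdd_mul (c := M) (Measurable.aestronglyMeasurable (by fun_prop)) (.of_forall fun x => hM _)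
  have e1 : ∀ x, φ x * d2 f x r = 2 * (f (x+0) * φ (x+0)) - f (x+r) * φ (x+0) - f (x + -r) * φ (x + 0) := by
    intro x; unfold d2; simp only [add_zero, ← sub_eq_add_neg]; ring
  have e2 : ∀ x, f x * d2 φ x r = 2 * (f (x+0) * φ (x+0)) - f (x+0) * φ (x + -r) - f (x+0) * φ (x + r) := by
    intro x; unfold d2; simp only [add_zero, ← sub_eq_add_neg]; ring
  simp_rw [e1, e2]
  have t1 := integral_sub (((hb 0 0).const_mul 2).sub (hb r 0)) (hb (-r) 0)
  have t2 := integral_sub (((hb 0 0).const_mul 2).sub (hb 0 (-r))) (hb 0 r)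
  simp only [Pi.sub_apply] at t1 t2
  rw [t1, t2, integral_sub ((hb 0 0).const_mul 2) (hb r 0), integral_sub ((hb 0 0).const_mul 2) (hb 0 (-r))]
  have s1 := integral_add_right_eq_self (μ := volume) (fun x : ℝ => f (x+0) * φ (x+ -r)) r
  have s2 := integral_add_right_eq_self (μ := volume) (fun x : ℝ => f (x+0) * φ (x+ r)) (-r)
  simp only [add_zero, add_neg_cancel_right, neg_add_cancel_right] at s1 s2 ⊢
  rw [s1, s2]
lemma Lam_dual {A α M : ℝ} (h0 : 0 < α) (h2 : α < 2) {f φ : ℝ → ℝ} (hf : ContDiff ℝ 2 f) (hM : ∀ x, |f x| ≤ M) (h : Dec A φ)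
    (hc : HasCompactSupport φ) : ∫ x, φ x * Lam α f x = ∫ x, f x * Lam α φ x := by
  have hm := hf.continuous.measurable
  obtain ⟨R, A', hR, hA', hb, hs⟩ := cs_data h.1.continuous hc
  obtain ⟨N, hN0, hN⟩ := d2_locM hf hM R
  have hφi : Integrable φ := h.1.continuous.integrable_of_hasCompactSupport hc
  have i1 : Integrable (fun p : ℝ × ℝ => φ p.1 * (d2 f p.1 p.2 / p.2^(1+α))) (volume.prod nu) := by
    refine ((hφi.norm.mul_prod (wk_int h0 h2)).const_mul N).mono' ((h.1.continuous.measurable.comp measurable_fst).mul (d2_meas2 hm α)).aestronglyMeasurable (ae_nu fun x r hr => ?_)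
    rw [norm_mul]
    rcases le_or_gt |x| R with hx | hx
    · calc _ ≤ ‖φ x‖ * (N * wk α r) := mul_le_mul_of_nonneg_left (d2_wk hr (hN x hx r hr)) (norm_nonneg _)
        _ = _ := by ring
    · simp [hs x hx]
  rw [pair_eq, pair_eq]
  congr 1
  have s1 := integral_integral_swap (f := fun x r => φ x * (d2 f x r / r^(1+α))) i1
  have s2 := integral_integral_swap (f := fun x r => f x * (d2 φ x r / r^(1+α))) (pair_int h0 h2 hm hM h)
  rw [s1, s2]
  refine setIntegral_congr_fun measurableSet_Ioi fun r hr => ?_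
  simp only [← mul_div_assoc]
  rw [integral_div, integral_div, d2_dual hm hM hφi]
end
section
def kap (φ : ℝ → ℝ) (x s : ℝ) : ℝ := ∫ θ in (0:ℝ)..1, θ*(1-θ) * iteratedDeriv 3 φ (s + θ*(x-s))
lemma kap_formula {φ : ℝ → ℝ} (h : ContDiff ℝ (⊤:ℕ∞) φ) {x s : ℝ} (hxs : x ≠ s) :
    kap φ x s = (deriv φ x + deriv φ s)/(x-s)^2 - 2*(φ x - φ s)/(x-s)^3 := by
  have hD : x - s ≠ 0 := sub_ne_zero.2 hxs
  have hl : ∀ θ : ℝ, HasDerivAt (fun θ => s + θ*(x-s)) (x-s) θ := fun θ => by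
    simpa using ((hasDerivAt_id θ).mul_const (x-s)).const_add s
  have hd : ∀ θ : ℝ, HasDerivAt (fun θ => θ*(1-θ) * iteratedDeriv 2 φ (s + θ*(x-s))/(x-s) - (1-2*θ) * iteratedDeriv 1 φ (s + θ*(x-s))/(x-s)^2
      - 2 * iteratedDeriv 0 φ (s + θ*(x-s))/(x-s)^3) (θ*(1-θ) * iteratedDeriv 3 φ (s + θ*(x-s))) θ := by
    intro θ
    have d2 := (hd_iter h 2 (s+θ*(x-s))).comp θ (hl θ)
    have d1 := (hd_iter h 1 (s+θ*(x-s))).comp θ (hl θ)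
    have d0 := (hd_iter h 0 (s+θ*(x-s))).comp θ (hl θ)
    have p1 : HasDerivAt (fun θ : ℝ => θ*(1-θ)) (1-2*θ) θ := by
      have := (hasDerivAt_id θ).mul ((hasDerivAt_id θ).const_sub 1)
      refine this.congr_deriv ?_; simp; ring
    have p2 : HasDerivAt (fun θ : ℝ => 1-2*θ) (-2) θ := by
      have := ((hasDerivAt_id θ).const_mul 2).const_sub 1
      refine this.congr_deriv ?_; simp
    have := (((p1.mul d2).div_const (x-s)).sub ((p2.mul d1).div_const ((x-s)^2))).sub ((d0.const_mul 2).div_const ((x-s)^3))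
    refine this.congr_deriv ?_
    simp only [Function.comp_apply]
    field_simp
    ring
  have hc := cont_iter h 3
  rw [kap, intervalIntegral.integral_eq_sub_of_hasDerivAt (fun θ _ => hd θ) ((by fun_prop : Continuous _).intervalIntegrable _ _)]
  simp only [iteratedDeriv_zero, iteratedDeriv_one]
  simp only [one_mul, zero_mul, add_sub_cancel, add_zero]
  ring
lemma kap_cont {φ : ℝ → ℝ} (h : ContDiff ℝ (⊤:ℕ∞) φ) : Continuous (Function.uncurry (kap φ)) := by
  have hc := cont_iter h 3
  unfold kap Function.uncurry
  apply intervalIntegral.continuous_parametric_intervalIntegral_of_continuous'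
  unfold Function.uncurry
  fun_prop
def kb (x s : ℝ) : ℝ := (1/(1+x^2) + 1/(1+s^2)) / (1+(x-s)^2)
lemma kap_bd {A : ℝ} {φ : ℝ → ℝ} (h : Dec A φ) (x s : ℝ) : |kap φ x s| ≤ 16 * A * kb x s := by
  have hA := h.nonneg
  rcases le_total |x-s| 1 with h1 | h1
  · have b : ∀ θ ∈ Set.uIoc (0:ℝ) 1, ‖θ*(1-θ) * iteratedDeriv 3 φ (s + θ*(x-s))‖ ≤ A * (4/(1+s^2)) := by
      intro θ hθ
      rw [Set.uIoc_of_le zero_le_one] at hθ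
      have h3 := h.2 3 le_rfl (s + θ*(x-s))
      have hp := peetre (θ*(x-s)) s
      have hq : (θ*(x-s))^2 ≤ 1 := by
        rw [mul_pow]
        have : (x-s)^2 ≤ 1 := by rw [← sq_abs]; nlinarith [abs_nonneg (x-s)]
        have : θ^2 ≤ 1 := by nlinarith [hθ.1, hθ.2]
        nlinarith [sq_nonneg θ, sq_nonneg (x-s)]
      rw [norm_mul, norm_of_nonneg (mul_nonneg hθ.1.le (by linarith [hθ.2])), norm_eq_abs]
      have hθ1 : θ*(1-θ) ≤ 1 := by nlinarith [hθ.1, hθ.2, sq_nonneg θ]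
      calc _ ≤ 1 * (A/(1+(s+θ*(x-s))^2)) := by
            apply mul_le_mul hθ1 h3 (abs_nonneg _) zero_le_one
        _ = A * (1/(1+(θ*(x-s)+s)^2)) := by rw [add_comm s]; ring
        _ ≤ A * (2*(1+(θ*(x-s))^2)/(1+s^2)) := by gcongr
        _ ≤ _ := by gcongr; linarith
    have := intervalIntegral.norm_integral_le_of_norm_le_const b
    rw [norm_eq_abs] at this
    refine this.trans ?_
    have hx : (x-s)^2 ≤ 1 := by rw [← sq_abs]; nlinarith [abs_nonneg (x-s)]
    have k1 : 1/(1+s^2)/2 ≤ kb x s := by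
      unfold kb
      have : 0 ≤ 1/(1+x^2) := by positivity
      gcongr <;> linarith
    have : A * (4/(1+s^2)) * |1-0| = 8 * A * (1/(1+s^2)/2) := by norm_num; ring
    rw [this]
    have : 0 ≤ kb x s := by unfold kb; positivity
    nlinarith
  · have hne : x ≠ s := by rintro rfl; norm_num at h1
    rw [kap_formula h.1 hne]
    have d1 : 1 ≤ (x-s)^2 := by rw [← sq_abs]; nlinarith
    have b1 := fun y => h.2 1 (by norm_num) y
    have b0 := h.b0
    simp only [iteratedDeriv_one] at b1
    set a := A/(1+x^2) with ha
    set b := A/(1+s^2) with hb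
    have ha0 : 0 ≤ a := by positivity
    have hb0 : 0 ≤ b := by positivity
    have t1 : |(deriv φ x + deriv φ s)/(x-s)^2| ≤ (a+b)/(x-s)^2 := by
      rw [abs_div, abs_of_pos (by positivity : 0 < (x-s)^2)]
      gcongr
      exact (abs_add_le _ _).trans (add_le_add (b1 x) (b1 s))
    have t2 : |2*(φ x - φ s)/(x-s)^3| ≤ 2*(a+b)/(x-s)^2 := by
      rw [abs_div, abs_mul, abs_two, abs_pow, pow_succ, sq_abs]
      have e1 : |φ x - φ s| ≤ a + b := (abs_sub _ _).trans (add_le_add (b0 x) (b0 s))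
      have : (x-s)^2 ≤ (x-s)^2 * |x-s| := by nlinarith
      gcongr
    refine (abs_sub _ _).trans ((add_le_add t1 t2).trans ?_)
    have e : 16 * A * kb x s = 16*(a+b)/(1+(x-s)^2) := by unfold kb; rw [ha, hb]; field_simp
    rw [e, ← add_div, div_le_div_iff₀ (by positivity) (by positivity)]
    nlinarith [mul_nonneg (add_nonneg ha0 hb0) (sub_nonneg.2 d1)]
lemma kb_int : Integrable (fun p : ℝ × ℝ => kb p.1 p.2) (volume.prod volume) := by
  have i0 : Integrable (fun x : ℝ => 1/(1+x^2)) := by simpa using integrable_inv_one_add_sq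
  have i1 := (i0.mul_prod i0 : Integrable (fun z : ℝ × ℝ => 1/(1+z.1^2) * (1/(1+z.2^2))) (volume.prod volume))
  have j1 := (measurePreserving_sub_prod (μ := (volume : Measure ℝ)) (ν := (volume : Measure ℝ))).integrable_comp_of_integrable i1
  have j2 := (measurePreserving_prod_sub (μ := (volume : Measure ℝ)) (ν := (volume : Measure ℝ))).integrable_comp_of_integrable i1
  refine (j1.add j2).congr (.of_forall fun p => ?_)
  simp only [Pi.add_apply, Function.comp_apply, kb]
  rw [show (p.2-p.1)^2 = (p.1-p.2)^2 by ring]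
  ring
def QB (φ f g : ℝ → ℝ) : ℝ := (1/(2*π)) * ∫ p : ℝ × ℝ, f p.1 * g p.2 * kap φ p.1 p.2
lemma QB_int {A M M' : ℝ} {φ f g : ℝ → ℝ} (h : Dec A φ) (hf : Measurable f) (hg : Measurable g) (hM : ∀ x, |f x| ≤ M)
    (hM' : ∀ x, |g x| ≤ M') : Integrable (fun p : ℝ × ℝ => f p.1 * g p.2 * kap φ p.1 p.2) := by
  rw [Measure.volume_eq_prod]
  refine (kb_int.const_mul (M * M' * (16 * A))).mono' (((hf.comp measurable_fst).mul (hg.comp measurable_snd)).mul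
    (kap_cont h.1).measurable).aestronglyMeasurable (.of_forall fun p => ?_)
  rw [norm_mul, norm_mul, mul_assoc (M*M')]
  have hM0 : 0 ≤ M := (abs_nonneg _).trans (hM 0)
  have hM0' : 0 ≤ M' := (abs_nonneg _).trans (hM' 0)
  exact mul_le_mul (mul_le_mul (hM _) (hM' _) (norm_nonneg _) hM0) (kap_bd h _ _) (norm_nonneg _) (by positivity)
def KK (a b : ℕ) (ψ : ℝ → ℝ) (x s : ℝ) : ℝ := ∫ θ in (0:ℝ)..1, θ^a*(1-θ)^b * ψ (s + θ*(x-s))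
lemma kap_KK (φ : ℝ → ℝ) : kap φ = KK 1 1 (iteratedDeriv 3 φ) := by
  ext x s; simp [kap, KK]
lemma KK_cont (a b : ℕ) {ψ : ℝ → ℝ} (h : Continuous ψ) : Continuous (Function.uncurry (KK a b ψ)) := by
  unfold KK Function.uncurry
  apply intervalIntegral.continuous_parametric_intervalIntegral_of_continuous'
  unfold Function.uncurry
  fun_prop
lemma KK_symm (a b : ℕ) (ψ : ℝ → ℝ) (x s : ℝ) : KK a b ψ x s = KK b a ψ s x := by
  have := intervalIntegral.integral_comp_sub_left (a := 0) (b := 1) (fun θ : ℝ => θ^a*(1-θ)^b * ψ (s + θ*(x-s))) 1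
  simp only [sub_self, sub_zero] at this
  unfold KK
  rw [← this]
  refine intervalIntegral.integral_congr fun θ _ => ?_
  rw [sub_sub_cancel, show s + (1-θ)*(x-s) = x + θ*(s-x) by ring]; ring
lemma KK_deriv (a b : ℕ) {ψ ψ' : ℝ → ℝ} {C : ℝ} (hd : ∀ x, HasDerivAt ψ (ψ' x) x) (hc : Continuous ψ') (hC : ∀ x, |ψ' x| ≤ C) (x s : ℝ) :
    HasDerivAt (fun x => KK a b ψ x s) (KK (a+1) b ψ' x s) x := by
  have hψ : Continuous ψ := continuous_iff_continuousAt.2 fun x => (hd x).continuousAt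
  have hC0 : 0 ≤ C := (abs_nonneg _).trans (hC 0)
  refine (intervalIntegral.hasDerivAt_integral_of_dominated_loc_of_deriv_le (F := fun x θ => θ^a*(1-θ)^b * ψ (s + θ*(x-s)))
    (F' := fun x θ => θ^(a+1)*(1-θ)^b * ψ' (s + θ*(x-s))) (s := Set.univ) (bound := fun _ => C) univ_mem ?_ ?_ ?_ ?_ ?_ ?_).2
  · exact .of_forall fun y => Continuous.aestronglyMeasurable (by fun_prop)
  · exact (by fun_prop : Continuous _).intervalIntegrable _ _
  · exact Continuous.aestronglyMeasurable (by fun_prop)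
  · refine .of_forall fun θ hθ y _ => ?_
    rw [Set.uIoc_of_le zero_le_one] at hθ
    have h1 : θ^(a+1) ≤ 1 := pow_le_one₀ hθ.1.le hθ.2
    have h2 : (1-θ)^b ≤ 1 := pow_le_one₀ (by linarith [hθ.2]) (by linarith [hθ.1])
    have p1 : 0 ≤ θ^(a+1) := pow_nonneg hθ.1.le _
    have p2 : 0 ≤ (1-θ)^b := pow_nonneg (by linarith [hθ.2]) _
    rw [norm_mul, norm_of_nonneg (mul_nonneg p1 p2), norm_eq_abs]
    calc _ ≤ 1 * C := mul_le_mul (by nlinarith) (hC _) (abs_nonneg _) zero_le_one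
      _ = C := one_mul C
  · exact (continuous_const).intervalIntegrable _ _
  · refine .of_forall fun θ hθ y _ => ?_
    have hl : HasDerivAt (fun y => s + θ*(y-s)) θ y := by
      simpa using (((hasDerivAt_id y).sub_const s).const_mul θ).const_add s
    have := ((hd (s+θ*(y-s))).comp y hl).const_mul (θ^a*(1-θ)^b)
    refine this.congr_deriv ?_
    ring
lemma KK_deriv' (a b : ℕ) {ψ ψ' : ℝ → ℝ} {C : ℝ} (hd : ∀ x, HasDerivAt ψ (ψ' x) x) (hc : Continuous ψ') (hC : ∀ x, |ψ' x| ≤ C) (x s : ℝ) :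
    HasDerivAt (fun s => KK a b ψ x s) (KK a (b+1) ψ' x s) s := by
  simp_rw [KK_symm a _ _ x]
  exact KK_deriv b a hd hc hC s x
end
section
abbrev Cc (φ : ℝ → ℝ) : Prop := ContDiff ℝ (⊤:ℕ∞) φ ∧ HasCompactSupport φ
lemma Cc.mul {f g : ℝ → ℝ} (hf : Cc f) (hg : ContDiff ℝ (⊤:ℕ∞) g) : Cc (fun x => f x * g x) := ⟨hf.1.mul hg, hf.2.mul_right⟩
lemma Cc.iter {φ : ℝ → ℝ} (h : Cc φ) (k : ℕ) : Cc (iteratedDeriv k φ) := by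
  induction k with
  | zero => simpa using h
  | succ k ih =>
    rw [iteratedDeriv_succ]
    exact ⟨((contDiff_succ_iff_deriv (n := (⊤:ℕ∞))).1 ih.1).2.2, ih.2.deriv⟩
lemma Cc.deriv {φ : ℝ → ℝ} (h : Cc φ) : Cc (deriv φ) := by simpa using h.iter 1
lemma Cc.bd {φ : ℝ → ℝ} (h : Cc φ) : ∃ A, 0 ≤ A ∧ ∀ x, |φ x| ≤ A := by
  obtain ⟨R, A, _, hA, hb, _⟩ := cs_data h.1.continuous h.2
  exact ⟨A, hA, hb⟩
lemma Cc.int {φ : ℝ → ℝ} (h : Cc φ) : Integrable φ := h.1.continuous.integrable_of_hasCompactSupport h.2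
lemma Cc.hd {φ : ℝ → ℝ} (h : Cc φ) (x : ℝ) : HasDerivAt φ (_root_.deriv φ x) x := (h.1.differentiable (by simp) x).hasDerivAt
lemma Cc.dec {φ : ℝ → ℝ} (h : Cc φ) : ∃ A, Dec A φ := by
  have : ∀ k, ∃ A, 0 ≤ A ∧ ∀ x, |iteratedDeriv k φ x| ≤ A/(1+x^2) := by
    intro k
    have hk := h.iter k
    obtain ⟨A, hA, hb⟩ := (Cc.mul (g := fun x => 1+x^2) hk (by fun_prop)).bd
    refine ⟨A, hA, fun x => ?_⟩
    rw [le_div_iff₀ (by positivity)]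
    have := hb x
    rwa [abs_mul, abs_of_pos (by positivity : 0 < 1+x^2)] at this
  choose A hA hb using this
  refine ⟨A 0 + A 1 + A 2 + A 3, h.1, fun k hk x => (hb k x).trans ?_⟩
  have := hA 0; have := hA 1; have := hA 2; have := hA 3
  gcongr
  interval_cases k <;> linarith
def Sg (g : ℝ → ℝ) (x : ℝ) : ℝ := ∫ r in Ioi 0, (g (x-r) - g (x+r))/r
lemma Sg_bd {g : ℝ → ℝ} (hg : Cc g) (R0 : ℝ) : ∃ L R, 0 ≤ L ∧ ∀ x, |x| ≤ R0 → ∀ r, 0 < r →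
    |(g (x-r) - g (x+r))/r| ≤ (Ioc 0 R).indicator (fun _ => L) r := by
  obtain ⟨R, A, hR, hA, hb, hs⟩ := cs_data hg.1.continuous hg.2
  obtain ⟨L, hL, hLb⟩ := hg.deriv.bd
  refine ⟨2*L, R0+R, by positivity, fun x hx r hr => ?_⟩
  by_cases h : r ≤ R0 + R
  · rw [Set.indicator_of_mem (show r ∈ Ioc 0 (R0+R) from ⟨hr, h⟩), abs_div, abs_of_pos hr, div_le_iff₀ hr]
    have := lip_of_hd (a := x-r) (b := x+r) hg.hd (fun y _ => hLb y) (u := x-r) (v := x+r) ⟨le_rfl, by linarith⟩ ⟨by linarith, le_rfl⟩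
    refine this.trans (le_of_eq ?_)
    rw [show x-r-(x+r) = -(2*r) by ring, abs_neg, abs_of_pos (by positivity)]; ring
  · have hx' := abs_le.1 hx
    have h1 : g (x-r) = 0 := hs _ (by rw [lt_abs]; right; linarith)
    have h2 : g (x+r) = 0 := hs _ (by rw [lt_abs]; left; linarith)
    rw [h1, h2]; simp [indicator]; intros; positivity
lemma ind_int (R L : ℝ) : Integrable ((Ioc 0 R).indicator (fun _ : ℝ => L)) nu :=
  ((integrable_indicator_iff measurableSet_Ioc).2 (by simp)).mono_measure Measure.restrict_le_self
lemma Sg_int {g : ℝ → ℝ} (hg : Cc g) (x : ℝ) : IntegrableOn (fun r => (g (x-r) - g (x+r))/r) (Ioi 0) := by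
  obtain ⟨L, R, hL, hb⟩ := Sg_bd hg |x|
  have hm := hg.1.continuous.measurable
  exact (ind_int R L).mono' (Measurable.aestronglyMeasurable (by fun_prop)) ((ae_restrict_iff' measurableSet_Ioi).2 (.of_forall fun r hr => hb x le_rfl r hr))
lemma Sg_int2 {a g : ℝ → ℝ} (ha : Cc a) (hg : Cc g) :
    Integrable (fun p : ℝ × ℝ => a p.1 * ((g (p.1-p.2) - g (p.1+p.2))/p.2)) (volume.prod nu) := by
  obtain ⟨R0, A, hR, hA, hab, has⟩ := cs_data ha.1.continuous ha.2
  obtain ⟨L, R, hL, hb⟩ := Sg_bd hg R0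
  have hm := hg.1.continuous.measurable
  have hm' := ha.1.continuous.measurable
  refine (ha.int.norm.mul_prod (ind_int R L)).mono' (Measurable.aestronglyMeasurable (by fun_prop)) (ae_nu fun x r hr => ?_)
  rw [norm_mul]
  rcases le_or_gt |x| R0 with hx | hx
  · exact mul_le_mul_of_nonneg_left (hb x hx r hr) (norm_nonneg _)
  · simp [has x hx]
lemma Sg_anti {a g : ℝ → ℝ} (ha : Cc a) (hg : Cc g) : ∫ x, a x * Sg g x = - ∫ x, g x * Sg a x := by
  have s1 := integral_integral_swap (f := fun x r => a x * ((g (x-r) - g (x+r))/r)) (Sg_int2 ha hg)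
  have s2 := integral_integral_swap (f := fun x r => g x * ((a (x-r) - a (x+r))/r)) (Sg_int2 hg ha)
  simp only [integral_const_mul] at s1 s2
  unfold Sg
  rw [s1, s2, ← integral_neg]
  refine setIntegral_congr_fun measurableSet_Ioi fun r hr => ?_
  simp only [← mul_div_assoc]
  rw [integral_div, integral_div, ← neg_div]
  congr 1
  obtain ⟨M, hM0, hM⟩ := ha.bd
  have hma := ha.1.continuous.measurable
  have hb : ∀ c d : ℝ, Integrable (fun x => a (x + c) * g (x + d)) := fun c d =>
    (hg.int.comp_add_right d).bdd_mul (c := M) (Measurable.aestronglyMeasurable (by fun_prop)) (.of_forall fun x => hM _)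
  have e1 : ∀ x, a x * (g (x-r) - g (x+r)) = a (x+0) * g (x + -r) - a (x+0) * g (x+r) := by
    intro x; simp only [add_zero, ← sub_eq_add_neg]; ring
  have e2 : ∀ x, g x * (a (x-r) - a (x+r)) = a (x + -r) * g (x+0) - a (x + r) * g (x+0) := by
    intro x; simp only [add_zero, ← sub_eq_add_neg]; ring
  simp_rw [e1, e2]
  rw [integral_sub (hb 0 (-r)) (hb 0 r), integral_sub (hb (-r) 0) (hb r 0)]
  have t1 := integral_add_right_eq_self (μ := volume) (fun x : ℝ => a (x+0) * g (x+ -r)) r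
  have t2 := integral_add_right_eq_self (μ := volume) (fun x : ℝ => a (x+0) * g (x+ r)) (-r)
  simp only [add_zero, add_neg_cancel_right, neg_add_cancel_right] at t1 t2 ⊢
  rw [t1, t2]; ring
lemma Lam_Sg {f : ℝ → ℝ} (hf : Cc f) (x : ℝ) : Lam 1 f x = (1/π) * Sg (deriv f) x := by
  unfold Lam Sg
  congr 1
  obtain ⟨M, hM0, hM⟩ := hf.bd
  obtain ⟨N, hN0, hN⟩ := d2_locM (cd_le hf.1 2) hM |x|
  have hN := hN x le_rfl
  have hu : ∀ r ∈ Ioi (0:ℝ), HasDerivAt (d2 f x) (deriv f (x-r) - deriv f (x+r)) r := by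
    intro r _
    have a1 := (hf.hd (x+r)).comp r ((hasDerivAt_id r).const_add x)
    have a2 := (hf.hd (x-r)).comp r ((hasDerivAt_id r).const_sub x)
    have := (a1.const_sub (2 * f x)).sub a2
    refine this.congr_deriv ?_
    simp; ring
  have hv : ∀ r ∈ Ioi (0:ℝ), HasDerivAt (fun r : ℝ => -r⁻¹) ((r^2)⁻¹) r := by
    intro r hr
    exact (hasDerivAt_inv (𝕜 := ℝ) (ne_of_gt hr : r ≠ 0)).neg.congr_deriv (by simp)
  have hrp : ∀ r ∈ Ioi (0:ℝ), d2 f x r / r^(1+1:ℝ) = d2 f x r * (r^2)⁻¹ := by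
    intro r hr
    norm_num [div_eq_mul_inv]
  have i1 : IntegrableOn (d2 f x * fun r : ℝ => (r^2)⁻¹) (Ioi 0) :=
    (Lam_int one_pos one_lt_two hf.1.continuous.measurable hN).congr_fun hrp measurableSet_Ioi
  have i2 : IntegrableOn ((fun r => deriv f (x-r) - deriv f (x+r)) * fun r : ℝ => -r⁻¹) (Ioi 0) :=
    (Sg_int hf.deriv x).neg.congr_fun (fun r _ => by simp [div_eq_mul_inv]) measurableSet_Ioi
  have key := integral_Ioi_mul_deriv_eq_deriv_mul hu hv i1 i2 (a' := 0) (b' := 0) ?_ ?_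
  · rw [setIntegral_congr_fun measurableSet_Ioi hrp, key, sub_zero, zero_sub, ← integral_neg]
    congr 1; ext r; ring
  · refine squeeze_zero_norm' (a := fun r => N * r) ?_ ?_
    · filter_upwards [self_mem_nhdsWithin] with r hr
      have hr' : 0 < r := hr
      simp only [Pi.mul_apply, norm_mul, norm_neg, norm_inv, norm_of_nonneg hr'.le]
      rw [← div_eq_mul_inv, div_le_iff₀ hr', norm_eq_abs]
      refine (hN r hr').trans ?_
      calc _ ≤ N * r^2 := by gcongr; exact min_le_left _ _
        _ = _ := by ring
    · have : Tendsto (fun r : ℝ => N * r) (𝓝 0) (𝓝 (N * 0)) := (continuous_const.mul continuous_id).tendsto 0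
      rw [mul_zero] at this
      exact this.mono_left nhdsWithin_le_nhds
  · refine squeeze_zero_norm' (a := fun r => N * r⁻¹) ?_ (by simpa using tendsto_inv_atTop_zero.const_mul N)
    filter_upwards [eventually_gt_atTop 0] with r hr
    simp only [Pi.mul_apply, norm_mul, norm_neg, norm_inv, norm_of_nonneg hr.le]
    gcongr
    refine (hN r hr).trans ?_
    calc _ ≤ N * 1 := by gcongr; exact min_le_right _ _
        _ = _ := by ring
end
section
lemma Cc.int_mul {f k : ℝ → ℝ} (hf : Cc f) (hk : Continuous k) : Integrable (fun x => f x * k x) :=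
  (hf.1.continuous.mul hk).integrable_of_hasCompactSupport hf.2.mul_right
lemma ibp_Cc {f k k' : ℝ → ℝ} (hf : Cc f) (hk : ∀ x, HasDerivAt k (k' x) x) (hk' : Continuous k') :
    ∫ x, deriv f x * k x = - ∫ x, f x * k' x := by
  have hkc : Continuous k := continuous_iff_continuousAt.2 fun x => (hk x).continuousAt
  have := integral_mul_deriv_eq_deriv_mul_of_integrable (u := f) (v := k) (u' := deriv f) (v' := k') (fun x _ => hf.hd x) (fun x _ => hk x)
    (hf.int_mul hk') (hf.deriv.int_mul hkc) (hf.int_mul hkc)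
  rw [this, neg_neg]
lemma KK_quot {φ : ℝ → ℝ} (h : Cc φ) (x s : ℝ) (hxs : x ≠ s) : KK 0 0 (deriv φ) x s = (φ x - φ s)/(x-s) := by
  have hl : ∀ θ : ℝ, HasDerivAt (fun θ => s + θ*(x-s)) (x-s) θ := fun θ => by
    simpa using ((hasDerivAt_id θ).mul_const (x-s)).const_add s
  have hD : x - s ≠ 0 := sub_ne_zero.2 hxs
  have hd : ∀ θ : ℝ, HasDerivAt (fun θ => φ (s + θ*(x-s))/(x-s)) (θ^0*(1-θ)^0*deriv φ (s + θ*(x-s))) θ := fun θ =>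
    (((h.hd _).comp θ (hl θ)).div_const (x-s)).congr_deriv (by field_simp)
  have hc := h.deriv.1.continuous
  rw [KK, intervalIntegral.integral_eq_sub_of_hasDerivAt (fun θ _ => hd θ) ((by fun_prop : Continuous _).intervalIntegrable _ _)]
  simp; ring
lemma Cc_int2 {f g : ℝ → ℝ} (hf : Cc f) (hg : Cc g) {k : ℝ × ℝ → ℝ} (hk : Continuous k) :
    Integrable (fun p : ℝ × ℝ => f p.1 * (g p.2 * k p)) (volume.prod volume) := by
  rw [← Measure.volume_eq_prod]
  have hfc := hf.1.continuous
  have hgc := hg.1.continuous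
  refine Continuous.integrable_of_hasCompactSupport ((hfc.comp continuous_fst).mul ((hgc.comp continuous_snd).mul hk)) ?_
  refine HasCompactSupport.intro (hf.2.isCompact.prod hg.2.isCompact) fun p hp => ?_
  rw [Set.mem_prod, not_and_or] at hp
  rcases hp with hp | hp <;> simp [image_eq_zero_of_notMem_tsupport hp]
lemma M4cc {f φ : ℝ → ℝ} (hf : Cc f) (h : Cc φ) : ∫ x, φ x * (deriv f x * Lam 1 f x) = QB φ f f := by
  have hg := hf.deriv
  have e1 : ∀ x, ∫ s, deriv f s * KK 0 0 (deriv φ) x s = φ x * Sg (deriv f) x - Sg (fun y => deriv f y * φ y) x := by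
    intro x
    have hkc : Continuous (fun s => KK 0 0 (deriv φ) x s) := (KK_cont 0 0 h.deriv.1.continuous).uncurry_left x
    rw [integral_fold _ (hg.int_mul hkc) x]
    unfold Sg
    rw [← integral_const_mul]
    have t := integral_sub ((Sg_int hg x).const_mul (φ x)) (Sg_int (hg.mul h.1) x)
    rw [← t]
    refine setIntegral_congr_fun measurableSet_Ioi fun r hr => ?_
    have hr : 0 < r := hr
    rw [KK_quot h _ _ (by linarith), KK_quot h _ _ (by linarith)]
    have : x - (x+r) = -r := by ring
    have : x - (x-r) = r := by ring
    simp only [*]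
    field_simp; ring
  have i1 : ∀ {a b : ℝ → ℝ}, Cc a → Cc b → Integrable (fun x => a x * Sg b x) := fun ha hb => by
    simpa only [Sg, integral_const_mul] using (Sg_int2 ha hb).integral_prod_left
  have e2 : ∫ x, deriv f x * ∫ s, deriv f s * KK 0 0 (deriv φ) x s = 2 * ∫ x, (deriv f x * φ x) * Sg (deriv f) x := by
    simp_rw [e1]
    have t := integral_sub (i1 (hg.mul h.1) hg) (i1 hg (hg.mul h.1))
    rw [Sg_anti hg (hg.mul h.1)] at t
    rw [two_mul, ← sub_neg_eq_add, ← t]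
    congr 1; ext x; ring
  have hdd : ∀ k x, HasDerivAt (iteratedDeriv k φ) (iteratedDeriv (k+1) φ x) x := hd_iter h.1
  have hcc := cont_iter h.1
  obtain ⟨C2, _, hC2⟩ := (h.iter 2).bd
  obtain ⟨C3, _, hC3⟩ := (h.iter 3).bd
  have k0 := KK_cont 0 1 (hcc 2)
  have k1 := KK_cont 1 1 (hcc 3)
  have e3 : ∀ x, ∫ s, deriv f s * KK 0 0 (deriv φ) x s = - ∫ s, f s * KK 0 1 (iteratedDeriv 2 φ) x s := by
    intro x
    rw [← iteratedDeriv_one (f := φ)]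
    exact ibp_Cc (k' := fun s => KK 0 1 (iteratedDeriv 2 φ) x s) hf (fun s => KK_deriv' (ψ' := iteratedDeriv 2 φ) 0 0 (hdd 1) (hcc 2) hC2 x s) (k0.uncurry_left x)
  have e4 : ∀ s, ∫ x, deriv f x * KK 0 1 (iteratedDeriv 2 φ) x s = - ∫ x, f x * kap φ x s := by
    intro s
    rw [kap_KK]
    exact ibp_Cc (k' := fun x => KK 1 1 (iteratedDeriv 3 φ) x s) hf (fun x => KK_deriv (ψ' := iteratedDeriv 3 φ) 0 1 (hdd 2) (hcc 3) hC3 x s) (k1.uncurry_right s)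
  have e5 : ∫ x, deriv f x * ∫ s, deriv f s * KK 0 0 (deriv φ) x s = ∫ p : ℝ × ℝ, f p.1 * f p.2 * kap φ p.1 p.2 := by
    simp_rw [e3, mul_neg]
    rw [integral_neg]
    simp_rw [← integral_const_mul]
    rw [integral_integral_swap (f := fun x s => deriv f x * (f s * KK 0 1 (iteratedDeriv 2 φ) x s)) (Cc_int2 (k := fun p => KK 0 1 (iteratedDeriv 2 φ) p.1 p.2) hg hf k0)]
    simp_rw [mul_left_comm (deriv f _), integral_const_mul, e4, mul_neg]
    rw [integral_neg, neg_neg]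
    simp_rw [← integral_const_mul]
    have hk : Continuous (fun p : ℝ × ℝ => kap φ p.2 p.1) := by
      simpa only [Function.comp_def, Function.uncurry, Prod.fst_swap, Prod.snd_swap] using (kap_cont h.1).comp continuous_swap
    rw [integral_integral_swap (f := fun s x => f s * (f x * kap φ x s)) (Cc_int2 (k := fun p => kap φ p.2 p.1) hf hf hk), Measure.volume_eq_prod,
      integral_prod _ (by simp only [mul_assoc]; exact Cc_int2 (k := fun p => kap φ p.1 p.2) hf hf (kap_cont h.1))]
    congr 1; ext x; congr 1; ext s; ring
  rw [QB, ← e5, e2]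
  simp_rw [Lam_Sg hf]
  rw [← integral_const_mul, ← integral_const_mul]
  congr 1; ext x; field_simp
end
section
def chi0 : ContDiffBump (0:ℝ) := ⟨1, 2, one_pos, one_lt_two⟩
def cut (k : ℝ) (x : ℝ) : ℝ := chi0 (x/k)
lemma cut_smooth (k : ℝ) : ContDiff ℝ (⊤:ℕ∞) (cut k) := chi0.contDiff.comp (contDiff_id.div_const k)
lemma cut_one {k x : ℝ} (hk : 0 < k) (hx : |x| ≤ k) : cut k x = 1 :=
  chi0.one_of_mem_closedBall (by simp [chi0, abs_of_pos hk, div_le_one hk, hx])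
lemma cut_zero {k x : ℝ} (hk : 0 < k) (hx : 2*k ≤ |x|) : cut k x = 0 :=
  chi0.zero_of_le_dist (by simpa [chi0, abs_div, abs_of_pos hk, le_div_iff₀ hk] using hx)
lemma cut_abs (k x : ℝ) : |cut k x| ≤ 1 := by
  rw [cut, abs_of_nonneg chi0.nonneg]; exact chi0.le_one
lemma cut_Cc {k : ℝ} (hk : 0 < k) : Cc (cut k) := by
  refine ⟨cut_smooth k, HasCompactSupport.intro (isCompact_Icc (a := -(2*k)) (b := 2*k)) fun x hx => cut_zero hk ?_⟩
  by_contra hh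
  exact hx (abs_le.1 (not_le.1 hh).le)
lemma QB_tendsto {ι : Type*} {l : Filter ι} [l.IsCountablyGenerated] {A M : ℝ} {φ f : ℝ → ℝ} {F : ι → ℝ → ℝ} (h : Dec A φ)
    (hm : ∀ᶠ i in l, Measurable (F i)) (hM : ∀ᶠ i in l, ∀ x, |F i x| ≤ M) (hl : ∀ x, Tendsto (fun i => F i x) l (𝓝 (f x))) :
    Tendsto (fun i => QB φ (F i) (F i)) l (𝓝 (QB φ f f)) := by
  refine Tendsto.const_mul _ ?_
  rw [Measure.volume_eq_prod]
  refine tendsto_integral_filter_of_dominated_convergence _ ?_ ?_ (kb_int.const_mul (M * M * (16 * A))) (.of_forall fun p => ?_)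
  · filter_upwards [hm, hM] with i hi hMi
    have := (QB_int h hi hi hMi hMi).1
    rwa [Measure.volume_eq_prod] at this
  · filter_upwards [hM] with i hMi
    refine .of_forall fun p => ?_
    have hM0 : 0 ≤ M := (abs_nonneg _).trans (hMi 0)
    rw [norm_mul, norm_mul, mul_assoc (M*M)]
    exact mul_le_mul (mul_le_mul (hMi _) (hMi _) (norm_nonneg _) hM0) (kap_bd h _ _) (norm_nonneg _) (by positivity)
  · exact ((hl p.1).mul (hl p.2)).mul_const _
lemma pair_tendsto {ι : Type*} {l : Filter ι} [l.IsCountablyGenerated] {M : ℝ} {g f : ℝ → ℝ} {F : ι → ℝ → ℝ} (h : Integrable g)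
    (hm : ∀ᶠ i in l, Measurable (F i)) (hM : ∀ᶠ i in l, ∀ x, |F i x| ≤ M) (hl : ∀ x, Tendsto (fun i => F i x) l (𝓝 (f x))) :
    Tendsto (fun i => ∫ x, F i x * g x) l (𝓝 (∫ x, f x * g x)) := by
  refine tendsto_integral_filter_of_dominated_convergence _ ?_ ?_ (h.norm.const_mul M) (.of_forall fun x => (hl x).mul_const _)
  · filter_upwards [hm] with i hi
    exact hi.aestronglyMeasurable.mul h.1
  · filter_upwards [hM] with i hMi
    refine .of_forall fun p => ?_
    rw [norm_mul]
    exact mul_le_mul_of_nonneg_right (hMi p) (norm_nonneg _)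
lemma deriv_eq_of_near {f g : ℝ → ℝ} {x η : ℝ} (hη : 0 < η) (h : ∀ y, |y - x| < η → g y = f y) : deriv g x = deriv f x := by
  refine Filter.EventuallyEq.deriv_eq ?_
  filter_upwards [Metric.ball_mem_nhds x hη] with y hy
  exact h y (by rwa [Metric.mem_ball, dist_eq] at hy)
lemma M4 {f φ : ℝ → ℝ} {M : ℝ} (hf : ContDiff ℝ (⊤:ℕ∞) f) (hM : ∀ x, |f x| ≤ M) (h : Cc φ) :
    ∫ x, φ x * (deriv f x * Lam 1 f x) = QB φ f f := by
  obtain ⟨A, hA⟩ := h.dec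
  obtain ⟨R, A', hR, hA', hb, hs⟩ := cs_data h.1.continuous h.2
  obtain ⟨n, hn0, hn⟩ := d2_loc (cd_le hf 2) R
  have hM0 : 0 ≤ M := (abs_nonneg _).trans (hM 0)
  let F : ℕ → ℝ → ℝ := fun k x => f x * cut (k+1) x
  have kp : ∀ k : ℕ, (0:ℝ) < k+1 := fun k => by positivity
  have hF : ∀ k, Cc (F k) := fun k => by
    have := (cut_Cc (kp k)).mul hf
    simpa only [mul_comm (cut _ _)] using this
  have hFM : ∀ k x, |F k x| ≤ M := fun k x => by
    rw [abs_mul]; nlinarith [hM x, cut_abs (k+1) x, abs_nonneg (f x)]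
  have hFe : ∀ (k : ℕ) (x : ℝ), |x| ≤ (k:ℝ) → F k x = f x := fun k x hx => by
    simp only [F]; rw [cut_one (kp k) (by linarith), mul_one]
  have hFl : ∀ x, Tendsto (fun k => F k x) atTop (𝓝 (f x)) := fun x => by
    obtain ⟨K, hK⟩ := exists_nat_ge |x|
    refine tendsto_const_nhds.congr' ?_
    filter_upwards [eventually_ge_atTop K] with k hk
    exact (hFe k x (hK.trans (by exact_mod_cast hk))).symm
  have t1 := QB_tendsto (l := atTop) hA (.of_forall fun k => (hF k).1.continuous.measurable) (.of_forall hFM) hFl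
  obtain ⟨K, hK⟩ := exists_nat_ge (R+1)
  have near : ∀ k ≥ K, ∀ x, |x| ≤ R → ∀ y, |y-x| ≤ 1 → F k y = f y := fun k hk x hx y hy => hFe k y (by
    have : (K:ℝ) ≤ k := by exact_mod_cast hk
    have := abs_sub_abs_le_abs_sub y x
    linarith)
  have hd2 : ∀ k ≥ K, ∀ x, |x| ≤ R → ∀ r, 0 < r → |d2 (F k) x r| ≤ (n+4*M) * min (r^2) 1 := fun k hk x hx r hr =>
    d2_min (hFM k) hn0 (fun r hr hr1 => by
      have e : d2 (F k) x r = d2 f x r := by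
        unfold d2
        rw [near k hk x hx x (by simp), near k hk x hx (x+r) (by simp [abs_of_pos hr, hr1]), near k hk x hx (x-r) (by simp [abs_of_pos hr, hr1])]
      rw [e]; exact hn x hx r hr hr1) hr
  have hder : ∀ k ≥ K, ∀ x, |x| ≤ R → deriv (F k) x = deriv f x := fun k hk x hx =>
    deriv_eq_of_near one_pos fun y hy => near k hk x hx y hy.le
  have hLl : ∀ x, |x| ≤ R → Tendsto (fun k => Lam 1 (F k) x) atTop (𝓝 (Lam 1 f x)) := fun x hx => by
    refine Tendsto.const_mul _ (tendsto_integral_filter_of_dominated_convergence (fun r => (n+4*M) * wk 1 r) ?_ ?_ ((wk_int one_pos one_lt_two).const_mul _) ?_)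
    · exact .of_forall fun k => (by
        have := (hF k).1.continuous.measurable
        unfold d2; exact Measurable.aestronglyMeasurable (by fun_prop))
    · filter_upwards [eventually_ge_atTop K] with k hk
      exact (ae_restrict_iff' measurableSet_Ioi).2 (.of_forall fun r hr => d2_wk hr (hd2 k hk x hx r hr))
    · exact .of_forall fun r => Tendsto.div_const ((((hFl x).const_mul 2).sub (hFl _)).sub (hFl _)) _
  have t2 : Tendsto (fun k => ∫ x, φ x * (deriv (F k) x * Lam 1 (F k) x)) atTop (𝓝 (∫ x, φ x * (deriv f x * Lam 1 f x))) := by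
    have hc := hf.continuous_deriv (by simp)
    have hLm : ∀ k, StronglyMeasurable (Lam 1 (F k)) := fun k => Lam_meas (hF k).1.continuous.measurable 1
    refine tendsto_integral_filter_of_dominated_convergence (fun x => ((n+4*M) * wkI 1) * ‖φ x * deriv f x‖) ?_ ?_ ((h.int_mul hc).norm.const_mul _) ?_
    · exact .of_forall fun k => h.1.continuous.aestronglyMeasurable.mul ((hF k).deriv.1.continuous.aestronglyMeasurable.mul (hLm k).aestronglyMeasurable)
    · filter_upwards [eventually_ge_atTop K] with k hk
      refine .of_forall fun x => ?_
      rcases le_or_gt |x| R with hx | hx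
      · rw [hder k hk x hx, ← mul_assoc, norm_mul, mul_comm]
        exact mul_le_mul_of_nonneg_right (Lam_bd one_pos one_lt_two (hd2 k hk x hx)) (norm_nonneg _)
      · simp [hs x hx]
    · refine .of_forall fun x => ?_
      rcases le_or_gt |x| R with hx | hx
      · refine Tendsto.const_mul _ (((hLl x hx).const_mul (deriv f x)).congr' ?_)
        filter_upwards [eventually_ge_atTop K] with k hk
        rw [hder k hk x hx]
      · simp [hs x hx]
  simp_rw [M4cc (hF _) h] at t2
  exact tendsto_nhds_unique t2 t1
end
section
def qq (α μ : ℝ) (φ f : ℝ → ℝ) : ℝ := QB φ f f - μ * ∫ x, f x * Lam α φ x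
lemma Lam_int1 {A α : ℝ} (h0 : 0 < α) (h2 : α < 2) {φ : ℝ → ℝ} (h : Dec A φ) : Integrable (Lam α φ) := by
  simpa using Lam_integrable h0 h2 (f := fun _ => 1) measurable_const (fun _ => by simp) h (M := 1)
lemma qq_tendsto {ι : Type*} {l : Filter ι} [l.IsCountablyGenerated] {α A M : ℝ} (μ : ℝ) (h0 : 0 < α) (h2 : α < 2) {φ f : ℝ → ℝ} {F : ι → ℝ → ℝ} (h : Dec A φ)
    (hm : ∀ᶠ i in l, Measurable (F i)) (hM : ∀ᶠ i in l, ∀ x, |F i x| ≤ M) (hl : ∀ x, Tendsto (fun i => F i x) l (𝓝 (f x))) :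
    Tendsto (fun i => qq α μ φ (F i)) l (𝓝 (qq α μ φ f)) :=
  (QB_tendsto h hm hM hl).sub ((pair_tendsto (Lam_int1 h0 h2 h) hm hM hl).const_mul μ)
lemma phi_Lam_int {α M : ℝ} (h0 : 0 < α) (h2 : α < 2) {f φ g : ℝ → ℝ} (hf : ContDiff ℝ (⊤:ℕ∞) f) (hM : ∀ x, |f x| ≤ M) (h : Cc φ)
    (hg : Continuous g) : Integrable (fun x => φ x * (g x * Lam α f x)) := by
  obtain ⟨R, A', hR, hA', hb, hs⟩ := cs_data h.1.continuous h.2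
  obtain ⟨N, hN0, hN⟩ := d2_locM (cd_le hf 2) hM R
  refine ((h.int_mul hg).norm.mul_const (N * wkI α)).mono' (h.1.continuous.aestronglyMeasurable.mul
    (hg.aestronglyMeasurable.mul (Lam_meas hf.continuous.measurable α).aestronglyMeasurable)) (.of_forall fun x => ?_)
  rcases le_or_gt |x| R with hx | hx
  · rw [← mul_assoc, norm_mul]
    exact mul_le_mul_of_nonneg_left (Lam_bd h0 h2 (hN x hx)) (norm_nonneg _)
  · simp [hs x hx]
def GG (α μ : ℝ) (f : ℝ → ℝ) (x : ℝ) : ℝ := deriv f x * Lam 1 f x - μ * Lam α f x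
lemma qq_eq {α M : ℝ} (μ : ℝ) (h0 : 0 < α) (h2 : α < 2) {f φ : ℝ → ℝ} (hf : ContDiff ℝ (⊤:ℕ∞) f) (hM : ∀ x, |f x| ≤ M) (h : Cc φ) :
    qq α μ φ f = ∫ x, φ x * GG α μ f x := by
  obtain ⟨A, hA⟩ := h.dec
  have t := integral_sub (phi_Lam_int one_pos one_lt_two hf hM h (hf.continuous_deriv (by simp))) (phi_Lam_int h0 h2 hf hM h (continuous_const (y := μ)))
  have e : ∫ x, φ x * GG α μ f x = ∫ x, (φ x * (deriv f x * Lam 1 f x) - φ x * (μ * Lam α f x)) := by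
    congr 1; ext x; simp [GG]; ring
  rw [e, t, M4 hf hM h, qq, ← Lam_dual h0 h2 (cd_le hf 2) hM hA h.2, ← integral_const_mul]
  congr 2; ext x; ring
lemma iter_zero {φ : ℝ → ℝ} {R : ℝ} (h : ∀ x, R < |x| → φ x = 0) (k : ℕ) : ∀ x, R < |x| → iteratedDeriv k φ x = 0 := by
  induction k with
  | zero => simpa using h
  | succ k ih =>
    intro x hx
    rw [iteratedDeriv_succ]
    have : iteratedDeriv k φ =ᶠ[𝓝 x] fun _ => 0 := by
      filter_upwards [(isOpen_lt continuous_const continuous_abs).mem_nhds hx] with y hy using ih y hy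
    rw [this.deriv_eq]; simp
def CB (k : ℕ) (A : ℝ) (φ : ℝ → ℝ) : Prop := ∀ j ≤ k, ∀ x, |iteratedDeriv j φ x| ≤ A
lemma CB.dec {φ : ℝ → ℝ} {R A : ℝ} (hφ : Cc φ) (h : CB 3 A φ) (hs : ∀ x, R < |x| → φ x = 0) : Dec (A*(1+R^2)) φ := by
  refine ⟨hφ.1, fun k hk x => ?_⟩
  have hA : 0 ≤ A := (abs_nonneg _).trans (h 0 (by norm_num) 0)
  rcases le_or_gt |x| R with hx | hx
  · rw [le_div_iff₀ (by positivity)]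
    have : x^2 ≤ R^2 := sq_le_sq.2 (hx.trans (le_abs_self R))
    exact mul_le_mul (h k hk x) (by linarith) (by positivity) hA
  · rw [iter_zero hs k x hx]; simp; positivity
lemma qq_bd {α μ : ℝ} (h0 : 0 < α) (h2 : α < 2) (hμ : 0 ≤ μ) (M : ℝ) (hM0 : 0 ≤ M) : ∃ C, 0 ≤ C ∧ ∀ φ f A, Dec A φ → Measurable f → (∀ x, |f x| ≤ M) →
    |QB φ f f| ≤ C * A ∧ |∫ x, f x * Lam α φ x| ≤ C * A ∧ |qq α μ φ f| ≤ C * A := by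
  set C1 := (1/(2*π)) * (M*M*16*∫ p : ℝ × ℝ, kb p.1 p.2 ∂(volume.prod volume)) with hC1
  set C2 := (1/π) * (M*4*∫ p : ℝ × ℝ, hh p.1 p.2 * wk α p.2 ∂(volume.prod nu)) with hC2
  have hpi := pi_pos
  have p1 : 0 ≤ C1 := by
    have : 0 ≤ ∫ p : ℝ × ℝ, kb p.1 p.2 ∂(volume.prod volume) := integral_nonneg fun p => by simp only [kb]; positivity
    positivity
  have p2 : 0 ≤ C2 := by
    have : 0 ≤ ∫ p : ℝ × ℝ, hh p.1 p.2 * wk α p.2 ∂(volume.prod nu) := integral_nonneg_of_ae (ae_nu fun x r hr =>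
      mul_nonneg (by simp only [hh]; positivity) (wk_nonneg α hr))
    positivity
  refine ⟨C1 + C2 + μ*C2, by positivity, fun φ f A h hm hM => ?_⟩
  have hA := h.nonneg
  have b1 : |QB φ f f| ≤ C1 * A := by
    rw [QB, abs_mul, abs_of_pos (by positivity : 0 < 1/(2*π)), hC1, mul_assoc (1/(2*π))]
    refine mul_le_mul_of_nonneg_left ?_ (by positivity)
    rw [← norm_eq_abs, Measure.volume_eq_prod]
    refine (norm_integral_le_of_norm_le (kb_int.const_mul (M * M * (16 * A))) (.of_forall fun p => ?_)).trans (le_of_eq ?_)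
    · rw [norm_mul, norm_mul, mul_assoc (M*M)]
      exact mul_le_mul (mul_le_mul (hM _) (hM _) (norm_nonneg _) hM0) (kap_bd h _ _) (norm_nonneg _) (by positivity)
    · rw [integral_const_mul]; ring
  have b2 : |∫ x, f x * Lam α φ x| ≤ C2 * A := by
    have e := integral_prod _ (pair_int h0 h2 hm hM h)
    rw [pair_eq, abs_mul, abs_of_pos (by positivity : 0 < 1/π), hC2, mul_assoc (1/π)]
    refine mul_le_mul_of_nonneg_left ?_ (by positivity)
    have e' : ∫ x, ∫ r in Ioi 0, f x * (d2 φ x r / r^(1+α)) = _ := e.symm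
    rw [e', ← norm_eq_abs]
    refine (norm_integral_le_of_norm_le ((hh_int h0 h2).const_mul (M * (4*A))) (ae_nu fun x r hr => ?_)).trans (le_of_eq ?_)
    · rw [norm_mul, mul_assoc M]
      exact mul_le_mul (hM x) (dec_wk h x hr) (norm_nonneg _) hM0
    · rw [integral_const_mul]; ring
  have b3 : |qq α μ φ f| ≤ C1 * A + μ * (C2 * A) := by
    rw [qq]
    refine (abs_sub _ _).trans (add_le_add b1 ?_)
    rw [abs_mul, abs_of_nonneg hμ]
    exact mul_le_mul_of_nonneg_left b2 hμ
  have q1 := mul_nonneg p1 hA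
  have q2 := mul_nonneg p2 hA
  have q3 := mul_nonneg hμ q2
  refine ⟨b1.trans ?_, b2.trans ?_, b3.trans ?_⟩ <;> nlinarith
structure Sol (α μ : ℝ) (B : ℝ → ℝ → ℝ) : Prop where
  h0 : 0 < α
  h2 : α < 2
  hμ : 0 ≤ μ
  smooth : ∀ t, 0 ≤ t → ContDiff ℝ (⊤:ℕ∞) (B t)
  diff : ∀ t, 0 < t → ∀ x, DifferentiableAt ℝ (fun τ => B τ x) t
  eq : ∀ t, 0 < t → ∀ᵐ x, HasDerivAt (fun τ => B τ x) (GG α μ (B t) x) t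
  cont : ∀ x, ContinuousOn (fun τ => B τ x) (Ici 0)
  bdd : ∀ T, 0 < T → ∃ M, 0 ≤ M ∧ ∀ t ∈ Icc (0:ℝ) T, ∀ x, |B t x| ≤ M
section
variable {α μ : ℝ} {B : ℝ → ℝ → ℝ}
lemma Sol.ev (S : Sol α μ B) {t : ℝ} (ht : 0 ≤ t) : (∀ᶠ τ in 𝓝[Ici 0] t, Measurable (B τ)) ∧
    (∃ M, ∀ᶠ τ in 𝓝[Ici 0] t, ∀ x, |B τ x| ≤ M) ∧ ∀ x, Tendsto (fun τ => B τ x) (𝓝[Ici 0] t) (𝓝 (B t x)) := by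
  obtain ⟨M, -, hM⟩ := S.bdd (t+1) (by linarith)
  refine ⟨?_, ⟨M, ?_⟩, fun x => S.cont x t ht⟩
  · filter_upwards [self_mem_nhdsWithin] with τ hτ using (S.smooth τ hτ).continuous.measurable
  · filter_upwards [self_mem_nhdsWithin, nhdsWithin_le_nhds (Iio_mem_nhds (by linarith : t < t+1))] with τ h1 h3
    exact hM τ ⟨h1, le_of_lt h3⟩
lemma Sol.pair_cont (S : Sol α μ B) {g : ℝ → ℝ} (hg : Integrable g) : ContinuousOn (fun t => ∫ x, B t x * g x) (Ici 0) := fun t ht => by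
  obtain ⟨h1, ⟨M, h3⟩, h4⟩ := S.ev ht
  exact pair_tendsto hg h1 h3 h4
lemma Sol.qq_cont (S : Sol α μ B) {A : ℝ} {φ : ℝ → ℝ} (h : Dec A φ) : ContinuousOn (fun t => qq α μ φ (B t)) (Ici 0) := fun t ht => by
  obtain ⟨h1, ⟨M, h3⟩, h4⟩ := S.ev ht
  exact qq_tendsto μ S.h0 S.h2 h h1 h3 h4
end
end
section
lemma smooth_deriv {f : ℝ → ℝ} (hf : ContDiff ℝ (⊤:ℕ∞) f) : ContDiff ℝ (⊤:ℕ∞) (deriv f) :=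
  ((contDiff_succ_iff_deriv (n := (⊤:ℕ∞))).1 hf).2.2
lemma ibp_iter {ψ : ℝ → ℝ} (h : Cc ψ) (k : ℕ) : ∀ {f : ℝ → ℝ}, ContDiff ℝ (⊤:ℕ∞) f →
    ∫ x, f x * iteratedDeriv k ψ x = (-1)^k * ∫ x, iteratedDeriv k f x * ψ x := by
  induction k with
  | zero => intro f _; simp
  | succ k ih =>
    intro f hf
    have t := ibp_Cc (h.iter k) (fun x => (hf.differentiable (by simp) x).hasDerivAt) (smooth_deriv hf).continuous
    rw [← iteratedDeriv_succ] at t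
    simp_rw [mul_comm (iteratedDeriv _ ψ _)] at t
    rw [t, ih (smooth_deriv hf), ← iteratedDeriv_succ']
    ring
lemma ptw {g : ℝ → ℝ} (hg : Continuous g) {R n : ℝ} (h : ∀ ψ, Cc ψ → (∀ x, R ≤ |x| → ψ x = 0) → |∫ x, g x * ψ x| ≤ n * ∫ x, |ψ x|) :
    ∀ x, |x| < R → |g x| ≤ n := by
  intro x hx
  by_contra hcon
  obtain ⟨m, hm1, hm2⟩ := exists_between (not_le.1 hcon)
  obtain ⟨c, hc, hcg⟩ : ∃ c : ℝ, |c| = 1 ∧ c * g x = |g x| := by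
    rcases le_total 0 (g x) with h | h
    · exact ⟨1, by simp, by simp [abs_of_nonneg h]⟩
    · exact ⟨-1, by simp, by simp [abs_of_nonpos h]⟩
  have o1 : IsOpen {y | m < c * g y} := isOpen_lt continuous_const (by fun_prop)
  have o2 : IsOpen {y : ℝ | |y| < R} := isOpen_lt continuous_abs continuous_const
  obtain ⟨ρ, hρ, hball⟩ := Metric.isOpen_iff.1 (o1.inter o2) x ⟨by simpa [hcg] using hm2, hx⟩
  let ψ : ContDiffBump x := ⟨ρ/2, ρ, by positivity, by linarith⟩
  have hz : ∀ y, ρ ≤ dist y x → ψ y = 0 := fun y hy => ψ.zero_of_le_dist hy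
  have hψ : Cc ψ := ⟨ψ.contDiff, ψ.hasCompactSupport⟩
  have hψi : Integrable ψ := hψ.int
  have h1 := h ψ hψ (fun y hy => hz y (by
    by_contra hh
    exact absurd (hball (Metric.mem_ball.2 (not_le.1 hh))).2 (not_lt.2 hy)))
  have hpos : 0 < ∫ y, ψ y := ψ.integral_pos
  have h3 : m * ∫ y, ψ y ≤ c * ∫ y, g y * ψ y := by
    rw [← integral_const_mul, ← integral_const_mul]
    have hi : Integrable (fun y => g y * ψ y) := by simpa only [mul_comm] using hψ.int_mul hg
    refine integral_mono (hψi.const_mul m) (hi.const_mul c) fun y => ?_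
    simp only
    by_cases hy : dist y x < ρ
    · have := (hball (Metric.mem_ball.2 hy)).1
      simp only [Set.mem_ofPred_eq] at this
      rw [← mul_assoc]
      exact mul_le_mul_of_nonneg_right this.le ψ.nonneg
    · rw [hz y (not_lt.1 hy)]; simp
  have h4 : c * ∫ y, g y * ψ y ≤ |∫ y, g y * ψ y| := (le_abs_self _).trans (by rw [abs_mul, hc, one_mul])
  simp_rw [abs_of_nonneg (ψ.nonneg)] at h1
  nlinarith
lemma portion {α μ : ℝ} {B : ℝ → ℝ → ℝ} (S : Sol α μ B) (R : ℝ) {U : Set ℝ} (hU : IsOpen U) (hne : ∃ t, 0 < t ∧ t ∉ U) :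
    ∃ n t1 ρ, 0 ≤ n ∧ 0 < ρ ∧ ρ < t1 ∧ t1 ∉ U ∧ ∀ t, t ∉ U → |t - t1| < ρ → ∀ k ≤ 8, ∀ x, |x| < R → |iteratedDeriv k (B t) x| ≤ n := by
  let E : Set ℝ := Ioi 0 ∩ Uᶜ
  have hE : IsLocallyClosed E := isOpen_Ioi.isLocallyClosed.inter hU.isClosed_compl.isLocallyClosed
  have : LocallyCompactSpace E := hE.locallyCompactSpace
  have : Nonempty E := let ⟨t, h1, h2⟩ := hne; ⟨⟨t, h1, h2⟩⟩
  let C : ℕ → Set E := fun n => {t | ∀ k ≤ 8, ∀ ψ, Cc ψ → (∀ x, R ≤ |x| → ψ x = 0) → |∫ x, B t x * iteratedDeriv k ψ x| ≤ n * ∫ x, |ψ x|}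
  have hcl : ∀ n, IsClosed (C n) := fun n => by
    have : C n = ⋂ (k : ℕ) (_ : k ≤ 8) (ψ : ℝ → ℝ) (_ : Cc ψ) (_ : ∀ x, R ≤ |x| → ψ x = 0),
      {t : E | |∫ x, B t x * iteratedDeriv k ψ x| ≤ n * ∫ x, |ψ x|} := by
      ext t; simp only [C, Set.mem_iInter, Set.mem_ofPred_eq]
    rw [this]
    refine isClosed_iInter fun k => isClosed_iInter fun _ => isClosed_iInter fun ψ => isClosed_iInter fun hψ => isClosed_iInter fun _ => ?_
    have hc : Continuous (fun t : E => ∫ x, B t x * iteratedDeriv k ψ x) :=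
      ((S.pair_cont (hψ.iter k).int).mono (fun t ht => Set.mem_Ici.2 (le_of_lt ht.1) : E ⊆ Ici 0)).domRestrict
    exact isClosed_le hc.abs continuous_const
  have hcov : ⋃ n, C n = Set.univ := by
    refine Set.eq_univ_of_forall fun t => Set.mem_iUnion.2 ?_
    have hs := S.smooth t t.2.1.le
    have hb : ∀ k, ∃ A, ∀ x ∈ Icc (-R) R, ‖iteratedDeriv k (B t) x‖ ≤ A := fun k =>
      (isCompact_Icc (a := -R) (b := R)).exists_bound_of_continuousOn (cont_iter hs k).continuousOn
    choose A hA using hb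
    obtain ⟨n, hn⟩ := exists_nat_ge (∑ k ∈ Finset.range 9, |A k|)
    refine ⟨n, fun k hk ψ hψ hz => ?_⟩
    have hAk : |A k| ≤ n := (Finset.single_le_sum (f := fun k => |A k|) (fun i _ => abs_nonneg _) (Finset.mem_range.2 (by omega : k < 9))).trans hn
    rw [ibp_iter hψ k hs, abs_mul, abs_pow, abs_neg, abs_one, one_pow, one_mul, ← integral_const_mul, ← norm_eq_abs]
    refine norm_integral_le_of_norm_le (hψ.int.abs.const_mul _) (.of_forall fun x => ?_)
    rw [norm_mul]
    rcases le_or_gt R |x| with hx | hx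
    · simp [hz x hx]
    · exact mul_le_mul_of_nonneg_right ((hA k x (abs_le.1 hx.le)).trans ((le_abs_self _).trans hAk)) (norm_nonneg _)
  obtain ⟨n, ⟨t1, ht1⟩⟩ := nonempty_interior_of_iUnion_of_closed hcl hcov
  obtain ⟨ρ, hρ, hb⟩ := Metric.isOpen_iff.1 isOpen_interior t1 ht1
  have h1p : (0:ℝ) < t1 := t1.2.1
  refine ⟨n, t1, min ρ (t1/2), by positivity, by positivity, by linarith [min_le_right ρ ((t1:ℝ)/2)], t1.2.2, fun t ht htt k hk => ?_⟩
  have htp : 0 < t := by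
    have := (abs_lt.1 (htt.trans_le (min_le_right _ _))).1
    linarith
  have hC : (⟨t, htp, ht⟩ : E) ∈ C n := interior_subset (hb (by
    rw [Metric.mem_ball, Subtype.dist_eq, dist_eq]; exact htt.trans_le (min_le_left _ _)))
  have hs := S.smooth t htp.le
  refine ptw (cont_iter hs k) fun ψ hψ hz => ?_
  have := hC k hk ψ hψ hz
  rw [ibp_iter hψ k hs, abs_mul, abs_pow, abs_neg, abs_one, one_pow, one_mul] at this
  exact this
end
section
lemma fam_iter {Ψ : ℕ → ℝ → ℝ} (h : ∀ j x, HasDerivAt (Ψ j) (Ψ (j+1) x) x) (k : ℕ) : iteratedDeriv k (Ψ 0) = Ψ k := by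
  induction k with
  | zero => simp
  | succ k ih => rw [iteratedDeriv_succ, ih]; exact funext fun x => (h k x).deriv
lemma fam_smooth {Ψ : ℕ → ℝ → ℝ} (h : ∀ j x, HasDerivAt (Ψ j) (Ψ (j+1) x) x) : ContDiff ℝ (⊤:ℕ∞) (Ψ 0) :=
  contDiff_of_differentiable_iteratedDeriv fun m _ => by
    rw [fam_iter h]; exact fun x => (h m x).differentiableAt
lemma iter_iter {φ : ℝ → ℝ} (h : ContDiff ℝ (⊤:ℕ∞) φ) (m k : ℕ) : iteratedDeriv k (iteratedDeriv m φ) = iteratedDeriv (m+k) φ :=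
  fam_iter (Ψ := fun j => iteratedDeriv (m+j) φ) (fun j => hd_iter h (m+j)) k
lemma KK_bd {ψ : ℝ → ℝ} {A R : ℝ} (hc : Continuous ψ) (hA : ∀ x, |ψ x| ≤ A) (hs : ∀ x, R < |x| → ψ x = 0) (a : ℕ) {x : ℝ} (hx : |x| ≤ R) (s : ℝ) :
    |KK a 1 ψ x s| ≤ A*(1+(2*R)^2)^2 * (1+s^2)⁻¹ := by
  have hA0 : 0 ≤ A := (abs_nonneg _).trans (hA 0)
  rw [KK_symm]
  have hd : ∀ v : ℝ, HasDerivAt (fun v : ℝ => A*(1+(2*R)^2)^2*(v^2/(2*(1+v^2*s^2)))) (A*(1+(2*R)^2)^2*(v/(1+v^2*s^2)^2)) v := by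
    intro v
    have d1 := (hasDerivAt_pow 2 v)
    have d2 := ((d1.mul_const (s^2)).const_add 1).const_mul 2
    have hp : 2*(1+v^2*s^2) ≠ 0 := by positivity
    refine ((d1.div d2 hp).const_mul _).congr_deriv ?_
    simp only [Nat.cast_ofNat, Nat.add_one_sub_one, pow_one]
    field_simp
    ring
  have hcb : Continuous (fun v : ℝ => A*(1+(2*R)^2)^2*(v/(1+v^2*s^2)^2)) := by
    refine continuous_const.mul (Continuous.div (by fun_prop) (by fun_prop) fun v => by positivity)
  have key := intervalIntegral.norm_integral_le_of_norm_le (a := 0) (b := 1) (μ := volume) (f := fun θ => θ^1*(1-θ)^a * ψ (x + θ*(s-x)))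
    zero_le_one (.of_forall fun v hv => ?_) (hcb.intervalIntegrable 0 1)
  · rw [intervalIntegral.integral_eq_sub_of_hasDerivAt (fun v _ => hd v) (hcb.intervalIntegrable _ _)] at key
    refine key.trans ?_
    have : A*(1+(2*R)^2)^2*(1^2/(2*(1+1^2*s^2))) - A*(1+(2*R)^2)^2*(0^2/(2*(1+0^2*s^2))) = A*(1+(2*R)^2)^2*(1+s^2)⁻¹ / 2 := by
      field_simp; ring
    rw [this]
    exact half_le_self (by positivity)
  · have hv1 : (1-v)^a ≤ 1 := pow_le_one₀ (by linarith [hv.2]) (by linarith [hv.1])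
    have hv2 : 0 ≤ (1-v)^a := pow_nonneg (by linarith [hv.2]) _
    have hv0 := hv.1.le
    rw [norm_mul, norm_of_nonneg (by positivity), pow_one]
    rcases le_or_gt |x + v*(s-x)| R with hu | hu
    · have e : v*s = (x+v*(s-x)) - (1-v)*x := by ring
      have h1 : |v*s| ≤ 2*R := by
        rw [e]
        refine (abs_sub _ _).trans ?_
        rw [abs_mul, abs_of_nonneg (by linarith [hv.2] : 0 ≤ 1-v)]
        nlinarith [abs_nonneg x]
      have h2 : v^2*s^2 ≤ (2*R)^2 := by
        rw [← mul_pow]; exact sq_le_sq.2 (h1.trans (le_abs_self _))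
      rw [mul_div_assoc', le_div_iff₀ (by positivity)]
      have h3 : (1+v^2*s^2)^2 ≤ (1+(2*R)^2)^2 := by gcongr
      have h4 : v*(1-v)^a*‖ψ (x+v*(s-x))‖ ≤ v*1*A := by gcongr; exact hA _
      calc _ ≤ v*1*A*(1+(2*R)^2)^2 := mul_le_mul h4 h3 (by positivity) (by positivity)
        _ = _ := by ring
    · rw [hs _ hu]; simp; positivity
def PsiK (φ G : ℝ → ℝ) (j : ℕ) (x : ℝ) : ℝ := ∫ s, G s * KK (j+1) 1 (iteratedDeriv (3+j) φ) x s
section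
variable {φ G : ℝ → ℝ} {M R : ℝ} (h : Cc φ) (hs : ∀ x, R < |x| → φ x = 0) (hG : Measurable G) (hM : ∀ x, |G x| ≤ M)
include h hs hG hM
lemma PsiK_b {A : ℝ} (j : ℕ) (hA : ∀ x, |iteratedDeriv (3+j) φ x| ≤ A) {x ρ : ℝ} (hρ : R ≤ ρ) (hx : |x| ≤ ρ) (s : ℝ) (a : ℕ):
    ‖G s * KK a 1 (iteratedDeriv (3+j) φ) x s‖ ≤ M*(A*(1+(2*ρ)^2)^2) * (1+s^2)⁻¹ := by
  have hM0 : 0 ≤ M := (abs_nonneg _).trans (hM 0)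
  rw [norm_mul, mul_assoc M]
  exact mul_le_mul (hM s) (KK_bd (cont_iter h.1 _) hA (iter_zero (fun y hy => hs y (hρ.trans_lt hy)) _) _ hx s) (norm_nonneg _) hM0
lemma PsiK_m (j a : ℕ) (x : ℝ) : AEStronglyMeasurable (fun s => G s * KK a 1 (iteratedDeriv (3+j) φ) x s) volume :=
  hG.aestronglyMeasurable.mul ((KK_cont a 1 (cont_iter h.1 (3+j))).uncurry_left x).aestronglyMeasurable
lemma PsiK_bd {A : ℝ} (j : ℕ) (hA : ∀ x, |iteratedDeriv (3+j) φ x| ≤ A) {x : ℝ} (hx : |x| ≤ R) :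
    |PsiK φ G j x| ≤ M*(A*(1+(2*R)^2)^2) * π := by
  have := norm_integral_le_of_norm_le (integrable_inv_one_add_sq.const_mul (M*(A*(1+(2*R)^2)^2)))
    (.of_forall fun s => PsiK_b h hs hG hM j hA le_rfl hx s (j+1))
  rwa [integral_const_mul, integral_univ_inv_one_add_sq] at this
lemma PsiK_hd (j : ℕ) (x : ℝ) : HasDerivAt (PsiK φ G j) (PsiK φ G (j+1) x) x := by
  obtain ⟨A, _, hA⟩ := (h.iter (3+j)).bd
  obtain ⟨A', _, hA'⟩ := (h.iter (3+(j+1))).bd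
  have hρ : R ≤ |x| + |R| + 1 := by linarith [le_abs_self R, abs_nonneg x]
  have hx : |x| < |x| + |R| + 1 := by linarith [abs_nonneg R]
  refine (hasDerivAt_integral_of_dominated_loc_of_deriv_le (F := fun x s => G s * KK (j+1) 1 (iteratedDeriv (3+j) φ) x s)
    (F' := fun x s => G s * KK (j+1+1) 1 (iteratedDeriv (3+(j+1)) φ) x s) (s := {y | |y| < |x|+|R|+1})
    (bound := fun s => M*(A'*(1+(2*(|x|+|R|+1))^2)^2) * (1+s^2)⁻¹) ((isOpen_lt continuous_abs continuous_const).mem_nhds hx) ?_ ?_ ?_ ?_ ?_ ?_).2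
  · exact .of_forall fun y => PsiK_m h hs hG hM j _ y
  · exact (integrable_inv_one_add_sq.const_mul _).mono' (PsiK_m h hs hG hM j _ x) (.of_forall fun s => PsiK_b h hs hG hM j hA hρ hx.le s _)
  · exact PsiK_m h hs hG hM (j+1) _ x
  · exact .of_forall fun s y hy => PsiK_b h hs hG hM (j+1) hA' hρ (le_of_lt hy) s _
  · exact integrable_inv_one_add_sq.const_mul _
  · exact .of_forall fun s y _ => (KK_deriv (j+1) 1 (hd_iter h.1 (3+j)) (cont_iter h.1 (3+(j+1))) hA' y s).const_mul (G s)
end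
lemma dec_d2' {A : ℝ} {φ : ℝ → ℝ} (h : Dec A φ) (x : ℝ) {r : ℝ} (hr : 0 < r) : |d2 φ x r| ≤ 12*A*min (r^2) 1 := by
  refine (dec_d2 h x hr).trans ?_
  have hA := h.nonneg
  have b : ∀ y : ℝ, 1/(1+y^2) ≤ 1 := fun y => by rw [div_le_one (by positivity)]; nlinarith [sq_nonneg y]
  have : hh x r ≤ 3 := by unfold hh; linarith [b x, b (x+r), b (x-r)]
  have hm : 0 ≤ min (r^2) 1 := by positivity
  have := mul_le_mul_of_nonneg_left this (mul_nonneg hA hm)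
  nlinarith
lemma Lam_hd {α : ℝ} (h0 : 0 < α) (h2 : α < 2) {φ : ℝ → ℝ} (h : Cc φ) (j : ℕ) (x : ℝ) :
    HasDerivAt (Lam α (iteratedDeriv j φ)) (Lam α (iteratedDeriv (j+1) φ) x) x := by
  obtain ⟨A, hA⟩ := (h.iter j).dec
  obtain ⟨A', hA'⟩ := (h.iter (j+1)).dec
  have m : ∀ i y, AEStronglyMeasurable (fun r => d2 (iteratedDeriv i φ) y r / r^(1+α)) (volume.restrict (Ioi 0)) := fun i y => by
    have := (d2_meas (cont_iter h.1 i).measurable y)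
    exact Measurable.aestronglyMeasurable (by fun_prop)
  refine HasDerivAt.const_mul _ (hasDerivAt_integral_of_dominated_loc_of_deriv_le (F := fun x r => d2 (iteratedDeriv j φ) x r / r^(1+α))
    (F' := fun x r => d2 (iteratedDeriv (j+1) φ) x r / r^(1+α)) (s := Set.univ) (bound := fun r => 12*A'*wk α r) univ_mem
    (.of_forall fun y => m j y) (Lam_int h0 h2 (cont_iter h.1 j).measurable fun r hr => dec_d2' hA x hr) (m (j+1) x) ?_ ((wk_int h0 h2).const_mul _) ?_).2
  · exact (ae_restrict_iff' measurableSet_Ioi).2 (.of_forall fun r hr y _ => d2_wk hr (dec_d2' hA' y hr))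
  · refine .of_forall fun r y _ => ?_
    have hd := hd_iter h.1 j
    exact ((((hd y).const_mul 2).sub ((hd (y+r)).comp_add_const y r)).sub ((hd (y-r)).comp_sub_const y r)).div_const _
lemma prod_CB {f g : ℝ → ℝ} (hf : ContDiff ℝ (⊤:ℕ∞) f) (hg : ContDiff ℝ (⊤:ℕ∞) g) {X Y R : ℝ} (hX : CB 3 X f) (hY0 : 0 ≤ Y) (hz : ∀ x, R < |x| → f x = 0)
    (hY : ∀ j ≤ 3, ∀ x, |x| ≤ R → |iteratedDeriv j g x| ≤ Y) : CB 3 (8*X*Y) (fun x => f x * g x) := by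
  intro k hk x
  have hX0 : 0 ≤ X := (abs_nonneg _).trans (hX 0 (by norm_num) 0)
  rcases le_or_gt |x| R with hx | hx
  · have e := iteratedDeriv_mul (n := k) (x := x) (cd_le hf k).contDiffAt (cd_le hg k).contDiffAt
    have e' : iteratedDeriv k (fun x => f x * g x) x = _ := e
    rw [e']
    refine (Finset.abs_sum_le_sum_abs _ _).trans ?_
    have : ∀ i ∈ Finset.range (k+1), |(k.choose i : ℝ) * iteratedDeriv i f x * iteratedDeriv (k-i) g x| ≤ (k.choose i : ℝ) * (X*Y) := by
      intro i hi
      have hi := Finset.mem_range.1 hi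
      rw [mul_assoc, abs_mul, abs_mul, Nat.abs_cast]
      gcongr
      · exact hX i (by omega) x
      · exact hY (k-i) (by omega) x hx
    refine (Finset.sum_le_sum this).trans ?_
    rw [← Finset.sum_mul, ← Nat.cast_sum, Nat.sum_range_choose]
    have : ((2^k : ℕ) : ℝ) ≤ 8 := by
      have : (2^k : ℕ) ≤ 2^3 := Nat.pow_le_pow_right (by norm_num) hk
      exact_mod_cast this
    nlinarith [mul_nonneg hX0 hY0]
  · rw [iter_zero (fun y hy => by rw [hz y hy, zero_mul]) k x hx]; simp; positivity
end
section
lemma GG_near {α μ M n η x : ℝ} {F : ℝ → ℝ} (h0 : 0 < α) (h2 : α < 2) (hμ : 0 ≤ μ) (hF : ContDiff ℝ (⊤:ℕ∞) F) (hM : ∀ x, |F x| ≤ M) (hη : 0 < η)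
    (hn : ∀ k ≤ 2, ∀ y, |y-x| ≤ η → |iteratedDeriv k F y| ≤ n) :
    |GG α μ F x| ≤ n*((n+4*M/η^2+4*M)*wkI 1) + μ*((n+4*M/η^2+4*M)*wkI α) := by
  have hM0 : 0 ≤ M := (abs_nonneg _).trans (hM 0)
  have hn0 : 0 ≤ n := (abs_nonneg _).trans (hn 0 (by norm_num) x (by simpa using hη.le))
  have hI : ∀ u ∈ Icc (x-η) (x+η), |u-x| ≤ η := fun u hu => abs_le.2 ⟨by linarith [hu.1], by linarith [hu.2]⟩
  have hl : ∀ u ∈ Icc (x-η) (x+η), ∀ v ∈ Icc (x-η) (x+η), |deriv F u - deriv F v| ≤ n * |u-v| := fun u hu v hv => by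
    have := (convex_Icc (x-η) (x+η)).norm_image_sub_le_of_norm_hasDerivWithin_le (f := iteratedDeriv 1 F) (fun y _ => (hd_iter hF 1 y).hasDerivWithinAt)
      (fun y hy => hn 2 le_rfl y (hI y hy)) hv hu
    simpa only [iteratedDeriv_one, norm_eq_abs] using this
  have hd := d2_of_deriv (hF.differentiable (by simp)) hl
  have hp : 0 ≤ 4*M/η^2 := by positivity
  have hd1 : ∀ r, 0 < r → r ≤ 1 → |d2 F x r| ≤ (n+4*M/η^2)*r^2 := fun r hr _ => by
    rcases le_total r η with h | h
    · exact (hd r hr.le h).trans (by nlinarith [mul_nonneg hp (sq_nonneg r)])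
    · refine (d2_abs hM x r).trans ?_
      have : η^2 ≤ r^2 := by gcongr
      have : 4*M/η^2*η^2 ≤ 4*M/η^2*r^2 := by gcongr
      rw [div_mul_cancel₀ _ (by positivity)] at this
      nlinarith [mul_nonneg hn0 (sq_nonneg r)]
  have hm : ∀ r, 0 < r → |d2 F x r| ≤ (n+4*M/η^2+4*M)*min (r^2) 1 := fun r hr => d2_min hM (by positivity) hd1 hr
  have b1 := Lam_bd one_pos one_lt_two hm
  have b2 := Lam_bd h0 h2 hm
  have b3 := hn 1 (by norm_num) x (by simpa using hη.le)
  rw [iteratedDeriv_one] at b3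
  refine (abs_sub _ _).trans ?_
  rw [abs_mul, abs_mul, abs_of_nonneg hμ]
  gcongr
lemma chi_ex {R' R'' : ℝ} (h : 0 < R') (h' : R' < R'') : ∃ χ : ℝ → ℝ, Cc χ ∧ (∀ x, |x| ≤ R' → χ x = 1) ∧ (∀ x, R'' ≤ |x| → χ x = 0) ∧ ∀ x, |χ x| ≤ 1 := by
  let b : ContDiffBump (0:ℝ) := ⟨R', R'', h, h'⟩
  refine ⟨b, ⟨b.contDiff, b.hasCompactSupport⟩, fun x hx => b.one_of_mem_closedBall (by simpa using hx), fun x hx => b.zero_of_le_dist (by simpa using hx), fun x => ?_⟩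
  rw [abs_of_nonneg b.nonneg]; exact b.le_one
/-- difference of the quadratic form -/
lemma QB_sub {M : ℝ} {φ f F : ℝ → ℝ} (h : Cc φ) (hf : Measurable f) (hF : Measurable F) (hM : ∀ x, |f x| ≤ M) (hM' : ∀ x, |F x| ≤ M) :
    QB φ f f - QB φ F F = (1/(2*π)) * ∫ x, (f x - F x) * PsiK φ (fun s => f s + F s) 0 x := by
  obtain ⟨A, hA⟩ := h.dec
  have s : ∀ x s, kap φ x s = kap φ s x := fun x s => by rw [kap_KK, KK_symm]
  have i1 := QB_int hA hf hf hM hM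
  have i2 := QB_int hA hF hF hM' hM'
  have i3 := QB_int hA hf hF hM hM'
  have i4 := QB_int hA hF hf hM' hM
  have e : ∫ p : ℝ × ℝ, f p.1 * F p.2 * kap φ p.1 p.2 = ∫ p : ℝ × ℝ, F p.1 * f p.2 * kap φ p.1 p.2 := by
    rw [Measure.volume_eq_prod, ← integral_prod_swap]
    refine integral_congr_ae (.of_forall fun p => ?_)
    simp only [Prod.fst_swap, Prod.snd_swap]
    rw [s p.2 p.1]; ring
  have t1 := integral_sub i1 i2
  have t2 := integral_sub i3 i4
  have t3 := integral_add (i1.sub i2) (i3.sub i4)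
  have e2 : ∫ p : ℝ × ℝ, ((f p.1 - F p.1) * (f p.2 + F p.2) * kap φ p.1 p.2) = (∫ p : ℝ × ℝ, f p.1 * f p.2 * kap φ p.1 p.2) - ∫ p : ℝ × ℝ, F p.1 * F p.2 * kap φ p.1 p.2 := by
    rw [e, sub_self] at t2
    simp only [Pi.sub_apply] at t3
    rw [t1, t2, add_zero] at t3
    rw [← t3]
    refine integral_congr_ae (.of_forall fun p => ?_)
    simp only []; ring
  have i5 := QB_int hA (hf.sub hF) (hf.add hF) (M := M+M) (M' := M+M) (fun x => (abs_sub _ _).trans (add_le_add (hM x) (hM' x)))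
    (fun x => (abs_add_le _ _).trans (add_le_add (hM x) (hM' x)))
  unfold QB
  rw [← mul_sub, ← e2]
  congr 1
  rw [Measure.volume_eq_prod] at i5 ⊢
  have t4 := integral_prod _ i5
  simp only [Pi.sub_apply, Pi.add_apply] at t4
  rw [t4]
  refine integral_congr_ae (.of_forall fun x => ?_)
  simp only [PsiK, zero_add]
  rw [← integral_const_mul]
  refine integral_congr_ae (.of_forall fun s => ?_)
  simp only []; rw [kap_KK]; ring
lemma gap_q {α μ n M R R' R'' : ℝ} (h0 : 0 < α) (h2 : α < 2) (hμ : 0 ≤ μ) (hM0 : 0 ≤ M) (hn0 : 0 ≤ n) (hR0 : 0 < R') (hR' : R' < R'') (hR : R'' ≤ R) :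
    ∃ C, 0 ≤ C ∧ ∀ f0 f : ℝ → ℝ, ContDiff ℝ (⊤:ℕ∞) f0 → ContDiff ℝ (⊤:ℕ∞) f → (∀ x, |f0 x| ≤ M) → (∀ x, |f x| ≤ M) →
      (∀ k ≤ 2, ∀ x, |x| < R → |iteratedDeriv k f0 x| ≤ n) → ∀ L,
      (∀ ψ A, Cc ψ → (∀ x, R'' ≤ |x| → ψ x = 0) → CB 3 A ψ → |∫ x, (f x - f0 x) * ψ x| ≤ L*A) →
      ∀ φ A, Cc φ → (∀ x, R' ≤ |x| → φ x = 0) → CB 6 A φ → |qq α μ φ f| ≤ C * ((∫ x, |φ x|) + L*A) := by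
  set η := (R''-R')/4 with hη
  have hη0 : 0 < η := by rw [hη]; linarith
  obtain ⟨χ, hχ, h1, hz, hb⟩ := chi_ex (R' := R'+2*η) (R'' := R'') (by linarith) (by linarith)
  have hX : ∃ X, 0 ≤ X ∧ CB 3 X χ := by
    obtain ⟨X, hX⟩ := hχ.dec
    refine ⟨X, hX.nonneg, fun j hj x => (hX.2 j hj x).trans (div_le_self hX.nonneg (by nlinarith [sq_nonneg x]))⟩
  obtain ⟨X, hX0, hX⟩ := hX
  have hpi := pi_pos
  have w1 := wkI_nonneg 1
  have w2 := wkI_nonneg α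
  set N := n+4*(3*M)/η^2+4*(3*M) with hN
  have hN0 : 0 ≤ N := by positivity
  set Cg := n*(N*wkI 1) + μ*(N*wkI α) with hCg
  have hCg0 : 0 ≤ Cg := by positivity
  set C1 := (1/(2*π)) * (8*X*(4*M*(1+(2*R'')^2)^2*π)) with hC1
  set C2 := μ*(8*X*(12*(1+R''^2)*wkI α)) with hC2
  have c1 : 0 ≤ C1 := by positivity
  have c2 : 0 ≤ C2 := by positivity
  refine ⟨Cg + C1 + C2, by positivity, fun f0 f hf0 hf hM1 hM2 hn L hL φ A hφ hs hA => ?_⟩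
  have hs' : ∀ x, R'' < |x| → φ x = 0 := fun x hx => hs x (by linarith)
  have hA0 : 0 ≤ A := (abs_nonneg _).trans (hA 0 (by norm_num) 0)
  set F : ℝ → ℝ := fun x => f x - (f x - f0 x) * χ x with hF
  have hFs : ContDiff ℝ (⊤:ℕ∞) F := hf.sub ((hf.sub hf0).mul hχ.1)
  have hF1 : ∀ x, |x| ≤ R'+2*η → F x = f0 x := fun x hx => by simp only [hF, h1 x hx]; ring
  have hFM : ∀ x, |F x| ≤ 3*M := fun x => by
    have : |(f x - f0 x) * χ x| ≤ (M+M)*1 := by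
      rw [abs_mul]; exact mul_le_mul ((abs_sub _ _).trans (add_le_add (hM2 x) (hM1 x))) (hb x) (abs_nonneg _) (by linarith)
    refine (abs_sub _ _).trans ?_
    linarith [hM2 x]
  have hfM : ∀ x, |f x| ≤ 3*M := fun x => (hM2 x).trans (by linarith)
  have q1 : |qq α μ φ F| ≤ Cg * ∫ x, |φ x| := by
    rw [qq_eq μ h0 h2 hFs hFM hφ, ← integral_const_mul, ← norm_eq_abs]
    refine norm_integral_le_of_norm_le (hφ.int.abs.const_mul Cg) (.of_forall fun x => ?_)
    rcases lt_or_ge |x| R' with hx | hx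
    · rw [norm_mul, mul_comm]
      refine mul_le_mul_of_nonneg_right (GG_near h0 h2 hμ hFs hFM hη0 fun k hk y hy => ?_) (abs_nonneg _)
      have hy2 : |y| < R' + η := by
        have := abs_add_le (y-x) x
        rw [sub_add_cancel] at this; linarith
      have : F =ᶠ[𝓝 y] f0 := by
        filter_upwards [(isOpen_lt continuous_abs continuous_const).mem_nhds (show |y| < R'+2*η by linarith)] with z hz using hF1 z (le_of_lt hz)
      rw [this.iteratedDeriv_eq]
      exact hn k hk y (by linarith)
    · simp [hs x hx]
  have hGm : Measurable (fun s => f s + F s) := (hf.add hFs).continuous.measurable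
  have hGM : ∀ x, |f x + F x| ≤ 4*M := fun x => (abs_add_le _ _).trans (by linarith [hM2 x, hFM x])
  have hP := fun j x => PsiK_hd hφ hs' hGm hGM j x
  have hLd := fun j x => Lam_hd h0 h2 hφ j x
  have p1 := hL (fun x => χ x * PsiK φ (fun s => f s + F s) 0 x) (8*X*(4*M*(A*(1+(2*R'')^2)^2)*π)) (hχ.mul (fam_smooth hP))
    (fun x hx => by simp [hz x hx]) (prod_CB (R := R'') hχ.1 (fam_smooth hP) hX (by positivity) (fun x hx => hz x hx.le) fun j hj x hx => by
      rw [fam_iter hP]; exact PsiK_bd hφ hs' hGm hGM j (hA (3+j) (by omega)) hx)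
  have p2 := hL (fun x => χ x * Lam α φ x) (8*X*(12*(A*(1+R''^2))*wkI α)) (hχ.mul (by simpa using fam_smooth hLd))
    (fun x hx => by simp [hz x hx]) (prod_CB (R := R'') hχ.1 (by simpa using fam_smooth hLd) hX (by positivity) (fun x hx => hz x hx.le) fun j hj x hx => by
      have := fam_iter hLd j
      simp only [iteratedDeriv_zero] at this
      rw [this]
      have hc : CB 3 A (iteratedDeriv j φ) := fun i hi y => by rw [iter_iter hφ.1]; exact hA _ (by omega) y
      exact Lam_bd h0 h2 fun r hr => dec_d2' (CB.dec (hφ.iter j) hc (iter_zero hs' j)) x hr)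
  obtain ⟨AA, hAA⟩ := hφ.dec
  have d1 := QB_sub hφ hf.continuous.measurable hFs.continuous.measurable hfM hFM
  have d2 := integral_sub (Lam_integrable h0 h2 hf.continuous.measurable hfM hAA) (Lam_integrable h0 h2 hFs.continuous.measurable hFM hAA)
  have e1 : ∀ g : ℝ → ℝ, ∫ x, (f x - F x) * g x = ∫ x, (f x - f0 x) * (χ x * g x) := fun g => by
    congr 1; ext x; simp only [hF]; ring
  have e2 : (∫ x, f x * Lam α φ x) - ∫ x, F x * Lam α φ x = ∫ x, (f x - f0 x) * (χ x * Lam α φ x) := by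
    rw [← d2, ← e1]; congr 1; ext x; ring
  rw [e1] at d1
  have e3 : qq α μ φ f = qq α μ φ F + (1/(2*π)) * (∫ x, (f x - f0 x) * (χ x * PsiK φ (fun s => f s + F s) 0 x)) - μ * ∫ x, (f x - f0 x) * (χ x * Lam α φ x) := by
    rw [← d1, ← e2]; unfold qq; ring
  rw [e3]
  have k1 : |(1/(2*π)) * (∫ x, (f x - f0 x) * (χ x * PsiK φ (fun s => f s + F s) 0 x))| ≤ C1*(L*A) := by
    rw [abs_mul, abs_of_pos (by positivity : 0 < 1/(2*π))]
    calc _ ≤ (1/(2*π)) * (L * (8*X*(4*M*(A*(1+(2*R'')^2)^2)*π))) := by gcongr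
      _ = _ := by rw [hC1]; ring
  have k2 : |μ * ∫ x, (f x - f0 x) * (χ x * Lam α φ x)| ≤ C2*(L*A) := by
    rw [abs_mul, abs_of_nonneg hμ]
    calc _ ≤ μ*(L * (8*X*(12*(A*(1+R''^2))*wkI α))) := by gcongr
      _ = _ := by rw [hC2]; ring
  have hLA : 0 ≤ L*A := by
    have := hL (fun _ => 0) A ⟨contDiff_const, HasCompactSupport.zero⟩ (by simp) (fun j hj x => by simpa using hA0)
    exact (abs_nonneg _).trans this
  have hI : 0 ≤ ∫ x, |φ x| := integral_nonneg fun _ => abs_nonneg _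
  refine (abs_sub _ _).trans ((add_le_add (abs_add_le _ _) le_rfl).trans ?_)
  nlinarith [mul_nonneg hCg0 hLA, mul_nonneg (add_nonneg c1 c2) hI]
end
section
lemma fd_bd (m : ℕ) : ∀ {f : ℝ → ℝ} {R x h n : ℝ}, ContDiff ℝ (⊤:ℕ∞) f → (∀ u, |u| < R → |iteratedDeriv m f u| ≤ n) → |x| + m*|h| < R →
    |(fwdDiff h)^[m] f x| ≤ n*|h|^m := by
  induction m with
  | zero => intro f R x h n _ hn hx; simpa using hn x (by simpa using hx)
  | succ m ih =>
    intro f R x h n hf hn hx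
    rw [Function.iterate_succ_apply, pow_succ', ← mul_assoc]
    have hs : ContDiff ℝ (⊤:ℕ∞) (fwdDiff h f) := (hf.comp (contDiff_id.add contDiff_const)).sub hf
    push_cast at hx
    refine ih (R := R - |h|) hs (fun u hu => ?_) (by linarith)
    have e : iteratedDeriv m (fwdDiff h f) u = iteratedDeriv m f (u+h) - iteratedDeriv m f u := by
      have := fam_iter (Ψ := fun j u => iteratedDeriv j f (u+h) - iteratedDeriv j f u)
        (fun j u => ((hd_iter hf j (u+h)).comp_add_const u h).sub (hd_iter hf j u)) m
      exact congrFun this u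
    rw [e]
    have hu2 : |u+h| < R := (abs_add_le _ _).trans_lt (by linarith)
    have := (convex_ball (0:ℝ) R).norm_image_sub_le_of_norm_hasDerivWithin_le (f := iteratedDeriv m f) (C := n) (fun y _ => (hd_iter hf m y).hasDerivWithinAt)
      (fun y hy => hn y (by simpa using hy)) (x := u) (y := u+h) (by simpa using hu.trans_le (by linarith [abs_nonneg h])) (by simpa using hu2)
    simpa using this
lemma sc_data {φ : ℝ → ℝ} (h : Cc φ) (hz : ∀ x, 1 ≤ |x| → φ x = 0) {A : ℝ} (hA : CB 6 A φ) (x0 : ℝ) {δ y : ℝ} (hy : 0 < y) (hy1 : y ≤ 1) (hδ : y ≤ δ) :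
    Cc (fun u => δ⁻¹*φ (δ⁻¹*(u-x0))) ∧ (∀ x, |x0| + δ ≤ |x| → δ⁻¹*φ (δ⁻¹*(x-x0)) = 0) ∧ CB 6 (A*(y⁻¹)^7) (fun u => δ⁻¹*φ (δ⁻¹*(u-x0))) ∧
    ∀ w : ℝ → ℝ, ∫ u, w u * (δ⁻¹*φ (δ⁻¹*(u-x0))) = ∫ z, w (x0+δ*z) * φ z := by
  have hδ0 : 0 < δ := hy.trans_le hδ
  have hA0 : 0 ≤ A := (abs_nonneg _).trans (hA 0 (by norm_num) 0)
  have hzz : ∀ x, |x0| + δ ≤ |x| → δ⁻¹*φ (δ⁻¹*(x-x0)) = 0 := fun x hx => by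
    rw [hz, mul_zero]
    rw [abs_mul, abs_of_pos (inv_pos.2 hδ0), ← div_eq_inv_mul, le_div_iff₀ hδ0]
    linarith [abs_sub_abs_le_abs_sub x x0]
  have hd : ∀ j x, HasDerivAt (fun u => (δ⁻¹)^(j+1)*iteratedDeriv j φ (δ⁻¹*(u-x0))) ((δ⁻¹)^(j+1+1)*iteratedDeriv (j+1) φ (δ⁻¹*(x-x0))) x := fun j x => by
    have := ((hd_iter h.1 j (δ⁻¹*(x-x0))).comp x (((hasDerivAt_id x).sub_const x0).const_mul δ⁻¹)).const_mul ((δ⁻¹)^(j+1))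
    refine this.congr_deriv ?_
    ring
  have hsm := fam_smooth hd
  have hit := fun k => fam_iter hd k
  simp only [zero_add, pow_one, iteratedDeriv_zero] at hsm hit
  refine ⟨⟨hsm, ?_⟩, hzz, fun k hk x => ?_, fun w => ?_⟩
  · refine HasCompactSupport.intro (isCompact_closedBall (0:ℝ) (|x0|+δ)) fun x hx => hzz x ?_
    simp at hx; exact hx.le
  · rw [hit, abs_mul, abs_of_pos (by positivity), mul_comm]
    have hi : δ⁻¹ ≤ y⁻¹ := inv_anti₀ hy hδ
    have h1 : 1 ≤ y⁻¹ := (one_le_inv₀ hy).2 hy1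
    have : (δ⁻¹)^(k+1) ≤ (y⁻¹)^7 := (pow_le_pow_left₀ (by positivity) hi _).trans (pow_le_pow_right₀ h1 (by omega))
    exact mul_le_mul (hA k hk _) this (by positivity) hA0
  · have e := Measure.integral_comp_mul_left (fun v => w (x0+v)*φ (δ⁻¹*v)) δ
    have e2 := integral_add_left_eq_self (μ := volume) (fun u => w u * φ (δ⁻¹*(u-x0))) x0
    simp only [add_sub_cancel_left] at e2
    rw [e2, abs_of_pos (inv_pos.2 hδ0), smul_eq_mul, ← integral_const_mul] at e
    have e3 : ∀ z, w (x0+δ*z) * φ (δ⁻¹*(δ*z)) = w (x0+δ*z) * φ z := fun z => by rw [inv_mul_cancel_left₀ hδ0.ne']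
    simp only [e3] at e
    rw [e]; congr 1; ext u; ring
lemma bump1 : ∃ φ : ℝ → ℝ, ∃ A, Cc φ ∧ (∀ x, 1 ≤ |x| → φ x = 0) ∧ CB 6 A φ ∧ ∫ x, φ x = 1 ∧ ∀ x, 0 ≤ φ x := by
  let b : ContDiffBump (0:ℝ) := ⟨1/2, 1, by norm_num, by norm_num⟩
  have hc : Cc (b.normed volume) := ⟨b.contDiff_normed, b.hasCompactSupport_normed⟩
  choose A hA0 hA using fun k => (hc.iter k).bd
  refine ⟨b.normed volume, ∑ i ∈ Finset.range 7, A i, hc, fun x hx => ?_, fun j hj x => (hA j x).trans ?_, b.integral_normed, fun x => b.nonneg_normed x⟩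
  · rw [b.normed_def, b.zero_of_le_dist (by simpa using hx), zero_div]
  · exact Finset.single_le_sum (f := A) (fun i _ => hA0 i) (Finset.mem_range.2 (by omega))
lemma ptw_gap {n M C0 R R' R'' : ℝ} (hn0 : 0 ≤ n) (hM0 : 0 ≤ M) (hC0 : 0 ≤ C0) (hR' : R' < R'') (hR : R'' ≤ R) :
    ∃ C, 0 ≤ C ∧ ∀ w : ℝ → ℝ, ContDiff ℝ (⊤:ℕ∞) w → (∀ x, |x| < R → |iteratedDeriv 8 w x| ≤ n) → (∀ x, |w x| ≤ M) → ∀ ℓ, 0 < ℓ →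
      (∀ φ A, Cc φ → (∀ x, R'' ≤ |x| → φ x = 0) → CB 6 A φ → |∫ x, w x * φ x| ≤ C0*ℓ*((∫ x, |φ x|) + ℓ*A)) → ∀ x0, |x0| ≤ R' → |w x0| ≤ C*ℓ := by
  obtain ⟨φ, A, hφ, hz, hA, hi, hp⟩ := bump1
  have hA0 : 0 ≤ A := (abs_nonneg _).trans (hA 0 (by norm_num) 0)
  set y0 := min 1 ((R''-R')/9) with hy0
  have hy00 : 0 < y0 := lt_min one_pos (by linarith)
  refine ⟨M/y0^8 + (n + 255*(C0*(1+A))), by positivity, fun w hw hn hM ℓ hℓ H x0 hx0 => ?_⟩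
  have hq0 : 0 ≤ M/y0^8 := by positivity
  have hq1 : 0 ≤ n + 255*(C0*(1+A)) := by positivity
  rcases le_or_gt (y0^8) ℓ with hl | hl
  · refine (hM x0).trans ?_
    have : M/y0^8*y0^8 ≤ M/y0^8*ℓ := by gcongr
    rw [div_mul_cancel₀ _ (by positivity)] at this
    nlinarith [mul_nonneg hq1 hℓ.le]
  set y := ℓ^((1:ℝ)/8) with hy
  have hyp : 0 < y := Real.rpow_pos_of_pos hℓ _
  have hy8 : y^8 = ℓ := by rw [hy, ← Real.rpow_natCast, ← Real.rpow_mul hℓ.le]; norm_num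
  have hyy : y < y0 := lt_of_pow_lt_pow_left₀ 8 hy00.le (by rw [hy8]; exact hl)
  have hy1 : y ≤ 1 := hyy.le.trans (min_le_left _ _)
  have hy2 : 9*y < R''-R' := by linarith [min_le_right (1:ℝ) ((R''-R')/9)]
  have hpair : ∀ j : ℕ, 1 ≤ j → j ≤ 8 → |∫ z, w (x0+j*y*z)*φ z| ≤ C0*(1+A)*ℓ := fun j h1 h8 => by
    have h1' : (1:ℝ) ≤ j := by exact_mod_cast h1
    have h8' : (j:ℝ) ≤ 8 := by exact_mod_cast h8
    have hδ : y ≤ j*y := by nlinarith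
    obtain ⟨s1, s2, s3, s4⟩ := sc_data hφ hz hA x0 hyp hy1 hδ
    have := H _ _ s1 (fun x hx => s2 x (by nlinarith)) s3
    rw [s4 w] at this
    have e1 : ∫ x, |(j*y)⁻¹*φ ((j*y)⁻¹*(x-x0))| = 1 := by
      have := s4 (fun _ => 1)
      simp only [one_mul, hi] at this
      rw [← this]; congr 1; ext x; exact abs_of_nonneg (mul_nonneg (by positivity) (hp _))
    rw [e1] at this
    refine this.trans ?_
    have : ℓ*(A*(y⁻¹)^7) ≤ A := by
      have : ℓ*(A*(y⁻¹)^7) = A*y := by rw [← hy8]; field_simp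
      rw [this]; nlinarith
    calc _ ≤ C0*ℓ*(1+A) := by gcongr
      _ = _ := by ring
  have hS : ∀ z, (fwdDiff (y*z))^[8] w x0 = ∑ k ∈ Finset.range 9, ((-1:ℝ)^(8-k)*(Nat.choose 8 k)) * w (x0+k*y*z) := fun z => by
    rw [fwdDiff_iter_eq_sum_shift]
    refine Finset.sum_congr rfl fun k _ => ?_
    rw [zsmul_eq_mul, nsmul_eq_mul]; push_cast; rw [mul_assoc (k:ℝ)]
  have hwI : ∀ k : ℕ, Integrable (fun z => w (x0+k*y*z)*φ z) := fun k => by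
    have := hφ.int_mul (k := fun z => w (x0+k*y*z)) (hw.continuous.comp (by fun_prop))
    exact this.congr (.of_forall fun z => mul_comm _ _)
  have hT : |∫ z, (fwdDiff (y*z))^[8] w x0 * φ z| ≤ n*ℓ := by
    have : n*ℓ = ∫ z, n*ℓ*φ z := by rw [integral_const_mul, hi, mul_one]
    rw [this, ← norm_eq_abs]
    refine norm_integral_le_of_norm_le (hφ.int.const_mul _) (.of_forall fun z => ?_)
    rw [norm_mul, norm_of_nonneg (hp z)]
    rcases le_or_gt 1 |z| with h1 | h1
    · simp [hz z h1]
    · refine mul_le_mul_of_nonneg_right ?_ (hp z)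
      have hyz : |y*z| ≤ y := by rw [abs_mul, abs_of_pos hyp]; nlinarith
      refine (fd_bd 8 hw hn (by push_cast; linarith)).trans ?_
      rw [← hy8]; gcongr
  have hE : ∫ z, (fwdDiff (y*z))^[8] w x0 * φ z = ∑ k ∈ Finset.range 9, ((-1:ℝ)^(8-k)*(Nat.choose 8 k)) * ∫ z, w (x0+k*y*z)*φ z := by
    simp only [← integral_const_mul]
    rw [← integral_finsetSum _ fun k _ => (hwI k).const_mul _]
    refine integral_congr_ae (.of_forall fun z => ?_)
    simp only []; rw [hS, Finset.sum_mul]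
    exact Finset.sum_congr rfl fun k _ => mul_assoc _ _ _
  have h00 : ∫ z, w (x0+((0:ℕ):ℝ)*y*z)*φ z = w x0 := by simp [integral_const_mul, hi]
  rw [hE, Finset.sum_range_succ', h00] at hT
  have hB : |∑ k ∈ Finset.range 8, ((-1:ℝ)^(8-(k+1))*(Nat.choose 8 (k+1))) * ∫ z, w (x0+((k+1:ℕ):ℝ)*y*z)*φ z| ≤ 255*(C0*(1+A)*ℓ) := by
    refine (Finset.abs_sum_le_sum_abs _ _).trans ?_
    have : ∀ k ∈ Finset.range 8, |((-1:ℝ)^(8-(k+1))*(Nat.choose 8 (k+1))) * ∫ z, w (x0+((k+1:ℕ):ℝ)*y*z)*φ z| ≤ (Nat.choose 8 (k+1)) * (C0*(1+A)*ℓ) := fun k hk => by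
      rw [abs_mul, abs_mul, abs_pow, abs_neg, abs_one, one_pow, one_mul, Nat.abs_cast]
      exact mul_le_mul_of_nonneg_left (hpair (k+1) (by omega) (by have := Finset.mem_range.1 hk; omega)) (by positivity)
    refine (Finset.sum_le_sum this).trans (le_of_eq ?_)
    rw [← Finset.sum_mul, ← Nat.cast_sum]
    congr 1
  have e0 : (-1:ℝ)^(8-0)*(Nat.choose 8 0)*w x0 = w x0 := by norm_num
  rw [e0] at hT
  have := abs_le.1 hT
  have h3 := abs_le.1 hB
  rw [abs_le]
  constructor <;> nlinarith [mul_nonneg hq0 hℓ.le]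
end
section
def WP (α μ : ℝ) (B : ℝ → ℝ → ℝ) (R s : ℝ) : Prop := ∀ φ, Cc φ → (∃ R' < R, ∀ x, R' ≤ |x| → φ x = 0) →
  HasDerivAt (fun t => ∫ x, B t x * φ x) (qq α μ φ (B s)) s
variable {α μ : ℝ} {B : ℝ → ℝ → ℝ}
lemma Sol.pint (S : Sol α μ B) {t : ℝ} (ht : 0 ≤ t) {φ : ℝ → ℝ} (h : Cc φ) : Integrable (fun x => B t x * φ x) :=
  (h.int_mul (S.smooth t ht).continuous).congr (.of_forall fun _ => mul_comm _ _)
lemma gap_mv (S : Sol α μ B) {R a τ K : ℝ} (ha : 0 ≤ a) (hτ : a < τ) (hW : ∀ s ∈ Ioo a τ, WP α μ B R s) {φ : ℝ → ℝ} (h : Cc φ)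
    (hR : ∃ R' < R, ∀ x, R' ≤ |x| → φ x = 0) (hK : ∀ s ∈ Ioo a τ, |qq α μ φ (B s)| ≤ K) : |∫ x, (B τ x - B a x) * φ x| ≤ K*(τ-a) := by
  obtain ⟨c, hc, e⟩ := exists_hasDerivAt_eq_slope (fun t => ∫ x, B t x * φ x) (fun s => qq α μ φ (B s)) hτ
    ((S.pair_cont h.int).mono fun t ht => ha.trans ht.1) (fun s hs => hW s hs φ h hR)
  have hl : 0 < τ - a := by linarith
  have t := integral_sub (S.pint (ha.trans hτ.le) h) (S.pint ha h)
  have e2 : ∫ x, (B τ x - B a x) * φ x = qq α μ φ (B c) * (τ-a) := by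
    rw [e, div_mul_cancel₀ _ hl.ne', ← t]; congr 1; ext x; ring
  rw [e2, abs_mul, abs_of_pos hl]
  exact mul_le_mul_of_nonneg_right (hK c hc) hl.le
lemma gap_lip (S : Sol α μ B) {T n R R' : ℝ} (hT : 0 < T) (hn0 : 0 ≤ n) (hR0 : 0 < R') (hR : R' < R) : ∃ C, 0 ≤ C ∧ ∀ a b, 0 < a → a < b → b ≤ T →
    (∀ s ∈ Ioo a b, WP α μ B R s) → (∀ k ≤ 8, ∀ x, |x| < R → |iteratedDeriv k (B a) x| ≤ n) → (∀ k ≤ 8, ∀ x, |x| < R → |iteratedDeriv k (B b) x| ≤ n) →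
    ∀ x, |x| ≤ R' → |B b x - B a x| ≤ C*(b-a) := by
  obtain ⟨M, hM0, hM⟩ := S.bdd T hT
  obtain ⟨K, hK0, hK⟩ := qq_bd S.h0 S.h2 S.hμ M hM0
  set R2 := R' + (R-R')/3 with hR2
  set R3 := R' + 2*(R-R')/3 with hR3
  have l1 : R' < R2 := by rw [hR2]; linarith
  have l2 : R2 < R3 := by rw [hR2, hR3]; linarith
  have l3 : R3 < R := by rw [hR3]; linarith
  obtain ⟨C1, hC1, H1⟩ := gap_q S.h0 S.h2 S.hμ hM0 hn0 (hR0.trans l1) l2 l3.le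
  set K1 := K*(1+R3^2) with hK1
  have hK10 : 0 ≤ K1 := by positivity
  obtain ⟨C2, hC2, H2⟩ := ptw_gap (n := 2*n) (M := 2*M) (C0 := C1*(1+K1)) (by positivity) (by positivity) (by positivity) l1 (l2.trans l3).le
  refine ⟨C2, hC2, fun a b ha hab hb hW hna hnb x hx => ?_⟩
  have hb0 := ha.trans hab
  have sa := S.smooth a ha.le
  have sb := S.smooth b hb0.le
  refine H2 (fun x => B b x - B a x) (sb.sub sa) (fun y hy => ?_) (fun y => ?_) (b-a) (by linarith) (fun φ A hφ hz hA => ?_) x hx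
  · have := iteratedDeriv_fun_sub (cd_le sb 8).contDiffAt (cd_le sa 8).contDiffAt (n := 8) (x := y)
    rw [this]
    refine (abs_sub _ _).trans ?_
    linarith [hna 8 le_rfl y hy, hnb 8 le_rfl y hy]
  · refine (abs_sub _ _).trans ?_
    linarith [hM a ⟨ha.le, by linarith⟩ y, hM b ⟨hb0.le, hb⟩ y]
  · have hA0 : 0 ≤ A := (abs_nonneg _).trans (hA 0 (by norm_num) 0)
    have hI : 0 ≤ ∫ x, |φ x| := integral_nonneg fun _ => abs_nonneg _
    have hq : ∀ s ∈ Ioo a b, |qq α μ φ (B s)| ≤ C1*((∫ x, |φ x|) + K1*(b-a)*A) := fun s hs => by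
      have hs0 : 0 ≤ s := by linarith [hs.1]
      refine H1 (B a) (B s) sa (S.smooth s hs0) (hM a ⟨ha.le, by linarith⟩) (hM s ⟨hs0, by linarith [hs.2]⟩) (fun k hk => hna k (by omega)) (K1*(b-a))
        (fun ψ A' hψ hz' hA' => ?_) φ A hφ hz hA
      have hA0' : 0 ≤ A' := (abs_nonneg _).trans (hA' 0 (by norm_num) 0)
      refine (gap_mv S (R := R) ha.le hs.1 (fun u hu => hW u ⟨hu.1, hu.2.trans hs.2⟩) hψ ⟨R3, l3, hz'⟩ (K := K*(A'*(1+R3^2))) fun u hu => ?_).trans ?_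
      · have hu0 : 0 ≤ u := by linarith [hu.1]
        exact (hK ψ (B u) _ (CB.dec hψ hA' fun y hy => hz' y hy.le) (S.smooth u hu0).continuous.measurable (hM u ⟨hu0, by linarith [hu.2, hs.2]⟩)).2.2
      · have : s - a ≤ b - a := by linarith [hs.2]
        calc _ ≤ K*(A'*(1+R3^2))*(b-a) := by gcongr
          _ = _ := by rw [hK1]; ring
    refine (gap_mv S (R := R) ha.le hab hW hφ ⟨R2, l2.trans l3, hz⟩ hq).trans ?_
    have hl : 0 < b - a := by linarith
    have p : 0 ≤ C1*(b-a) := by positivity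
    have p2 : 0 ≤ (b-a)*A := by positivity
    nlinarith [mul_nonneg p (mul_nonneg hK10 hI), mul_nonneg p p2]
end
section
lemma lip_E1 {b : ℝ → ℝ} {E Z : Set ℝ} {s t C : ℝ} (hst : s < t) (hE : IsClosed (E ∩ Icc s t)) (hs : s ∈ E) (ht : t ∈ E) (hZ : volume Z = 0)
    (hb : ∀ τ ∈ Icc s t, DifferentiableAt ℝ b τ) (hd : ∀ τ ∈ E ∩ Icc s t, τ ∉ Z → |deriv b τ| ≤ C)
    (hg : ∀ a c, a ∈ E → c ∈ E → s ≤ a → a < c → c ≤ t → (∀ u ∈ Ioo a c, u ∉ E) → |b c - b a| ≤ C*(c-a)) : b t - b s ≤ C*(t-s) := by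
  by_contra hcon
  push Not at hcon
  have hl : 0 < t - s := by linarith
  obtain ⟨K, hK1, hK2⟩ : ∃ K, C < K ∧ K*(t-s) < b t - b s := by
    obtain ⟨K, h1, h2⟩ := exists_between ((lt_div_iff₀ hl).2 hcon)
    exact ⟨K, h1, (lt_div_iff₀ hl).1 h2⟩
  set g : ℝ → ℝ := fun τ => b τ - K*τ with hgdef
  have hgd : ∀ τ ∈ Icc s t, HasDerivAt g (deriv b τ - K) τ := fun τ hτ => by
    exact ((hb τ hτ).hasDerivAt.sub ((hasDerivAt_id τ).const_mul K)).congr_deriv (by simp)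
  have hgc : ContinuousOn g (Icc s t) := fun τ hτ => (hgd τ hτ).continuousAt.continuousWithinAt
  have hsub : Ioo (g s) (g t) ⊆ g '' (Z ∩ Icc s t) := by
    intro c hc
    set Sc := (E ∩ Icc s t) ∩ g ⁻¹' Set.Iic c with hSc
    have hcl : IsClosed Sc := (hgc.mono Set.inter_subset_right).preimage_isClosed_of_isClosed hE isClosed_Iic
    have hcp : IsCompact Sc := (isCompact_Icc (a := s) (b := t)).of_isClosed_subset hcl fun x hx => hx.1.2
    obtain ⟨σ, hσ⟩ := hcp.exists_isGreatest ⟨s, ⟨hs, le_rfl, hst.le⟩, hc.1.le⟩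
    obtain ⟨⟨⟨hσE, hσI⟩, hσc⟩, hmax⟩ := hσ
    have hσt : σ < t := lt_of_le_of_ne hσI.2 fun h => by
      rw [h] at hσc; exact absurd hσc (not_le.2 hc.2)
    have key : ∀ p : ℝ → Prop, (∀ᶠ τ in 𝓝[>] σ, p τ) → ∃ τ, σ < τ ∧ τ ∈ E ∩ Icc s t ∧ p τ := by
      intro p hp
      by_contra hno
      push Not at hno
      obtain ⟨u, hu, hup⟩ := (mem_nhdsGT_iff_exists_Ioo_subset).1 hp
      set F := E ∩ Icc s t ∩ Ici (min u t) with hF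
      have hFc : IsCompact F := (isCompact_Icc (a := s) (b := t)).of_isClosed_subset (hE.inter isClosed_Ici) fun x hx => hx.1.2
      obtain ⟨a, ha⟩ := hFc.exists_isLeast ⟨t, ⟨ht, hst.le, le_rfl⟩, Set.mem_Ici.2 (min_le_right u t)⟩
      have hσa : σ < a := (lt_min hu hσt).trans_le ha.1.2
      have hgap : ∀ v ∈ Ioo σ a, v ∉ E := fun v hv hvE => by
        have hvI : v ∈ E ∩ Icc s t := ⟨hvE, hσI.1.trans hv.1.le, hv.2.le.trans ha.1.1.2.2⟩
        rcases lt_or_ge v (min u t) with h | h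
        · exact hno v hv.1 hvI (hup ⟨hv.1, h.trans_le (min_le_left _ _)⟩)
        · exact absurd (ha.2 ⟨hvI, h⟩) (not_le.2 hv.2)
      have h1 := (abs_le.1 (hg σ a hσE ha.1.1.1 hσI.1 hσa ha.1.1.2.2 hgap)).2
      have h2 : g a ≤ c := by
        have : g a ≤ g σ := by simp only [hgdef]; nlinarith
        exact this.trans hσc
      exact absurd (hmax ⟨ha.1.1, h2⟩) (not_le.2 hσa)
    have key2 : ∀ p : ℝ → Prop, (∀ᶠ τ in 𝓝[>] σ, p τ) → ∃ τ, σ < τ ∧ c < g τ ∧ p τ := fun p hp => by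
      obtain ⟨τ, h1, h2, h3⟩ := key p hp
      refine ⟨τ, h1, ?_, h3⟩
      by_contra h
      exact absurd (hmax ⟨h2, not_lt.1 h⟩) (not_le.2 h1)
    refine ⟨σ, ⟨?_, hσI⟩, ?_⟩
    · by_contra hz
      have h1 := (abs_le.1 (hd σ ⟨hσE, hσI⟩ hz)).2
      have h2 := (hasDerivAt_iff_tendsto_slope.1 (hgd σ hσI)).eventually (gt_mem_nhds (show deriv b σ - K < 0 by linarith))
      obtain ⟨τ, k1, k2, k3⟩ := key2 _ (h2.filter_mono (nhdsWithin_mono _ fun x hx => (ne_of_gt hx)))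
      rw [slope_def_field, div_neg_iff] at k3
      have : g σ ≤ c := hσc
      rcases k3 with k3 | k3 <;> linarith [k3.1, k3.2]
    · refine le_antisymm hσc (not_lt.1 fun h => ?_)
      have := (hgd σ hσI).continuousAt.eventually (gt_mem_nhds h)
      obtain ⟨τ, k1, k2, k3⟩ := key2 _ (this.filter_mono nhdsWithin_le_nhds)
      linarith
  have h0 := addHaar_image_eq_zero_of_differentiableOn_of_addHaar_eq_zero volume (s := Z ∩ Icc s t)
    (fun τ hτ => (hgd τ hτ.2).differentiableAt.differentiableWithinAt) (measure_mono_null Set.inter_subset_left hZ)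
  have h1 := measure_mono_null hsub h0
  rw [Real.volume_Ioo, ENNReal.ofReal_eq_zero] at h1
  simp only [hgdef] at h1
  linarith
lemma lip_E {b : ℝ → ℝ} {E Z : Set ℝ} {s t C : ℝ} (hst : s < t) (hE : IsClosed (E ∩ Icc s t)) (hs : s ∈ E) (ht : t ∈ E) (hZ : volume Z = 0)
    (hb : ∀ τ ∈ Icc s t, DifferentiableAt ℝ b τ) (hd : ∀ τ ∈ E ∩ Icc s t, τ ∉ Z → |deriv b τ| ≤ C)
    (hg : ∀ a c, a ∈ E → c ∈ E → s ≤ a → a < c → c ≤ t → (∀ u ∈ Ioo a c, u ∉ E) → |b c - b a| ≤ C*(c-a)) : |b t - b s| ≤ C*(t-s) := by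
  refine abs_le.2 ⟨?_, lip_E1 hst hE hs ht hZ hb hd hg⟩
  have := lip_E1 (b := fun τ => -b τ) hst hE hs ht hZ (fun τ hτ => (hb τ hτ).neg) (fun τ hτ hz => by rw [deriv.fun_neg, abs_neg]; exact hd τ hτ hz)
    (fun a c h1 h2 h3 h4 h5 h6 => by
      have := hg a c h1 h2 h3 h4 h5 h6
      rwa [← abs_neg, neg_sub_neg, neg_sub])
  linarith
end
section
variable {α μ : ℝ} {B : ℝ → ℝ → ℝ}
lemma Sol.meas2 (S : Sol α μ B) : Measurable (fun p : ℝ × ℝ => B (max p.1 0) p.2) := by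
  have := measurable_uncurry_of_continuous_of_measurable (u := fun t x => B (max t 0) x)
    (fun x => (S.cont x).comp_continuous (by fun_prop) (fun t => le_max_right t 0)) (fun t => (S.smooth _ (le_max_right t 0)).continuous.measurable)
  exact this
lemma Sol.Dt_meas (S : Sol α μ B) : Measurable (fun p : ℝ × ℝ => if 0 < p.1 then deriv (fun τ => B τ p.2) p.1 else 0) := by
  have hm := S.meas2
  refine measurable_of_tendsto_metrizable (f := fun (k : ℕ) (p : ℝ × ℝ) => if 0 < p.1 then ((k:ℝ)+1)*(B (max (p.1+1/((k:ℝ)+1)) 0) p.2 - B (max p.1 0) p.2) else 0) (fun k => ?_) ?_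
  · refine Measurable.ite (measurableSet_lt measurable_const measurable_fst) (measurable_const.mul (Measurable.sub ?_ hm)) measurable_const
    exact hm.comp ((measurable_fst.add_const _).prodMk measurable_snd)
  · rw [tendsto_pi_nhds]
    rintro ⟨t, x⟩
    by_cases ht : 0 < t
    · simp only [ht, if_true]
      have h := hasDerivAt_iff_tendsto_slope_zero.1 (S.diff t ht x).hasDerivAt
      have h2 : Tendsto (fun k : ℕ => 1/((k:ℝ)+1)) atTop (𝓝[≠] 0) :=
        tendsto_nhdsWithin_iff.2 ⟨tendsto_one_div_add_atTop_nhds_zero_nat, .of_forall fun k => (by positivity : 1/((k:ℝ)+1) ≠ 0)⟩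
      refine (h.comp h2).congr fun k => ?_
      have : 0 < 1/((k:ℝ)+1) := by positivity
      simp only [Function.comp, smul_eq_mul]
      rw [max_eq_left (by linarith), max_eq_left ht.le, one_div, inv_inv]
    · simp only [ht, if_false]; exact tendsto_const_nhds
lemma lip_ae (S : Sol α μ B) {U : Set ℝ} {R R' n t1 ρ : ℝ} (hU : IsOpen U) (hW : ∀ s ∈ U, WP α μ B R s) (hρ : ρ < t1) (hn0 : 0 ≤ n)
    (hn : ∀ t, t ∉ U → |t-t1| < ρ → ∀ k ≤ 8, ∀ x, |x| < R → |iteratedDeriv k (B t) x| ≤ n) (hρ0 : 0 < ρ) (hR0 : 0 < R') (hR : R' < R) :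
    ∃ C, 0 ≤ C ∧ ∀ᵐ x, |x| ≤ R' → ∀ s t, s ∉ U → t ∉ U → |s-t1| < ρ → |t-t1| < ρ → |B t x - B s x| ≤ C*|t-s| := by
  obtain ⟨M, hM0, hM⟩ := S.bdd (t1+ρ) (by linarith)
  obtain ⟨C1, hC1, H1⟩ := gap_lip S (T := t1+ρ) (n := n) (by linarith) hn0 hR0 hR
  have hI : ∀ t, |t-t1| < ρ → 0 < t ∧ t ≤ t1+ρ := fun t ht => by have := abs_lt.1 ht; constructor <;> linarith [this.1, this.2]
  set η := (R-R')/2 with hη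
  have hη0 : 0 < η := by rw [hη]; linarith
  set C2 := n*((n+4*M/η^2+4*M)*wkI 1) + μ*((n+4*M/η^2+4*M)*wkI α) with hC2
  have hd : ∀ t, t ∉ U → |t-t1| < ρ → ∀ᵐ x, |x| ≤ R' → |deriv (fun τ => B τ x) t| ≤ C2 := fun t htU ht => by
    filter_upwards [S.eq t (hI t ht).1] with x hx hxR
    rw [hx.deriv]
    refine GG_near S.h0 S.h2 S.hμ (S.smooth t (hI t ht).1.le) (hM t ⟨(hI t ht).1.le, (hI t ht).2⟩) hη0 fun k hk y hy => hn t htU ht k (by omega) y ?_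
    have := abs_add_le (y-x) x
    rw [sub_add_cancel] at this; linarith
  have hae : ∀ᵐ x : ℝ, ∀ᵐ t : ℝ, t ∉ U → |t-t1| < ρ → |x| ≤ R' → |if 0 < t then deriv (fun τ => B τ x) t else 0| ≤ C2 := by
    refine (Measure.ae_ae_comm (p := fun t x : ℝ => t ∉ U → |t-t1| < ρ → |x| ≤ R' → |if 0 < t then deriv (fun τ => B τ x) t else 0| ≤ C2) ?_).1 (.of_forall fun t => ?_)
    · have m1 : MeasurableSet {p : ℝ × ℝ | p.1 ∉ U} := measurable_fst hU.measurableSet.compl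
      have m2 : MeasurableSet {p : ℝ × ℝ | |p.1-t1| < ρ} := measurableSet_lt (by fun_prop) measurable_const
      have m3 : MeasurableSet {p : ℝ × ℝ | |p.2| ≤ R'} := measurableSet_le (by fun_prop) measurable_const
      have m4 : MeasurableSet {p : ℝ × ℝ | |if 0 < p.1 then deriv (fun τ => B τ p.2) p.1 else 0| ≤ C2} := measurableSet_le S.Dt_meas.abs measurable_const
      exact m1.imp (m2.imp (m3.imp m4))
    · by_cases h : t ∉ U ∧ |t-t1| < ρ
      · filter_upwards [hd t h.1 h.2] with x hx _ _ hxR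
        simp only [(hI t h.2).1, if_true]; exact hx hxR
      · exact .of_forall fun x h1 h2 => absurd ⟨h1, h2⟩ h
  refine ⟨max C1 C2, le_max_of_le_left hC1, ?_⟩
  filter_upwards [hae] with x hx hxR
  have main : ∀ s t, s ∉ U → t ∉ U → |s-t1| < ρ → |t-t1| < ρ → s < t → |B t x - B s x| ≤ max C1 C2*(t-s) := by
    intro s t hs ht hs1 ht1 hst
    have hin : ∀ τ, s ≤ τ → τ ≤ t → |τ-t1| < ρ := fun τ h1 h2 => by
      have a := abs_lt.1 hs1; have b := abs_lt.1 ht1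
      exact abs_lt.2 ⟨by linarith [a.1], by linarith [b.2]⟩
    refine lip_E (b := fun τ => B τ x) (E := Uᶜ) (Z := {t | ¬ (t ∉ U → |t-t1| < ρ → |x| ≤ R' → |if 0 < t then deriv (fun τ => B τ x) t else 0| ≤ C2)}) hst
      (hU.isClosed_compl.inter isClosed_Icc) hs ht hx (fun τ hτ => S.diff τ (hI τ (hin τ hτ.1 hτ.2)).1 x) (fun τ hτ hz => ?_) fun a c ha hc h1 h2 h3 h4 => ?_
    · have hi := hin τ hτ.2.1 hτ.2.2
      have := (not_not.1 hz) hτ.1 hi hxR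
      simp only [(hI τ hi).1, if_true] at this
      exact this.trans (le_max_right _ _)
    · have ia := hin a h1 (by linarith)
      have ic := hin c (by linarith) h3
      refine (H1 a c (hI a ia).1 h2 (hI c ic).2 (fun u hu => hW u (not_not.1 (h4 u hu))) (hn a ha ia) (hn c hc ic) x hxR).trans ?_
      exact mul_le_mul_of_nonneg_right (le_max_left _ _) (by linarith)
  intro s t hs ht hs1 ht1
  rcases lt_trichotomy s t with h | h | h
  · rw [abs_of_pos (by linarith : 0 < t-s)]; exact main s t hs ht hs1 ht1 h
  · simp [h]
  · rw [abs_sub_comm, abs_sub_comm t s, abs_of_pos (by linarith : 0 < s-t)]; exact main t s ht hs ht1 hs1 h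
end
section
variable {α μ : ℝ} {B : ℝ → ℝ → ℝ}
lemma mv_q {W q : ℝ → ℝ} {a b q0 c : ℝ} (hab : a < b) (hc : ContinuousOn W (Icc a b)) (hd : ∀ s ∈ Ioo a b, HasDerivAt W (q s) s)
    (hq : ∀ s ∈ Ioo a b, |q s - q0| ≤ c) : |W b - W a - (b-a)*q0| ≤ c*(b-a) := by
  obtain ⟨s, hs, e⟩ := exists_hasDerivAt_eq_slope W q hab hc hd
  have hl : 0 < b - a := by linarith
  have : W b - W a - (b-a)*q0 = (q s - q0)*(b-a) := by rw [e]; field_simp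
  rw [this, abs_mul, abs_of_pos hl]
  exact mul_le_mul_of_nonneg_right (hq s hs) hl.le
lemma deriv_E {W q : ℝ → ℝ} {E : Set ℝ} (hE : IsClosed E) {t0 r : ℝ} (ht0 : t0 ∈ E) (hr : 0 < r) (hc : ∀ s, |s-t0| < r → ContinuousAt W s)
    (hU : ∀ s, |s-t0| < r → s ∉ E → HasDerivAt W (q s) s) (hq : ContinuousAt q t0) (hd : HasDerivWithinAt W (q t0) E t0) : HasDerivAt W (q t0) t0 := by
  rw [hasDerivAt_iff_isLittleO, Asymptotics.isLittleO_iff]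
  intro c hcp
  have h1 := (Asymptotics.isLittleO_iff.1 (hasDerivWithinAt_iff_isLittleO.1 hd)) hcp
  obtain ⟨δ1, hδ1, H1⟩ := Metric.mem_nhdsWithin_iff.1 h1
  obtain ⟨δ2, hδ2, H2⟩ := Metric.continuousAt_iff.1 hq c hcp
  rw [Metric.eventually_nhds_iff]
  refine ⟨min r (min δ1 δ2), lt_min hr (lt_min hδ1 hδ2), fun s hs => ?_⟩
  simp only [dist_eq, lt_min_iff] at hs H2
  obtain ⟨hsr, hs1, hs2⟩ := hs
  have hcp' : IsCompact (E ∩ uIcc t0 s) := isCompact_uIcc.inter_left hE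
  obtain ⟨a, ⟨haE, haI⟩, hmin⟩ := hcp'.exists_isMinOn ⟨t0, ht0, Set.left_mem_uIcc⟩ (f := fun a => |a-s|) (by fun_prop)
  have hin : ∀ u ∈ uIcc t0 s, |u-t0| ≤ |s-t0| := fun u hu => Set.abs_sub_left_of_mem_uIcc hu
  have k1 : |W a - W t0 - (a-t0)*q t0| ≤ c*|a-t0| := by
    have := H1 (a := a) ⟨by rw [Metric.mem_ball, dist_eq]; exact (hin a haI).trans_lt hs1, haE⟩
    simpa using this
  have hno : ∀ u ∈ uIcc t0 s, |u-s| < |a-s| → u ∉ E := fun u hu h hE' => absurd (hmin ⟨hE', hu⟩) (not_le.2 h)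
  have k2 : |W s - W a - (s-a)*q t0| ≤ c*|s-a| := by
    have hsub : ∀ u ∈ uIcc a s, u ∈ uIcc t0 s := fun u hu => Set.uIcc_subset_uIcc haI Set.right_mem_uIcc hu
    rcases lt_trichotomy a s with h | h | h
    · rw [abs_of_pos (by linarith : 0 < s-a)]
      rw [Set.uIcc_of_le h.le] at hsub
      refine mv_q (q := q) h (fun u hu => (hc u ((hin u (hsub u hu)).trans_lt hsr)).continuousWithinAt) (fun u hu => ?_) fun u hu => ?_
      · have hu' := hsub u ⟨hu.1.le, hu.2.le⟩
        refine hU u ((hin u hu').trans_lt hsr) (hno u hu' ?_)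
        rw [abs_of_neg (by linarith [hu.2]), abs_of_neg (by linarith)]; linarith [hu.1]
      · exact (H2 ((hin u (hsub u ⟨hu.1.le, hu.2.le⟩)).trans_lt hs2)).le
    · simp [h]
    · rw [Set.uIcc_of_ge h.le] at hsub
      have := mv_q (q := q) (q0 := q t0) (c := c) h (fun u hu => (hc u ((hin u (hsub u hu)).trans_lt hsr)).continuousWithinAt) (fun u hu => ?_) fun u hu => ?_
      · rw [abs_sub_comm s a, abs_of_pos (by linarith : 0 < a-s), ← abs_neg]
        convert this using 2; ring
      · have hu' := hsub u ⟨hu.1.le, hu.2.le⟩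
        refine hU u ((hin u hu').trans_lt hsr) (hno u hu' ?_)
        rw [abs_of_pos (by linarith [hu.1]), abs_of_pos (by linarith)]; linarith [hu.2]
      · exact (H2 ((hin u (hsub u ⟨hu.1.le, hu.2.le⟩)).trans_lt hs2)).le
  have k3 : |a-t0| + |s-a| = |s-t0| := by
    rcases le_total t0 s with h | h
    · rw [Set.uIcc_of_le h] at haI
      rw [abs_of_nonneg (by linarith [haI.1]), abs_of_nonneg (by linarith [haI.2]), abs_of_nonneg (by linarith)]; ring
    · rw [Set.uIcc_of_ge h] at haI
      rw [abs_of_nonpos (by linarith [haI.2]), abs_of_nonpos (by linarith [haI.1]), abs_of_nonpos (by linarith)]; ring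
  rw [norm_eq_abs, norm_eq_abs, ← k3, mul_add, smul_eq_mul]
  have e : W s - W t0 - (s-t0)*q t0 = (W a - W t0 - (a-t0)*q t0) + (W s - W a - (s-a)*q t0) := by ring
  rw [e]
  exact (abs_add_le _ _).trans (add_le_add k1 k2)
lemma weak_R (S : Sol α μ B) {R : ℝ} (hR : 0 < R) {t : ℝ} (ht : 0 < t) : WP α μ B R t := by
  set U := interior {s | 0 < s ∧ WP α μ B R s} with hUdef
  have hUo : IsOpen U := isOpen_interior
  have hUW : ∀ s ∈ U, WP α μ B R s := fun s hs => (interior_subset hs).2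
  by_cases hne : ∃ t, 0 < t ∧ t ∉ U
  swap
  · push Not at hne; exact hUW t (hne t ht)
  exfalso
  obtain ⟨n, t1, ρ, hn0, hρ0, hρ, ht1, hn⟩ := portion S R hUo hne
  refine ht1 (mem_interior.2 ⟨Metric.ball t1 ρ, fun t0 h => ?_, Metric.isOpen_ball, Metric.mem_ball_self hρ0⟩)
  rw [Metric.mem_ball, dist_eq] at h
  have ht0 : 0 < t0 := by linarith [(abs_lt.1 h).1]
  refine ⟨ht0, ?_⟩
  by_cases hU : t0 ∈ U
  · exact hUW t0 hU
  rintro φ hφ ⟨R1, hR1, hz⟩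
  obtain ⟨AA, hAA⟩ := hφ.dec
  obtain ⟨C, hC, hae⟩ := lip_ae S hUo hUW hρ hn0 hn hρ0 (R' := max R1 (R/2)) (lt_max_of_lt_right (by linarith)) (max_lt hR1 (by linarith))
  have cn : ∀ s, 0 < s → Ici (0:ℝ) ∈ 𝓝 s := fun s hs => Ici_mem_nhds hs
  refine deriv_E (q := fun s => qq α μ φ (B s)) hUo.isClosed_compl (r := t0) (E := Uᶜ) hU ht0 (fun s hs => ?_) (fun s hs hsU => ?_) ?_ ?_
  · have hs0 : 0 < s := by linarith [(abs_lt.1 hs).1]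
    exact (S.pair_cont hφ.int).continuousAt (cn s hs0)
  · exact hUW s (not_not.1 hsU) φ hφ ⟨R1, hR1, hz⟩
  · exact (S.qq_cont hAA).continuousAt (cn t0 ht0)
  · obtain ⟨M, _, hM⟩ := S.bdd (t0+1) (by linarith)
    rw [hasDerivWithinAt_iff_tendsto_slope, qq_eq μ S.h0 S.h2 (S.smooth t0 ht0.le) (hM t0 ⟨ht0.le, by linarith⟩) hφ]
    have hev : ∀ᶠ s in 𝓝[Uᶜ \ {t0}] t0, s ∉ U ∧ s ≠ t0 ∧ |s-t1| < ρ ∧ 0 < s := by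
      have o : IsOpen {s : ℝ | |s-t1| < ρ} := isOpen_lt (by fun_prop) continuous_const
      filter_upwards [self_mem_nhdsWithin, nhdsWithin_le_nhds (o.mem_nhds h), nhdsWithin_le_nhds (Ioi_mem_nhds ht0)] with s h1 h2 h3
      exact ⟨h1.1, h1.2, h2, h3⟩
    have hT : Tendsto (fun s => ∫ x, φ x * slope (fun τ => B τ x) t0 s) (𝓝[Uᶜ \ {t0}] t0) (𝓝 (∫ x, φ x * GG α μ (B t0) x)) := by
      refine tendsto_integral_filter_of_dominated_convergence (fun x => |φ x| * C) ?_ ?_ (hφ.int.abs.mul_const C) ?_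
      · filter_upwards [hev] with s hs
        simp only [slope_def_field]
        exact (hφ.1.continuous.mul (((S.smooth s hs.2.2.2.le).continuous.sub (S.smooth t0 ht0.le).continuous).div_const _)).aestronglyMeasurable
      · filter_upwards [hev] with s hs
        filter_upwards [hae] with x hx
        rw [norm_mul]
        rcases le_or_gt R1 |x| with h1 | h1
        · simp [hz x h1]
        · refine mul_le_mul_of_nonneg_left ?_ (abs_nonneg _)
          have := hx (h1.le.trans (le_max_left _ _)) t0 s hU hs.1 h hs.2.2.1
          rw [slope_def_field, norm_div, norm_eq_abs, norm_eq_abs, div_le_iff₀ (abs_pos.2 (sub_ne_zero.2 hs.2.1))]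
          exact this
      · filter_upwards [S.eq t0 ht0] with x hx
        exact ((hasDerivAt_iff_tendsto_slope.1 hx).mono_left (nhdsWithin_mono _ fun y hy => hy.2)).const_mul _
    refine hT.congr' ?_
    filter_upwards [hev] with s hs
    have tt := integral_sub (S.pint hs.2.2.2.le hφ) (S.pint ht0.le hφ)
    rw [slope_def_field, ← tt, ← integral_div]
    congr 1; ext x; rw [slope_def_field]; ring
/-- the weak equation -/
lemma Sol.weak (S : Sol α μ B) {t : ℝ} (ht : 0 < t) {φ : ℝ → ℝ} (h : Cc φ) : HasDerivAt (fun t => ∫ x, B t x * φ x) (qq α μ φ (B t)) t := by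
  obtain ⟨R, A, hR, hA, _, hz⟩ := cs_data h.1.continuous h.2
  exact weak_R S (R := R+2) (by linarith) ht φ h ⟨R+1, by linarith, fun x hx => hz x (by linarith)⟩
end
section
def Om (α C e : ℝ) : ℝ := ∫ r in Ioi 0, min (C*r^2) e / r^(1+α)
lemma Om_b {C e r : ℝ} (hC : 0 ≤ C) (h0 : 0 ≤ e) (h1 : e ≤ 1) (α : ℝ) (hr : 0 < r) :
    ‖min (C*r^2) e / r^(1+α)‖ ≤ (C+1) * wk α r := by
  have : 0 ≤ min (C*r^2) e := le_min (by positivity) h0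
  rw [norm_of_nonneg (by positivity), wk, ← mul_div_assoc]
  gcongr
  rcases le_total (r^2) 1 with h | h
  · rw [min_eq_left h]; exact (min_le_left _ _).trans (by nlinarith)
  · rw [min_eq_right h]; exact (min_le_right _ _).trans (by linarith)
lemma Om_tendsto {α C : ℝ} (h0 : 0 < α) (h2 : α < 2) (hC : 0 ≤ C) {e : ℕ → ℝ} (he : ∀ n, 0 ≤ e n) (hl : Tendsto e atTop (𝓝 0)) :
    Tendsto (fun n => Om α C (e n)) atTop (𝓝 0) := by
  have : Tendsto (fun n => Om α C (e n)) atTop (𝓝 (∫ r in Ioi (0:ℝ), (0:ℝ))) := by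
    refine tendsto_integral_filter_of_dominated_convergence (fun r => (C+1) * wk α r) ?_ ?_ ((wk_int h0 h2).const_mul _) ?_
    · exact .of_forall fun n => Measurable.aestronglyMeasurable (by fun_prop)
    · filter_upwards [hl.eventually (gt_mem_nhds one_pos)] with n hn
      exact (ae_restrict_iff' measurableSet_Ioi).2 (.of_forall fun r hr => Om_b hC (he n) hn.le α hr)
    · refine (ae_restrict_iff' measurableSet_Ioi).2 (.of_forall fun r (hr : 0 < r) => ?_)
      have := ((tendsto_const_nhds (x := C*r^2)).min hl).div_const (r^(1+α))
      rwa [min_eq_right (by positivity), zero_div] at this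
  simpa using this
lemma Lam_low {f : ℝ → ℝ} {α C M m e x : ℝ} (h0 : 0 < α) (h2 : α < 2) (hC : 0 ≤ C) (hf : Differentiable ℝ f)
    (hL : ∀ x y, |deriv f x - deriv f y| ≤ C*|x-y|) (hM : ∀ x, |f x| ≤ M) (hm : ∀ y, f y ≤ m) (he : 2*(m - f x) ≤ e) (he1 : e ≤ 1) :
    -Lam α f x ≤ Om α C e := by
  have hd : ∀ r, 0 < r → |d2 f x r| ≤ C*r^2 := fun r hr => d2_of_deriv hf (η := r) (fun u _ v _ => hL u v) r hr.le le_rfl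
  have hb : ∀ r, 0 < r → |d2 f x r| ≤ (C+4*M)*min (r^2) 1 := fun r hr =>
    d2_min hM hC (fun r hr _ => hd r hr) hr
  have he0 : 0 ≤ e := by linarith [hm x]
  have hp : 1 / π ≤ 1 := by rw [div_le_one pi_pos]; linarith [Real.pi_gt_three]
  have hO : 0 ≤ Om α C e := setIntegral_nonneg measurableSet_Ioi fun r (hr : 0 < r) => by
    have : 0 ≤ min (C*r^2) e := le_min (by positivity) he0
    positivity
  have h1 : -∫ r in Ioi 0, d2 f x r / r^(1+α) ≤ Om α C e := by
    rw [← integral_neg]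
    refine setIntegral_mono_on (Lam_int h0 h2 hf.continuous.measurable hb).neg ?_ measurableSet_Ioi fun r (hr : 0 < r) => ?_
    · refine Integrable.mono' ((wk_int h0 h2).const_mul (C+1)) (Measurable.aestronglyMeasurable (by fun_prop)) ?_
      exact (ae_restrict_iff' measurableSet_Ioi).2 (.of_forall fun r hr => Om_b hC he0 he1 α hr)
    · rw [← neg_div]
      gcongr
      refine le_min ?_ ?_
      · exact (neg_le_abs _).trans (hd r hr)
      · unfold d2; linarith [hm (x+r), hm (x-r)]
  have e1 : -Lam α f x = 1/π * -∫ r in Ioi 0, d2 f x r / r^(1+α) := by unfold Lam; ring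
  rw [e1]
  calc _ ≤ 1/π * Om α C e := mul_le_mul_of_nonneg_left h1 (by positivity)
    _ ≤ 1 * Om α C e := by gcongr
    _ = _ := one_mul _
lemma deriv_low {f : ℝ → ℝ} {C m x : ℝ} (hC : 0 < C) (hf : Differentiable ℝ f)
    (hL : ∀ x y, |deriv f x - deriv f y| ≤ C*|x-y|) (hm : ∀ y, f y ≤ m) : |deriv f x| ≤ √(4*C*(m - f x)) := by
  refine Real.le_sqrt_of_sq_le ?_
  rw [sq_abs]
  set a := deriv f x with ha
  set s := a/(2*C) with hs
  have hg : ∀ y, HasDerivAt (fun y => f y - a*y) (deriv f y - a) y := fun y => by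
    exact ((hf y).hasDerivAt.sub ((hasDerivAt_id y).const_mul a)).congr_deriv (by simp)
  have := (convex_closedBall x |s|).norm_image_sub_le_of_norm_hasDerivWithin_le (f := fun y => f y - a*y) (f' := fun y => deriv f y - a) (C := C*|s|)
    (fun y _ => (hg y).hasDerivWithinAt) (fun y hy => (hL y x).trans (by
      have : |y-x| ≤ |s| := by simpa [dist_eq] using hy
      gcongr)) (Metric.mem_closedBall_self (abs_nonneg s)) (show x+s ∈ _ by simp [dist_eq])
  have h2 := (abs_le.1 this).1
  have e1 : C*|s| * ‖x+s-x‖ = a^2/(4*C) := by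
    rw [add_sub_cancel_left, norm_eq_abs, mul_assoc, abs_mul_abs_self, hs]; field_simp; ring
  have e2 : a*s = 2*(a^2/(4*C)) := by rw [hs]; field_simp; ring
  rw [e1] at h2
  have h3 : a^2/(4*C) ≤ m - f x := by nlinarith [hm (x+s)]
  rw [div_le_iff₀ (by positivity)] at h3
  linarith
lemma maxP {v g : ℝ → ℝ → ℝ} {α μ G C M C1 T : ℝ} (h0 : 0 < α) (h2 : α < 2) (hμ : 0 ≤ μ) (hC : 0 < C) (hG0 : 0 ≤ G)
    (hG : ∀ t ∈ Ioc 0 T, ∀ x, |g t x| ≤ G)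
    (hd : ∀ t ∈ Ioc 0 T, ∀ x, HasDerivAt (fun τ => v τ x) (deriv (v t) x * g t x - μ * Lam α (v t) x) t)
    (hc : ∀ x, ContinuousOn (fun τ => v τ x) (Icc 0 T))
    (hf : ∀ t ∈ Icc 0 T, Differentiable ℝ (v t)) (hC1 : ∀ t ∈ Icc 0 T, ∀ x, |deriv (v t) x| ≤ C1)
    (hL : ∀ t ∈ Icc 0 T, ∀ x y, |deriv (v t) x - deriv (v t) y| ≤ C*|x-y|) (hM : ∀ t ∈ Icc 0 T, ∀ x, |v t x| ≤ M)
    {t1 t2 m : ℝ} (ht1 : 0 ≤ t1) (ht : t1 ≤ t2) (ht2 : t2 ≤ T) (hm : ∀ y, v t1 y ≤ m) (x : ℝ) : v t2 x ≤ m := by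
  have hM0 : 0 ≤ M := (abs_nonneg _).trans (hM t1 ⟨ht1, ht.trans ht2⟩ 0)
  have hC0 : 0 ≤ C1 := (abs_nonneg _).trans (hC1 t1 ⟨ht1, ht.trans ht2⟩ 0)
  have hw := wkI_nonneg α
  set N := C1*G + μ*((C+4*M)*wkI α) with hN
  have hN0 : 0 ≤ N := by positivity
  have io : ∀ {t}, t ∈ Ioc 0 T → t ∈ Icc 0 T := fun h => ⟨h.1.le, h.2⟩
  have hvt : ∀ t ∈ Ioc 0 T, ∀ x, |deriv (v t) x * g t x - μ * Lam α (v t) x| ≤ N := fun t ht x => by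
    have a := Lam_bd h0 h2 (x := x) fun r hr => d2_min (hM t (io ht)) hC.le (fun r hr _ => d2_of_deriv (hf t (io ht)) (η := r) (fun u _ v _ => hL t (io ht) u v) r hr.le le_rfl) hr
    refine (abs_sub _ _).trans ?_
    rw [abs_mul, abs_mul, abs_of_nonneg hμ]
    exact add_le_add (mul_le_mul (hC1 t (io ht) x) (hG t ht x) (abs_nonneg _) hC0) (by gcongr)
  have mvt : ∀ a b x, 0 ≤ a → a < b → b ≤ T → ∃ τ ∈ Ioo a b, v b x - v a x = (deriv (v τ) x * g τ x - μ * Lam α (v τ) x) * (b-a) := fun a b x ha hab hb => by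
    obtain ⟨τ, hτ, e⟩ := exists_hasDerivAt_eq_slope (fun τ => v τ x) (fun τ => deriv (v τ) x * g τ x - μ * Lam α (v τ) x) hab
      ((hc x).mono (Set.Icc_subset_Icc ha hb)) (fun τ hτ => hd τ ⟨ha.trans_lt hτ.1, hτ.2.le.trans hb⟩ x)
    refine ⟨τ, hτ, ?_⟩
    rw [e, div_mul_cancel₀ _ (by linarith)]
  have lip : ∀ a b x, 0 ≤ a → a < b → b ≤ T → |v b x - v a x| ≤ N*(b-a) := fun a b x ha hab hb => by
    obtain ⟨τ, hτ, e⟩ := mvt a b x ha hab hb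
    rw [e, abs_mul, abs_of_pos (sub_pos.2 hab)]
    exact mul_le_mul_of_nonneg_right (hvt τ ⟨ha.trans_lt hτ.1, hτ.2.le.trans hb⟩ x) (by linarith)
  have step : ∀ h m t, 0 < h → 4*N*h ≤ 1 → 0 ≤ t → t+h ≤ T → (∀ y, v t y ≤ m) → ∀ x, v (t+h) x ≤ m + h*(√(8*C*N*h)*G + μ*Om α C (4*N*h)) := by
    intro h m t hh hh1 ht0 htT hm x
    have hO : 0 ≤ Om α C (4*N*h) := setIntegral_nonneg measurableSet_Ioi fun r (hr : 0 < r) => by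
      have : 0 ≤ min (C*r^2) (4*N*h) := le_min (by positivity) (by positivity)
      positivity
    by_contra! hcon
    obtain ⟨τ, hτ, e⟩ := mvt t (t+h) x ht0 (by linarith) htT
    have hτT : τ ∈ Ioc 0 T := ⟨ht0.trans_lt hτ.1, hτ.2.le.trans htT⟩
    have q : 0 ≤ h*(√(8*C*N*h)*G + μ*Om α C (4*N*h)) := by positivity
    have u1 : ∀ y, v τ y ≤ m + N*h := fun y => by
      have a := (abs_le.1 (lip t τ y ht0 hτ.1 hτT.2)).2
      have b : N*(τ-t) ≤ N*h := mul_le_mul_of_nonneg_left (by linarith [hτ.2]) hN0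
      linarith [hm y]
    have u2 : m - N*h ≤ v τ x := by
      have a := (abs_le.1 (lip τ (t+h) x hτT.1.le hτ.2 htT)).2
      have b : N*(t+h-τ) ≤ N*h := mul_le_mul_of_nonneg_left (by linarith [hτ.1]) hN0
      linarith
    have w1 := Lam_low h0 h2 hC.le (hf τ (io hτT)) (hL τ (io hτT)) (hM τ (io hτT)) u1 (x := x) (e := 4*N*h) (by linarith) hh1
    have w2 : |deriv (v τ) x| ≤ √(8*C*N*h) := (deriv_low hC (hf τ (io hτT)) (hL τ (io hτT)) u1 (x := x)).trans (Real.sqrt_le_sqrt (by nlinarith))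
    have w3 : deriv (v τ) x * g τ x ≤ √(8*C*N*h)*G := by
      refine (le_abs_self _).trans ?_
      rw [abs_mul]
      exact mul_le_mul w2 (hG τ hτT x) (abs_nonneg _) (by positivity)
    have w4 := mul_le_mul_of_nonneg_left w1 hμ
    have w5 : (deriv (v τ) x * g τ x - μ * Lam α (v τ) x) * h ≤ (√(8*C*N*h)*G + μ*Om α C (4*N*h))*h :=
      mul_le_mul_of_nonneg_right (by linarith) hh.le
    rw [add_sub_cancel_left] at e
    linarith [hm x]
  rcases ht.eq_or_lt with rfl | hlt
  · exact hm x
  set L := t2 - t1 with hLd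
  have hLp : 0 < L := sub_pos.2 hlt
  have hh0 : Tendsto (fun k : ℕ => L/((k:ℝ)+1)) atTop (𝓝 0) := by
    simpa [mul_comm, div_eq_mul_inv] using (tendsto_one_div_add_atTop_nhds_zero_nat (𝕜 := ℝ)).const_mul L
  have key : ∀ᶠ k : ℕ in atTop, v t2 x ≤ m + L*(√(8*C*N*(L/((k:ℝ)+1)))*G + μ*Om α C (4*N*(L/((k:ℝ)+1)))) := by
    have := hh0.const_mul (4*N)
    rw [mul_zero] at this
    filter_upwards [this.eventually (gt_mem_nhds one_pos)] with k hk
    set h := L/((k:ℝ)+1) with hh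
    have hk0 : (0:ℝ) < k+1 := by positivity
    have hhp : 0 < h := by positivity
    have hLk : L = (k+1)*h := by rw [hh]; field_simp
    set w := √(8*C*N*h)*G + μ*Om α C (4*N*h) with hw
    have ind : ∀ j : ℕ, j ≤ k+1 → ∀ y, v (t1+j*h) y ≤ m + j*h*w := by
      intro j
      induction j with
      | zero => intro _ y; simpa using hm y
      | succ j ih =>
        intro hj y
        have hj' : ((j+1:ℕ):ℝ) ≤ k+1 := by exact_mod_cast hj
        push_cast at hj' ⊢
        have := step h (m+j*h*w) (t1+j*h) hhp hk.le (by positivity) (by nlinarith) (ih (by lia)) y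
        rw [← hw] at this
        have e : t1 + (j+1)*h = t1+j*h+h := by ring
        rw [e]; linarith
    have := ind (k+1) le_rfl x
    push_cast at this
    rw [← hLk] at this
    rwa [hLd, add_sub_cancel, ← hLd] at this
  have lim : Tendsto (fun k : ℕ => m + L*(√(8*C*N*(L/((k:ℝ)+1)))*G + μ*Om α C (4*N*(L/((k:ℝ)+1))))) atTop (𝓝 (m + L*(√(8*C*N*0)*G + μ*0))) := by
    refine tendsto_const_nhds.add (((((hh0.const_mul _).sqrt).mul_const _).add ((Om_tendsto h0 h2 hC.le (fun n => by positivity) ?_).const_mul _)).const_mul _)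
    simpa using hh0.const_mul (4*N)
  simpa using ge_of_tendsto lim key
end
section
lemma q_int (A : ℝ) : Integrable (fun x : ℝ => A/(1+x^2)) := by
  simpa [div_eq_mul_inv] using integrable_inv_one_add_sq.const_mul A
lemma fq_int {f φ : ℝ → ℝ} {M A : ℝ} (hf : Measurable f) (hM : ∀ x, |f x| ≤ M) (hφ : Continuous φ) (hb : ∀ x, |φ x| ≤ A/(1+x^2)) :
    Integrable (fun x => f x * φ x) ∧ |∫ x, f x * φ x| ≤ M*A*π := by
  have hn : ∀ x, ‖f x * φ x‖ ≤ M*A/(1+x^2) := fun x => by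
    rw [norm_mul, mul_div_assoc]
    exact mul_le_mul (hM x) (hb x) (abs_nonneg _) ((abs_nonneg _).trans (hM x))
  refine ⟨(q_int (M*A)).mono' (hf.mul hφ.measurable).aestronglyMeasurable (.of_forall hn), ?_⟩
  rw [← norm_eq_abs]
  refine (norm_integral_le_of_norm_le (q_int (M*A)) (.of_forall hn)).trans_eq ?_
  simp_rw [div_eq_mul_inv]
  rw [integral_const_mul, integral_univ_inv_one_add_sq]
def cv (φ f : ℝ → ℝ) (h : ℝ) : ℝ := ∫ y, f y * φ (y-h)
lemma cv_eq (φ f : ℝ → ℝ) (h : ℝ) : cv φ f h = ∫ x, f (x+h) * φ x := by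
  rw [← integral_sub_right_eq_self (fun x => f (x+h) * φ x) h]; simp [cv]
lemma cv_deriv {f φ φ' : ℝ → ℝ} {M A : ℝ} (hf : Measurable f) (hM : ∀ x, |f x| ≤ M) (hφ : ∀ x, HasDerivAt φ (φ' x) x)
    (hc : Continuous φ') (hb0 : ∀ x, |φ x| ≤ A/(1+x^2)) (hb : ∀ x, |φ' x| ≤ A/(1+x^2)) (h : ℝ) : HasDerivAt (cv φ f) (-cv φ' f h) h := by
  have hcφ : Continuous φ := continuous_iff_continuousAt.2 fun x => (hφ x).continuousAt
  have hM0 : 0 ≤ M := (abs_nonneg _).trans (hM 0)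
  have hA : 0 ≤ A := by simpa using (abs_nonneg _).trans (hb 0)
  have e : -cv φ' f h = ∫ y, f y * -φ' (y-h) := by simp [cv, integral_neg]
  rw [e]
  refine (hasDerivAt_integral_of_dominated_loc_of_deriv_le (bound := fun y => 3*(M*A)/(1+(y-h)^2)) (F := fun h y => f y * φ (y-h)) (F' := fun h y => f y * -φ' (y-h)) (Metric.ball_mem_nhds h one_pos) ?_ ?_ ?_ ?_ ?_ ?_).2
  · exact .of_forall fun h => Measurable.aestronglyMeasurable (by fun_prop)
  · have := (fq_int (f := fun x => f (x+h)) (by fun_prop) (fun x => hM _) hcφ hb0).1.comp_sub_right h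
    simpa using this
  · exact Measurable.aestronglyMeasurable (by fun_prop)
  · refine .of_forall fun y k hk => ?_
    rw [norm_mul, norm_neg]
    have h1 : |k-h| < 1 := by simpa [dist_eq] using hk
    have h2 : (k-h)^2 ≤ 1 := by rw [← sq_abs]; nlinarith [abs_nonneg (k-h)]
    calc _ ≤ M*(A/(1+(y-k)^2)) := mul_le_mul (hM y) (hb _) (abs_nonneg _) hM0
      _ = 3*(M*A)/(3*(1+(y-k)^2)) := by field_simp
      _ ≤ _ := by
        refine div_le_div_of_nonneg_left (by positivity) (by positivity) ?_
        nlinarith [sq_nonneg (y-k-(k-h))]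
  · simpa using (q_int (3*(M*A))).comp_sub_right h
  · refine .of_forall fun y k _ => ?_
    exact (((hφ (y-k)).comp_const_sub y k)).const_mul _
lemma cv_Lam {f φ : ℝ → ℝ} {α M A : ℝ} (h0 : 0 < α) (h2 : α < 2) (hf : Measurable f) (hM : ∀ x, |f x| ≤ M) (h : Dec A φ) (x0 : ℝ) :
    ∫ x, f (x+x0) * Lam α φ x = Lam α (cv φ f) x0 := by
  have hm : Measurable (fun x => f (x+x0)) := by fun_prop
  rw [pair_eq]
  unfold Lam
  congr 1
  have := integral_integral_swap (f := fun x r => f (x+x0) * (d2 φ x r / r^(1+α))) (μ := volume) (ν := volume.restrict (Ioi 0)) (pair_int h0 h2 hm (fun x => hM _) h)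
  rw [this]
  refine integral_congr_ae (.of_forall fun r => ?_)
  simp only [← mul_div_assoc]
  rw [integral_div]
  congr 1
  have i : ∀ c, Integrable (fun x => f (x+x0) * φ (x+c)) := fun c => by
    have := (fq_int (f := fun x => f (x+x0-c)) (by fun_prop) (fun x => hM _) h.1.continuous (by simpa using fun x => h.2 0 (by lia) x)).1.comp_add_right c
    simpa [add_right_comm] using this
  have e : ∀ c, ∫ x, f (x+x0) * φ (x+c) = cv φ f (x0-c) := fun c => by
    rw [cv, ← integral_add_right_eq_self (fun y => f y * φ (y-(x0-c))) x0]
    congr 1; ext x; congr 2; ring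
  have e0 := e 0; have e1 := e r; have e2 := e (-r)
  have i0 := i 0; have i1 := i r; have i2 := i (-r)
  simp only [add_zero, sub_zero, sub_neg_eq_add, ← sub_eq_add_neg] at e0 e1 e2 i0 i1 i2
  have t1 := integral_sub ((i0.const_mul 2).sub i1) i2
  have t2 := integral_sub (i0.const_mul 2) i1
  unfold d2
  rw [← e0, ← e1, ← e2, ← integral_const_mul]
  simp only [Pi.sub_apply] at t1
  rw [sub_right_comm, ← t2, ← t1]
  congr 1; ext x; ring
lemma cv_prop {f φ : ℝ → ℝ} {M A : ℝ} (hf : Measurable f) (hM : ∀ x, |f x| ≤ M) (h : Dec A φ) :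
    (∀ x, |cv φ f x| ≤ M*A*π) ∧ (∀ x, HasDerivAt (cv φ f) (-cv (deriv φ) f x) x) ∧ (∀ x, |deriv (cv φ f) x| ≤ M*A*π) ∧
      ∀ x y, |deriv (cv φ f) x - deriv (cv φ f) y| ≤ M*A*π*|x-y| := by
  have b : ∀ k ≤ 3, ∀ x, |cv (iteratedDeriv k φ) f x| ≤ M*A*π := fun k hk x => by
    rw [cv_eq]; exact (fq_int (f := fun y => f (y+x)) (by fun_prop) (fun y => hM _) (cont_iter h.1 k) (h.2 k hk)).2
  have d : ∀ k ≤ 2, ∀ x, HasDerivAt (cv (iteratedDeriv k φ) f) (-cv (iteratedDeriv (k+1) φ) f x) x := fun k hk x =>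
    cv_deriv hf hM (hd_iter h.1 k) (cont_iter h.1 (k+1)) (h.2 k (by lia)) (h.2 (k+1) (by lia)) x
  have d0 := d 0 (by lia)
  have b0 := b 0 (by lia)
  have b1 := b 1 (by lia)
  have d1 := d 1 (by lia)
  simp only [zero_add, iteratedDeriv_zero, iteratedDeriv_one] at d0 b0 b1 d1
  have e : deriv (cv φ f) = fun x => -cv (deriv φ) f x := funext fun x => (d0 x).deriv
  refine ⟨b0, d0, fun x => by rw [e, abs_neg]; exact b1 x, fun x y => ?_⟩
  rw [e]
  exact convex_univ.norm_image_sub_le_of_norm_hasDerivWithin_le (fun z _ => (d1 z).neg.hasDerivWithinAt)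
    (fun z _ => by rw [neg_neg]; exact b 2 (by lia) z) (Set.mem_univ y) (Set.mem_univ x)
end
section
def pk (d x : ℝ) : ℝ := 1/(x^2+d^2)
def pa (d x : ℝ) : ℝ := (d^2-x^2)/(x^2+d^2)^2
section
variable {d : ℝ}
lemma pu (hd : 0 < d) (x : ℝ) : HasDerivAt (fun x => x^2+d^2) (2*x) x := by
  simpa using (hasDerivAt_pow 2 x).add_const (d^2)
lemma pk_d1 (hd : 0 < d) (x : ℝ) : HasDerivAt (pk d) (-2*x/(x^2+d^2)^2) x := by
  have hu : x^2+d^2 ≠ 0 := by positivity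
  exact ((hasDerivAt_const x (1:ℝ)).div (pu hd x) hu).congr_deriv (by ring)
lemma pk_d2 (hd : 0 < d) (x : ℝ) : HasDerivAt (fun x => -2*x/(x^2+d^2)^2) ((6*x^2-2*d^2)/(x^2+d^2)^3) x := by
  have hu : x^2+d^2 ≠ 0 := by positivity
  refine (((hasDerivAt_id x).const_mul (-2)).div ((pu hd x).pow 2) (pow_ne_zero 2 hu)).congr_deriv ?_
  simp only [id, Pi.pow_apply]; field_simp; ring
lemma pk_d3 (hd : 0 < d) (x : ℝ) : HasDerivAt (fun x => (6*x^2-2*d^2)/(x^2+d^2)^3) (24*x*(d^2-x^2)/(x^2+d^2)^4) x := by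
  have hu : x^2+d^2 ≠ 0 := by positivity
  refine ((((hasDerivAt_pow 2 x).const_mul 6).sub_const (2*d^2)).div ((pu hd x).pow 3) (pow_ne_zero 3 hu)).congr_deriv ?_
  simp only [Pi.pow_apply]; field_simp; ring
lemma pk_i (hd : 0 < d) : iteratedDeriv 1 (pk d) = (fun x => -2*x/(x^2+d^2)^2) ∧ iteratedDeriv 2 (pk d) = (fun x => (6*x^2-2*d^2)/(x^2+d^2)^3) ∧
    iteratedDeriv 3 (pk d) = fun x => 24*x*(d^2-x^2)/(x^2+d^2)^4 := by
  have h1 : iteratedDeriv 1 (pk d) = fun x => -2*x/(x^2+d^2)^2 := by rw [iteratedDeriv_one]; exact funext fun x => (pk_d1 hd x).deriv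
  have h2 : iteratedDeriv 2 (pk d) = fun x => (6*x^2-2*d^2)/(x^2+d^2)^3 := by rw [iteratedDeriv_succ, h1]; exact funext fun x => (pk_d2 hd x).deriv
  exact ⟨h1, h2, by rw [iteratedDeriv_succ, h2]; exact funext fun x => (pk_d3 hd x).deriv⟩
lemma pk_bd (hd : 0 < d) (h1 : d ≤ 1) (x : ℝ) : 1/(x^2+d^2) ≤ (1/d^2)/(1+x^2) := by
  rw [div_div]
  refine div_le_div_of_nonneg_left zero_le_one (by positivity) ?_
  nlinarith [sq_nonneg x, mul_le_mul h1 h1 hd.le zero_le_one, mul_nonneg (sq_nonneg x) (show 0 ≤ 1-d^2 by nlinarith)]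
lemma pk_dec (hd : 0 < d) (h1 : d ≤ 1) : Dec (12/d^5) (pk d) := by
  refine ⟨?_, fun k hk x => ?_⟩
  · unfold pk
    exact contDiff_const.div (by fun_prop) fun x => by positivity
  have hu : 0 < x^2+d^2 := by positivity
  have hud : d^2 ≤ x^2+d^2 := by nlinarith
  have hx : 2*|x| * d ≤ x^2+d^2 := by rw [← sq_abs x]; nlinarith [sq_nonneg (|x|-d)]
  have key : ∀ c : ℝ, c*(x^2+d^2)*d^3 ≤ 12 → c ≤ 12/d^5/(1+x^2) := fun c hc => by
    calc c ≤ 12/d^3*(1/(x^2+d^2)) := by rw [← div_eq_mul_one_div, le_div_iff₀ hu, le_div_iff₀ (by positivity)]; exact hc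
      _ ≤ 12/d^3*((1/d^2)/(1+x^2)) := mul_le_mul_of_nonneg_left (pk_bd hd h1 x) (by positivity)
      _ = _ := by field_simp
  obtain ⟨i1, i2, i3⟩ := pk_i hd
  have hd3 : d^3 ≤ 1 := pow_le_one₀ hd.le h1
  set u := x^2+d^2 with hud'
  have hp : |d^2-x^2| ≤ u := abs_le.2 ⟨by nlinarith, by nlinarith⟩
  interval_cases k
  · rw [iteratedDeriv_zero]
    apply key
    unfold pk
    rw [← hud', abs_of_pos (by positivity), one_div, inv_mul_cancel₀ hu.ne']; linarith
  · rw [i1]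
    apply key
    simp only []
    rw [← hud', abs_div, abs_of_pos (pow_pos hu 2), abs_mul, abs_neg, abs_two]
    rw [show 2*|x|/u^2*u*d^3 = 2*|x| * d*d^2/u by field_simp, div_le_iff₀ hu]
    nlinarith [mul_le_mul hx (show d^2 ≤ 1 by nlinarith) (by positivity) hu.le]
  · rw [i2]
    apply key
    simp only []
    rw [← hud', abs_div, abs_of_pos (pow_pos hu 3)]
    have h6 : |6*x^2-2*d^2| ≤ 6*u := abs_le.2 ⟨by nlinarith, by nlinarith⟩
    rw [show |6*x^2-2*d^2|/u^3*u*d^3 = |6*x^2-2*d^2| * d^3/u^2 by field_simp, div_le_iff₀ (by positivity)]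
    calc _ ≤ 6*u*(u*1) := by gcongr; nlinarith
      _ ≤ _ := by nlinarith
  · rw [i3]
    apply key
    simp only []
    rw [← hud', abs_div, abs_of_pos (pow_pos hu 4), abs_mul, abs_mul, show |(24:ℝ)| = 24 by norm_num]
    rw [show 24*|x| * |d^2-x^2|/u^4*u*d^3 = 12*(2*|x| * d)*|d^2-x^2| * d^2/u^3 by field_simp; ring, div_le_iff₀ (by positivity)]
    calc _ ≤ 12*u*u*u := by gcongr
      _ = _ := by ring
lemma pa_bd (hd : 0 < d) (h1 : d ≤ 1) (x : ℝ) : |pa d x| ≤ (12/d^5)/(1+x^2) := by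
  have hu : 0 < x^2+d^2 := by positivity
  have hp : |d^2-x^2| ≤ x^2+d^2 := abs_le.2 ⟨by nlinarith [sq_nonneg d], by nlinarith [sq_nonneg x]⟩
  have b := (pk_dec hd h1).b0 x
  refine le_trans ?_ ((le_abs_self _).trans b)
  rw [pa, pk, abs_div, abs_of_pos (pow_pos hu 2), div_le_div_iff₀ (by positivity) hu]
  nlinarith
lemma kap_pk (hd : 0 < d) (h1 : d ≤ 1) (x s : ℝ) : kap (pk d) x s = -(deriv (pk d) x * pa d s + deriv (pk d) s * pa d x) := by
  have ux : x^2+d^2 ≠ 0 := by positivity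
  have us : s^2+d^2 ≠ 0 := by positivity
  rw [(pk_d1 hd x).deriv, (pk_d1 hd s).deriv]
  rcases eq_or_ne x s with rfl | h
  · unfold kap pa
    rw [(pk_i hd).2.2]
    simp only [sub_self, mul_zero, add_zero]
    rw [intervalIntegral.integral_mul_const]
    have : ∫ θ in (0:ℝ)..1, θ*(1-θ) = 1/6 := by
      simp_rw [mul_sub, mul_one, ← sq]
      rw [intervalIntegral.integral_sub (by simp) (by simp)]; norm_num
    rw [this]; field_simp; ring
  · have hxs : x - s ≠ 0 := sub_ne_zero.2 h
    rw [kap_formula (pk_dec hd h1).1 h, (pk_d1 hd x).deriv, (pk_d1 hd s).deriv]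
    unfold pk pa
    field_simp; ring
lemma QB_pk (hd : 0 < d) (h1 : d ≤ 1) {f : ℝ → ℝ} {M : ℝ} (hf : Measurable f) (hM : ∀ x, |f x| ≤ M) :
    QB (pk d) f f = -(∫ x, f x * deriv (pk d) x) * ((1/π) * ∫ x, f x * pa d x) := by
  have hD := pk_dec hd h1
  have c1 : Continuous (deriv (pk d)) := by simpa using cont_iter hD.1 1
  have i1 := (fq_int hf hM c1 (by simpa using hD.2 1 (by lia))).1
  have ca : Continuous (pa d) := by unfold pa; exact Continuous.div (by fun_prop) (by fun_prop) fun x => by positivity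
  have i2 := (fq_int hf hM ca (pa_bd hd h1)).1
  have e : ∀ p : ℝ × ℝ, f p.1 * f p.2 * kap (pk d) p.1 p.2 = -((f p.1 * deriv (pk d) p.1) * (f p.2 * pa d p.2) + (f p.1 * pa d p.1) * (f p.2 * deriv (pk d) p.2)) := fun p => by
    rw [kap_pk hd h1]; ring
  unfold QB
  simp_rw [e]
  rw [integral_neg, Measure.volume_eq_prod]
  have t := integral_add (i1.mul_prod i2) (i2.mul_prod i1)
  rw [t, integral_prod_mul (fun x => f x * deriv (pk d) x) fun x => f x * pa d x, integral_prod_mul (fun x => f x * pa d x) fun x => f x * deriv (pk d) x]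
  field_simp; ring
end
end
section
lemma cut_CB : ∃ X, 0 ≤ X ∧ ∀ k : ℝ, 1 ≤ k → CB 3 X (cut k) := by
  have hc : Cc chi0 := ⟨chi0.contDiff, chi0.hasCompactSupport⟩
  choose A hA hb using fun j => (hc.iter j).bd
  refine ⟨A 0 + A 1 + A 2 + A 3, by have := hA 0; have := hA 1; have := hA 2; have := hA 3; positivity, fun k hk j hj x => ?_⟩
  have e : cut k = fun x => chi0 (k⁻¹ * x) := by ext x; rw [cut, div_eq_inv_mul]
  rw [e, iteratedDeriv_comp_const_mul (cd_le hc.1 j)]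
  simp only []
  have h1 : |k⁻¹^j| ≤ 1 := by
    rw [abs_of_pos (by positivity)]
    exact pow_le_one₀ (by positivity) (inv_le_one_of_one_le₀ hk)
  have h2 : A j ≤ A 0 + A 1 + A 2 + A 3 := by
    have := hA 0; have := hA 1; have := hA 2; have := hA 3
    interval_cases j <;> linarith
  rw [abs_mul]
  calc _ ≤ 1 * A j := mul_le_mul h1 (hb j _) (abs_nonneg _) zero_le_one
    _ ≤ _ := by linarith
lemma Dec.mulCB {f g : ℝ → ℝ} (hf : ContDiff ℝ (⊤:ℕ∞) f) {X A : ℝ} (hX : CB 3 X f) (hg : Dec A g) : Dec (8*X*A) (fun x => f x * g x) := by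
  refine ⟨hf.mul hg.1, fun k hk x => ?_⟩
  have hX0 : 0 ≤ X := (abs_nonneg _).trans (hX 0 (by norm_num) 0)
  have hY0 : 0 ≤ A/(1+x^2) := div_nonneg hg.nonneg (by positivity)
  have e : iteratedDeriv k (fun x => f x * g x) x = _ := iteratedDeriv_mul (n := k) (x := x) (cd_le hf k).contDiffAt (cd_le hg.1 k).contDiffAt
  rw [e]
  refine (Finset.abs_sum_le_sum_abs _ _).trans ?_
  have : ∀ i ∈ Finset.range (k+1), |(k.choose i : ℝ) * iteratedDeriv i f x * iteratedDeriv (k-i) g x| ≤ (k.choose i : ℝ) * (X*(A/(1+x^2))) := by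
    intro i hi
    have hi := Finset.mem_range.1 hi
    rw [mul_assoc, abs_mul, abs_mul, Nat.abs_cast]
    exact mul_le_mul_of_nonneg_left (mul_le_mul (hX i (by lia) x) (hg.2 (k-i) (by lia) x) (abs_nonneg _) hX0) (by positivity)
  refine (Finset.sum_le_sum this).trans ?_
  rw [← Finset.sum_mul, ← Nat.cast_sum, Nat.sum_range_choose]
  have : ((2^k : ℕ) : ℝ) ≤ 8 := by
    have : (2^k : ℕ) ≤ 2^3 := Nat.pow_le_pow_right (by norm_num) hk
    exact_mod_cast this
  rw [mul_div_assoc]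
  nlinarith [mul_nonneg hX0 hY0]
lemma qq_cut {α A A' M : ℝ} (μ : ℝ) (h0 : 0 < α) (h2 : α < 2) {φ f : ℝ → ℝ} {F : ℕ → ℝ → ℝ} (h : Dec A φ) (hF : ∀ k, Dec A' (F k))
    (he : ∀ R, ∀ᶠ k in atTop, ∀ x, |x| < R → F k x = φ x) (hf : Measurable f) (hM : ∀ x, |f x| ≤ M) :
    Tendsto (fun k => qq α μ (F k) f) atTop (𝓝 (qq α μ φ f)) := by
  have hM0 : 0 ≤ M := (abs_nonneg _).trans (hM 0)
  refine Tendsto.sub (Tendsto.const_mul _ ?_) (Tendsto.const_mul _ ?_)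
  · rw [Measure.volume_eq_prod]
    refine tendsto_integral_of_dominated_convergence (fun p => M*M*(16*A')*kb p.1 p.2) (fun k => ?_) (kb_int.const_mul _) (fun k => ?_) (.of_forall fun p => ?_)
    · have := (QB_int (hF k) hf hf hM hM).1
      rwa [Measure.volume_eq_prod] at this
    · refine .of_forall fun p => ?_
      rw [norm_mul, norm_mul, mul_assoc (M*M)]
      exact mul_le_mul (mul_le_mul (hM _) (hM _) (norm_nonneg _) hM0) (kap_bd (hF k) _ _) (norm_nonneg _) (by positivity)
    · refine tendsto_const_nhds.congr' ?_
      filter_upwards [he (|p.1|+|p.2|+1)] with k hk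
      congr 1
      unfold kap
      refine intervalIntegral.integral_congr fun θ hθ => ?_
      rw [Set.uIcc_of_le zero_le_one] at hθ
      congr 1
      refine Filter.EventuallyEq.iteratedDeriv_eq 3 ?_
      have o : IsOpen {y : ℝ | |y| < |p.1|+|p.2|+1} := isOpen_lt continuous_abs continuous_const
      filter_upwards [o.mem_nhds (x := p.2+θ*(p.1-p.2)) (by
        have e : p.2+θ*(p.1-p.2) = (1-θ)*p.2+θ*p.1 := by ring
        rw [Set.mem_ofPred_eq, e]
        refine (abs_add_le _ _).trans_lt ?_
        rw [abs_mul, abs_mul, abs_of_nonneg hθ.1, abs_of_nonneg (sub_nonneg.2 hθ.2)]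
        nlinarith [hθ.1, hθ.2, abs_nonneg p.1, abs_nonneg p.2])] with y hy
      exact (hk y hy).symm
  · have e : ∀ (ψ : ℝ → ℝ) (C : ℝ), Dec C ψ → ∫ x, f x * Lam α ψ x = (1/π) * ∫ p : ℝ × ℝ, f p.1 * (d2 ψ p.1 p.2 / p.2^(1+α)) ∂(volume.prod nu) := fun ψ C hψ => by
      rw [pair_eq, integral_prod _ (pair_int h0 h2 hf hM hψ)]
    simp_rw [e φ A h, fun k => e (F k) A' (hF k)]
    refine Tendsto.const_mul _ ?_
    refine tendsto_integral_of_dominated_convergence _ (fun k => (pair_int h0 h2 hf hM (hF k)).1) ((hh_int h0 h2).const_mul (M * (4*A'))) (fun k => ae_nu fun x r hr => ?_) (.of_forall fun p => ?_)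
    · rw [norm_mul, mul_assoc M]
      exact mul_le_mul (hM x) (dec_wk (hF k) x hr) (norm_nonneg _) hM0
    · refine tendsto_const_nhds.congr' ?_
      filter_upwards [he (|p.1|+|p.2|+1)] with k hk
      have a := abs_nonneg p.1; have b := abs_nonneg p.2
      unfold d2
      rw [hk _ (by linarith), hk _ ((abs_add_le _ _).trans_lt (by linarith)), hk _ ((abs_sub _ _).trans_lt (by linarith))]
section
variable {α μ : ℝ} {B : ℝ → ℝ → ℝ}
lemma Sol.weakD (S : Sol α μ B) {t A : ℝ} (ht : 0 < t) {φ : ℝ → ℝ} (h : Dec A φ) : HasDerivAt (fun t => ∫ x, B t x * φ x) (qq α μ φ (B t)) t := by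
  obtain ⟨X, hX0, hX⟩ := cut_CB
  let F : ℕ → ℝ → ℝ := fun k x => cut (k+1) x * φ x
  have hF : ∀ k, Dec (8*X*A) (F k) := fun k => Dec.mulCB (cut_smooth _) (hX _ (by simp)) h
  have hFc : ∀ k, Cc (F k) := fun k => (cut_Cc (by positivity)).mul h.1
  have he : ∀ R, ∀ᶠ k in atTop, ∀ x, |x| < R → F k x = φ x := fun R => by
    filter_upwards [eventually_ge_atTop ⌈R⌉₊] with k hk x hx
    have : R ≤ k := Nat.ceil_le.1 hk
    simp only [F]
    rw [cut_one (by positivity) (by linarith), one_mul]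
  obtain ⟨M, hM0, hM⟩ := S.bdd (t+1) (by linarith)
  obtain ⟨C, hC0, hC⟩ := qq_bd S.h0 S.h2 S.hμ M hM0
  have hm : ∀ s, 0 ≤ s → Measurable (B s) := fun s hs => (S.smooth s hs).continuous.measurable
  have hii : ∀ {ψ : ℝ → ℝ} {A' : ℝ}, Dec A' ψ → ∀ b, 0 < b → IntervalIntegrable (fun τ => qq α μ ψ (B τ)) volume t b := fun hψ b hb =>
    ((S.qq_cont hψ).mono fun s hs => (lt_min ht hb).le.trans hs.1).intervalIntegrable
  have key : ∀ b, 0 < b → b < t+1 → ∫ x, B b x * φ x = (∫ x, B t x * φ x) + ∫ τ in t..b, qq α μ φ (B τ) := by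
    intro b hb hb1
    have hu : ∀ τ ∈ uIcc t b, τ ∈ Icc 0 (t+1) := fun τ hτ => ⟨(lt_min ht hb).le.trans hτ.1, hτ.2.trans (max_le (by linarith) hb1.le)⟩
    have l : ∀ s ∈ Icc 0 (t+1), Tendsto (fun k => ∫ x, B s x * F k x) atTop (𝓝 (∫ x, B s x * φ x)) := fun s hs => by
      have hn : ∀ k x, ‖B s x * F k x‖ ≤ M*(A/(1+x^2)) := fun k x => by
        rw [norm_mul, norm_mul]
        refine mul_le_mul (hM s hs x) ?_ (by positivity) hM0
        calc _ ≤ 1 * |φ x| := mul_le_mul_of_nonneg_right (cut_abs _ _) (abs_nonneg _)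
          _ ≤ _ := by rw [one_mul]; exact h.b0 x
      refine tendsto_integral_of_dominated_convergence _ (fun k => ((S.smooth s hs.1).continuous.mul (hF k).1.continuous).aestronglyMeasurable) ((q_int A).const_mul M)
        (fun k => .of_forall (hn k)) (.of_forall fun x => ?_)
      refine tendsto_const_nhds.congr' ?_
      filter_upwards [he (|x|+1)] with k hk
      rw [hk x (by linarith)]
    have l2 : Tendsto (fun k => ∫ τ in t..b, qq α μ (F k) (B τ)) atTop (𝓝 (∫ τ in t..b, qq α μ φ (B τ))) := by
      refine intervalIntegral.tendsto_integral_filter_of_dominated_convergence (fun _ => C*(8*X*A)) ?_ ?_ (by simp) ?_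
      · exact .of_forall fun k => (intervalIntegrable_iff.1 (hii (hF k) b hb)).1
      · refine .of_forall fun k => .of_forall fun τ hτ => ?_
        have := hu τ (Set.uIoc_subset_uIcc hτ)
        exact (hC _ _ _ (hF k) (hm τ this.1) (hM τ this)).2.2
      · refine .of_forall fun τ hτ => ?_
        have := hu τ (Set.uIoc_subset_uIcc hτ)
        exact qq_cut μ S.h0 S.h2 h hF he (hm τ this.1) (hM τ this)
    refine tendsto_nhds_unique (l b ⟨hb.le, hb1.le⟩) (((l t ⟨ht.le, by linarith⟩).add l2).congr fun k => ?_)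
    rw [intervalIntegral.integral_eq_sub_of_hasDerivAt (f := fun s => ∫ x, B s x * F k x) (fun s hs => S.weak ((lt_min ht hb).trans_le hs.1) (hFc k)) (hii (hF k) b hb)]
    ring
  have hcq : ContinuousAt (fun τ => qq α μ φ (B τ)) t := (S.qq_cont h).continuousAt (Ici_mem_nhds ht)
  have d := intervalIntegral.integral_hasDerivAt_right (f := fun τ => qq α μ φ (B τ)) (hii h t ht)
    (((S.qq_cont h).mono (Set.Ioi_subset_Ici_self)).stronglyMeasurableAtFilter isOpen_Ioi t ht) hcq
  refine (d.const_add (∫ x, B t x * φ x)).congr_of_eventuallyEq ?_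
  filter_upwards [Ioo_mem_nhds ht (lt_add_one t)] with b hb
  exact key b hb.1 hb.2
lemma Lam_shift (α : ℝ) (f : ℝ → ℝ) (c x : ℝ) : Lam α (fun x => f (x+c)) x = Lam α f (x+c) := by
  unfold Lam d2
  simp only [add_right_comm, sub_add_eq_add_sub]
lemma Sol.shift (S : Sol α μ B) (c : ℝ) : Sol α μ (fun t x => B t (x+c)) where
  h0 := S.h0
  h2 := S.h2
  hμ := S.hμ
  smooth t ht := (S.smooth t ht).comp (contDiff_id.add contDiff_const)
  diff t ht x := S.diff t ht (x+c)
  eq t ht := by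
    filter_upwards [(measurePreserving_add_right volume c).quasiMeasurePreserving.ae (S.eq t ht)] with x hx
    unfold GG at hx ⊢
    rwa [Lam_shift, Lam_shift, deriv_comp_add_const]
  cont x := S.cont (x+c)
  bdd T hT := let ⟨M, h, hM⟩ := S.bdd T hT; ⟨M, h, fun t ht x => hM t ht (x+c)⟩
end
end
section
section
variable {α μ : ℝ} {B : ℝ → ℝ → ℝ}
lemma Lam_smul (α c : ℝ) (f : ℝ → ℝ) (x : ℝ) : Lam α (fun x => c * f x) x = c * Lam α f x := by
  unfold Lam
  rw [mul_left_comm, ← integral_const_mul c]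
  congr 1
  refine (integral_congr_ae (.of_forall fun r => ?_))
  simp only [d2]; ring
lemma Sol.pois (S : Sol α μ B) {d c : ℝ} (hd : 0 < d) (h1 : d ≤ 1) (hc : |c| = 1) {t1 t2 m : ℝ} (ht1 : 0 ≤ t1) (ht : t1 ≤ t2)
    (hm : ∀ y, c * cv (pk d) (B t1) y ≤ m) (x : ℝ) : c * cv (pk d) (B t2) x ≤ m := by
  obtain ⟨M, hM0, hM⟩ := S.bdd (t2+1) (by linarith)
  have hD := pk_dec hd h1
  have hms : ∀ s, 0 ≤ s → Measurable (B s) := fun s hs => (S.smooth s hs).continuous.measurable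
  have P := fun t (ht : t ∈ Icc 0 (t2+1)) => cv_prop (hms t ht.1) (hM t ht) hD
  set K := M*(12/d^5)*π with hK
  have hK0 : 0 ≤ K := by positivity
  have ca : Continuous (pa d) := by unfold pa; exact Continuous.div (by fun_prop) (by fun_prop) fun x => by positivity
  have io : ∀ {t}, t ∈ Ioc 0 (t2+1) → t ∈ Icc 0 (t2+1) := fun h => ⟨h.1.le, h.2⟩
  have hdv : ∀ t ∈ Icc 0 (t2+1), ∀ x, HasDerivAt (fun x => c * cv (pk d) (B t) x) (c * deriv (cv (pk d) (B t)) x) x := fun t ht x => by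
    rw [((P t ht).2.1 x).deriv]; exact ((P t ht).2.1 x).const_mul c
  refine maxP (v := fun t x => c * cv (pk d) (B t) x) (g := fun t x => (1/π) * ∫ y, B t (y+x) * pa d y) (G := (1/π) * K) (C := K+1) (M := K) (C1 := K) (T := t2+1)
    S.h0 S.h2 S.hμ (by positivity) (by positivity) (fun t ht x => ?_) (fun t ht x => ?_) (fun x => ?_) (fun t ht x => (hdv t ht x).differentiableAt) (fun t ht x => ?_) (fun t ht x y => ?_) (fun t ht x => ?_) ht1 ht (by linarith) hm x
  · have hmt := hms t ht.1.le
    rw [abs_mul, abs_of_pos (by positivity)]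
    gcongr
    exact (fq_int (f := fun y => B t (y+x)) (by fun_prop) (fun y => hM t (io ht) _) ca (pa_bd hd h1)).2
  · have hmt := hms t ht.1.le
    have w := ((S.shift x).weakD ht.1 hD).const_mul c
    simp_rw [← cv_eq] at w
    refine w.congr_deriv ?_
    rw [(hdv t (io ht) x).deriv, Lam_smul, ((P t (io ht)).2.1 x).deriv, qq, QB_pk hd h1 (by fun_prop) (fun y => hM t (io ht) _), cv_Lam S.h0 S.h2 hmt (hM t (io ht)) hD, cv_eq (deriv _)]
    ring
  · have := (S.shift x).pair_cont (g := pk d) ?_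
    · simp_rw [← cv_eq] at this
      exact (continuousOn_const.mul this).mono fun s hs => hs.1
    · exact (q_int _).mono' hD.1.continuous.aestronglyMeasurable (.of_forall hD.b0)
  · rw [(hdv t ht x).deriv, abs_mul, hc, one_mul]; exact (P t ht).2.2.1 x
  · rw [(hdv t ht x).deriv, (hdv t ht y).deriv, ← mul_sub, abs_mul, hc, one_mul]
    refine ((P t ht).2.2.2 x y).trans ?_
    gcongr; linarith
  · rw [abs_mul, hc, one_mul]; exact (P t ht).1 x
lemma cv_pk {d : ℝ} (hd : 0 < d) (f : ℝ → ℝ) (x : ℝ) : d * cv (pk d) f x = ∫ z, f (d*z+x) * (1+z^2)⁻¹ := by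
  have := Measure.integral_comp_mul_left (fun y => f (y+x) * pk d y) d
  rw [cv_eq, smul_eq_mul, abs_of_pos (inv_pos.2 hd)] at *
  have e : d * ∫ y, f (y+x) * pk d y = d^2 * (d⁻¹ * ∫ y, f (y+x) * pk d y) := by field_simp
  rw [e, ← this, ← integral_const_mul]
  congr 1; ext z; unfold pk
  have : 1+z^2 ≠ 0 := by positivity
  rw [show (d*z)^2+d^2 = d^2*(1+z^2) by ring]; field_simp
lemma fz_int {f : ℝ → ℝ} {M : ℝ} (hf : Measurable f) (hM : ∀ x, |f x| ≤ M) (d x : ℝ) : Integrable (fun z => f (d*z+x) * (1+z^2)⁻¹) :=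
  integrable_inv_one_add_sq.bdd_mul (c := M) (Measurable.aestronglyMeasurable (by fun_prop)) (.of_forall fun x => hM _)
lemma Sol.le (S : Sol α μ B) {c : ℝ} (hc : |c| = 1) {t1 t2 m : ℝ} (ht1 : 0 ≤ t1) (ht : t1 ≤ t2)
    (hm : ∀ y, c * B t1 y ≤ m) (x : ℝ) : c * B t2 x ≤ m := by
  obtain ⟨M, hM0, hM⟩ := S.bdd (t2+1) (by linarith)
  have hms : ∀ s, 0 ≤ s → Measurable (B s) := fun s hs => (S.smooth s hs).continuous.measurable
  have i1 : t1 ∈ Icc 0 (t2+1) := ⟨ht1, by linarith⟩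
  have i2 : t2 ∈ Icc 0 (t2+1) := ⟨ht1.trans ht, by linarith⟩
  have key : ∀ n : ℕ, c * ∫ z, B t2 (1/((n:ℝ)+1)*z+x) * (1+z^2)⁻¹ ≤ m * π := fun n => by
    have hd : 0 < 1/((n:ℝ)+1) := by positivity
    have hd1 : 1/((n:ℝ)+1) ≤ 1 := by rw [div_le_one (by positivity)]; linarith [(Nat.cast_nonneg n : (0:ℝ) ≤ n)]
    set d := 1/((n:ℝ)+1)
    have := S.pois hd hd1 hc ht1 ht (m := m * π / d) (fun y => ?_) x
    · rw [le_div_iff₀ hd] at this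
      rw [← cv_pk hd]; linarith
    · rw [le_div_iff₀ hd, mul_assoc, mul_comm _ d, cv_pk hd, ← integral_univ_inv_one_add_sq, ← integral_const_mul, ← integral_const_mul]
      refine integral_mono ((fz_int (hms t1 ht1) (hM t1 i1) d y).const_mul c) (integrable_inv_one_add_sq.const_mul m) fun z => ?_
      simp only []
      rw [← mul_assoc]
      exact mul_le_mul_of_nonneg_right (hm _) (by positivity)
  have lim : Tendsto (fun n : ℕ => ∫ z, B t2 (1/((n:ℝ)+1)*z+x) * (1+z^2)⁻¹) atTop (𝓝 (∫ z, B t2 x * (1+z^2)⁻¹)) := by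
    refine tendsto_integral_of_dominated_convergence (fun z => M*(1+z^2)⁻¹) (fun n => (fz_int (hms t2 i2.1) (hM t2 i2) _ x).1) (integrable_inv_one_add_sq.const_mul M)
      (fun n => .of_forall fun z => ?_) (.of_forall fun z => Tendsto.mul_const _ ?_)
    · rw [norm_mul, norm_of_nonneg (show 0 ≤ (1+z^2)⁻¹ by positivity)]
      exact mul_le_mul_of_nonneg_right (hM t2 i2 _) (by positivity)
    · refine ((S.smooth t2 i2.1).continuous.tendsto x).comp ?_
      simpa using ((tendsto_one_div_add_atTop_nhds_zero_nat (𝕜 := ℝ)).mul_const z).add_const x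
  have := le_of_tendsto' (lim.const_mul c) key
  rw [integral_const_mul, integral_univ_inv_one_add_sq, ← mul_assoc] at this
  exact le_of_mul_le_mul_right this pi_pos
end
end
/-- **Lemma 6.1 (maximum principle).** Let `0 < α < 2`, `μ ≥ 0`, and let `B` be a
smooth, locally (in time) bounded solution of `B_t + J B_x + μ Λ^α B = 0`,
`B_x = ℋ J` with initial data `B₀ = B(·,0) ∈ L^∞`.  Then
`‖B(t)‖_{L^∞} ≤ ‖B₀‖_{L^∞}` for all `t ≥ 0`; more precisely, for all
`0 ≤ t₁ ≤ t₂`, `sup_x B(x,t₁) = sup_{(x,t) ∈ [t₁,t₂] × ℝ} B(x,t)` and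
`inf_x B(x,t₁) = inf_{(x,t) ∈ [t₁,t₂] × ℝ} B(x,t)`. -/
theorem maximum_principle (α μ : ℝ) (hα : α ∈ Set.Ioo (0 : ℝ) 2) (hμ : 0 ≤ μ)
    (B J LB : ℝ → ℝ → ℝ)
    (hBiotSavart : ∀ t : ℝ, 0 < t → IsHilbertPV (J t) (deriv (B t)))
    (hLap : ∀ t : ℝ, 0 < t → IsFracLapPV α (B t) (LB t))
    (heq : ∀ x : ℝ, ∀ t : ℝ, 0 < t →
      HasDerivAt (fun τ : ℝ => B τ x) (-(J t x * deriv (B t) x + μ * LB t x)) t)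
    (hsmooth : ∀ t : ℝ, 0 ≤ t → ContDiff ℝ (⊤ : ℕ∞) (B t))
    (hcont : ∀ x : ℝ, ContinuousWithinAt (fun τ : ℝ => B τ x) (Set.Ici 0) 0)
    (hbdd : ∀ T : ℝ, 0 < T → ∃ M : ℝ, ∀ t ∈ Set.Icc (0 : ℝ) T, ∀ x : ℝ, |B t x| ≤ M) :
    (∀ M : ℝ, (∀ x : ℝ, |B 0 x| ≤ M) → ∀ t : ℝ, 0 ≤ t → ∀ x : ℝ, |B t x| ≤ M) ∧
    (∀ t₁ t₂ : ℝ, 0 ≤ t₁ → t₁ ≤ t₂ →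
      sSup (Set.range (B t₁)) =
          sSup {y : ℝ | ∃ t ∈ Set.Icc t₁ t₂, ∃ x : ℝ, B t x = y} ∧
        sInf (Set.range (B t₁)) =
          sInf {y : ℝ | ∃ t ∈ Set.Icc t₁ t₂, ∃ x : ℝ, B t x = y}) := by
  have ⟨h0, h2⟩ := hα
  have c2 : ∀ t, 0 ≤ t → ContDiff ℝ 2 (B t) := fun t ht => cd_le (hsmooth t ht) 2
  have S : Sol α μ B := by
    refine ⟨h0, h2, hμ, hsmooth, fun t ht x => (heq x t ht).differentiableAt, fun t ht => ?_, fun x t ht => ?_, fun T hT => ?_⟩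
    · obtain ⟨M, hM⟩ := hbdd t ht
      have hMt := hM t ⟨ht.le, le_rfl⟩
      filter_upwards [hilbert_main (J t) (B t) M (c2 t ht.le) hMt (hBiotSavart t ht)] with x hx
      refine (heq x t ht).congr_deriv ?_
      rw [hx, Lam_of_pv h0 h2 (c2 t ht.le) hMt (hLap t ht) x, GG]; ring
    · rcases (Set.mem_Ici.1 ht).eq_or_lt with rfl | h
      · exact hcont x
      · exact (heq x t h).continuousAt.continuousWithinAt
    · obtain ⟨M, hM⟩ := hbdd T hT
      exact ⟨M, (abs_nonneg _).trans (hM 0 ⟨le_rfl, hT.le⟩ 0), hM⟩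
  have up : ∀ {t₁ t₂ m : ℝ}, 0 ≤ t₁ → t₁ ≤ t₂ → (∀ y, B t₁ y ≤ m) → ∀ x, B t₂ x ≤ m := fun a b hm x => by
    simpa using S.le (c := 1) (by simp) a b (by simpa using hm) x
  have lo : ∀ {t₁ t₂ m : ℝ}, 0 ≤ t₁ → t₁ ≤ t₂ → (∀ y, m ≤ B t₁ y) → ∀ x, m ≤ B t₂ x := fun {t₁ t₂ m} a b hm x => by
    have := S.le (c := -1) (m := -m) (by simp) a b (fun y => by linarith [hm y]) x
    linarith
  refine ⟨fun M hM t ht x => abs_le.2 ⟨lo le_rfl ht (fun y => (abs_le.1 (hM y)).1) x, up le_rfl ht (fun y => (abs_le.1 (hM y)).2) x⟩, fun t₁ t₂ ht₁ ht => ?_⟩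
  obtain ⟨M, hM⟩ := hbdd (t₁+1) (by linarith)
  have hMt := fun x => abs_le.1 (hM t₁ ⟨ht₁, by linarith⟩ x)
  have ba : BddAbove (Set.range (B t₁)) := ⟨M, by rintro _ ⟨x, rfl⟩; exact (hMt x).2⟩
  have bb : BddBelow (Set.range (B t₁)) := ⟨-M, by rintro _ ⟨x, rfl⟩; exact (hMt x).1⟩
  have u : ∀ y ∈ {y : ℝ | ∃ t ∈ Set.Icc t₁ t₂, ∃ x : ℝ, B t x = y}, y ≤ sSup (Set.range (B t₁)) := by
    rintro _ ⟨t, ht, x, rfl⟩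
    exact up ht₁ ht.1 (fun y => le_csSup ba ⟨y, rfl⟩) x
  have l : ∀ y ∈ {y : ℝ | ∃ t ∈ Set.Icc t₁ t₂, ∃ x : ℝ, B t x = y}, sInf (Set.range (B t₁)) ≤ y := by
    rintro _ ⟨t, ht, x, rfl⟩
    exact lo ht₁ ht.1 (fun y => csInf_le bb ⟨y, rfl⟩) x
  have sb : Set.range (B t₁) ⊆ {y : ℝ | ∃ t ∈ Set.Icc t₁ t₂, ∃ x : ℝ, B t x = y} := by
    rintro _ ⟨x, rfl⟩
    exact ⟨t₁, ⟨le_rfl, ht⟩, x, rfl⟩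
  have ne := Set.range_nonempty (B t₁)
  exact ⟨le_antisymm (csSup_le_csSup ⟨_, u⟩ ne sb) (csSup_le (ne.mono sb) u),
    le_antisymm (le_csInf (ne.mono sb) l) (csInf_le_csInf ⟨_, l⟩ ne sb)⟩
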